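/- arXiv:2509.24442 — 3 statements merged into one kernel-verified Lean document; each statement's English description precedes it below -/
import Mathlib

section
/- There exists a constant C > 0, depending only on n, λ, Λ and p, such that the following holds. Let u be a nonnegative bounded continuous function on B₁ and let f be continuous on B₁ with ‖f‖_{Lⁿ(B₁)} < ∞. Suppose u satisfies both M⁻_{λ,Λ}(D_p(Du) D²u D_p(Du)) − Λ|Du|^{p+1} ≤ f and M⁺_{λ,Λ}(D_p(Du) D²u D_p(Du)) + Λ|Du|^{p+1} ≥ f in B₁ in the viscosity sense. Then sup_{B_{1/2}} u ≤ C·(inf_{B_{1/2}} u + ‖f‖_{Lⁿ(B₁)}^{1/(1+p)}). -/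
open MeasureTheory Metric Set

noncomputable section

/-- Euclidean space ℝⁿ. -/
abbrev En (n : ℕ) := EuclideanSpace ℝ (Fin n)

/-- The Pucci extremal operator `M⁻_{λ,Λ}(M) = λ·Σ_{e>0} e + Λ·Σ_{e<0} e`. -/
noncomputable def pucciInf {ι : Type*} [Fintype ι] [DecidableEq ι] (lam Lam : ℝ)
    (M : Matrix ι ι ℝ) : ℝ :=
  if h : M.IsHermitian then
    ∑ i, (lam * max (h.eigenvalues i) 0 + Lam * min (h.eigenvalues i) 0)
  else 0

/-- The Pucci extremal operator `M⁺_{λ,Λ}(M) = Λ·Σ_{e>0} e + λ·Σ_{e<0} e`. -/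
noncomputable def pucciSup {ι : Type*} [Fintype ι] [DecidableEq ι] (lam Lam : ℝ)
    (M : Matrix ι ι ℝ) : ℝ :=
  if h : M.IsHermitian then
    ∑ i, (Lam * max (h.eigenvalues i) 0 + lam * min (h.eigenvalues i) 0)
  else 0

/-- The gradient vector `Dψ(x)` of coordinatewise partial derivatives. -/
noncomputable def gradVec {n : ℕ} (ψ : En n → ℝ) (x : En n) : Fin n → ℝ :=
  fun i => fderiv ℝ ψ x (EuclideanSpace.single i 1)

/-- The Hessian matrix `D²ψ(x)` of second partial derivatives. -/
noncomputable def hessMat {n : ℕ} (ψ : En n → ℝ) (x : En n) : Matrix (Fin n) (Fin n) ℝ :=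
  Matrix.of fun i j =>
    fderiv ℝ (fun y => fderiv ℝ ψ y (EuclideanSpace.single j 1)) x (EuclideanSpace.single i 1)

/-- `D_p(z) = diag(|z₁|^{p/2},…,|zₙ|^{p/2})`. -/
noncomputable def Dp {n : ℕ} (p : ℝ) (z : Fin n → ℝ) : Matrix (Fin n) (Fin n) ℝ :=
  Matrix.diagonal fun i => |z i| ^ (p / 2)

/-- Euclidean norm of a vector of `Fin n → ℝ`. -/
noncomputable def vnorm {n : ℕ} (v : Fin n → ℝ) : ℝ := Real.sqrt (∑ i, v i ^ 2)

/-- `u` satisfies `M⁻_{λ,Λ}(D_p(Du) D²u D_p(Du)) − Λ|Du|^{p+1} ≤ f` in `Ω`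
in the viscosity sense. -/
def IsViscSuper {n : ℕ} (lam Lam p : ℝ) (Ω : Set (En n)) (u f : En n → ℝ) : Prop :=
  ∀ x₀ ∈ Ω, ∀ ψ : En n → ℝ, ContDiffOn ℝ 2 ψ Ω →
    IsLocalMinOn (fun x => u x - ψ x) Ω x₀ →
    pucciInf lam Lam (Dp p (gradVec ψ x₀) * hessMat ψ x₀ * Dp p (gradVec ψ x₀))
      - Lam * vnorm (gradVec ψ x₀) ^ (p + 1) ≤ f x₀

/-- `u` satisfies `M⁺_{λ,Λ}(D_p(Du) D²u D_p(Du)) + Λ|Du|^{p+1} ≥ f` in `Ω`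
in the viscosity sense. -/
def IsViscSub {n : ℕ} (lam Lam p : ℝ) (Ω : Set (En n)) (u f : En n → ℝ) : Prop :=
  ∀ x₀ ∈ Ω, ∀ ψ : En n → ℝ, ContDiffOn ℝ 2 ψ Ω →
    IsLocalMaxOn (fun x => u x - ψ x) Ω x₀ →
    f x₀ ≤ pucciSup lam Lam (Dp p (gradVec ψ x₀) * hessMat ψ x₀ * Dp p (gradVec ψ x₀))
      + Lam * vnorm (gradVec ψ x₀) ^ (p + 1)

/-- `‖f‖_{Lⁿ(Ω)} = (∫_Ω |f|ⁿ)^{1/n}`. -/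
noncomputable def LnNorm {n : ℕ} (f : En n → ℝ) (Ω : Set (En n)) : ℝ :=
  (∫ x in Ω, |f x| ^ (n : ℝ)) ^ ((n : ℝ)⁻¹)

/-- The open cube `Q_r = {x : |x_i| < r for all i}`. -/
def Qcube (n : ℕ) (r : ℝ) : Set (En n) := {x | ∀ i, |x i| < r}

open Filter Topology

/-! ### Viscosity supersolutions through second-order jets -/

/-- The diagonal operator with entries `d`. -/
def diagL {n : ℕ} (d : Fin n → ℝ) : En n →L[ℝ] En n :=
  LinearMap.toContinuousLinearMap
    { toFun := fun x => WithLp.toLp 2 fun i => d i * x i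
      map_add' := fun x y => by ext i; simp [mul_add]
      map_smul' := fun c x => by ext i; simp [mul_left_comm] }

@[simp] lemma diagL_apply {n : ℕ} (d : Fin n → ℝ) (x : En n) (i : Fin n) :
    diagL d x i = d i * x i := rfl

lemma En.inner_eq_sum {n : ℕ} (x y : En n) : inner ℝ x y = ∑ i, x i * y i := by
  simp [PiLp.inner_apply, mul_comm]

lemma En.norm_sq_eq_sum {n : ℕ} (x : En n) : ‖x‖ ^ 2 = ∑ i, x i ^ 2 := by
  simp [EuclideanSpace.norm_sq_eq]

lemma En.abs_apply_le_norm {n : ℕ} (x : En n) (i : Fin n) : |x i| ≤ ‖x‖ := by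
  simpa using PiLp.norm_apply_le x i

/-- The quadratic polynomial with gradient `z` and Hessian `A` at `x` lies below `u` near `x`
up to an error `o(‖y - x‖²)`. -/
def JetBelow {n : ℕ} (u : En n → ℝ) (x z : En n) (A : En n →L[ℝ] En n) : Prop :=
  ∀ η > 0, ∀ᶠ y in 𝓝 x,
    u x + inner ℝ z (y - x) + (1 / 2) * inner ℝ (A (y - x)) (y - x) - η * ‖y - x‖ ^ 2 ≤ u y

/-- Second-order jet form of `M⁻(D_p(Du) D²u D_p(Du)) + lam Γ Σ |u_i|^{p+2} - Lam |Du|^{p+1} ≤ f`,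
with the Pucci operator replaced by its value on matrices bounded below by `-κ`. -/
def PucciSuper {n : ℕ} (lam Lam p Γ : ℝ) (Ω : Set (En n)) (u f : En n → ℝ) : Prop :=
  ∀ x ∈ Ω, ∀ (z : En n) (A : En n →L[ℝ] En n), (∀ v w, inner ℝ (A v) w = inner ℝ v (A w)) →
    JetBelow u x z A → ∀ κ ≥ 0,
    (∀ ξ : En n, -κ * ‖ξ‖ ^ 2 ≤
      inner ℝ (A (diagL (fun i => |z i| ^ (p / 2)) ξ)) (diagL (fun i => |z i| ^ (p / 2)) ξ)) →
    lam * (∑ i, |z i| ^ p * A (EuclideanSpace.single i 1) i + κ * n + Γ * ∑ i, |z i| ^ (p + 2))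
      ≤ Lam * κ * n + Lam * ‖z‖ ^ (p + 1) + f x

lemma Matrix.IsHermitian.le_eigenvalues {n : ℕ} {N : Matrix (Fin n) (Fin n) ℝ}
    (hN : N.IsHermitian) {κ : ℝ} (h : ∀ ξ : En n, κ * ‖ξ‖ ^ 2 ≤ ∑ i, ∑ j, ξ i * N i j * ξ j)
    (i : Fin n) : κ ≤ hN.eigenvalues i := by
  have h1 := h (hN.eigenvectorBasis i)
  rw [hN.eigenvectorBasis.orthonormal.1 i] at h1
  rw [hN.eigenvalues_eq]
  simpa [dotProduct, Matrix.mulVec, Finset.mul_sum, mul_assoc] using h1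

lemma Matrix.IsHermitian.eigenvalues_le {n : ℕ} {N : Matrix (Fin n) (Fin n) ℝ}
    (hN : N.IsHermitian) {κ : ℝ} (h : ∀ ξ : En n, ∑ i, ∑ j, ξ i * N i j * ξ j ≤ κ * ‖ξ‖ ^ 2)
    (i : Fin n) : hN.eigenvalues i ≤ κ := by
  have h1 := h (hN.eigenvectorBasis i)
  rw [hN.eigenvectorBasis.orthonormal.1 i] at h1
  rw [hN.eigenvalues_eq]
  simpa [dotProduct, Matrix.mulVec, Finset.mul_sum, mul_assoc] using h1

lemma le_pucciInf {n : ℕ} {lam Lam κ : ℝ} (hlL : lam ≤ Lam) (hκ : 0 ≤ κ)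
    {N : Matrix (Fin n) (Fin n) ℝ} (hN : N.IsHermitian)
    (h : ∀ ξ : En n, -κ * ‖ξ‖ ^ 2 ≤ ∑ i, ∑ j, ξ i * N i j * ξ j) :
    lam * (N.trace + κ * n) - Lam * κ * n ≤ pucciInf lam Lam N := by
  have ht : N.trace = ∑ i, hN.eigenvalues i := by simpa using hN.trace_eq_sum_eigenvalues
  rw [pucciInf, dif_pos hN, ht]
  have : lam * (∑ i, hN.eigenvalues i + κ * n) - Lam * κ * n
      = ∑ i, (lam * hN.eigenvalues i + lam * κ - Lam * κ) := by
    simp [Finset.sum_add_distrib, ← Finset.mul_sum]; ring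
  rw [this]
  refine Finset.sum_le_sum fun i _ => ?_
  have hi := hN.le_eigenvalues h i
  rcases le_total 0 (hN.eigenvalues i) with h0 | h0
  · rw [max_eq_left h0, min_eq_right h0]
    nlinarith
  · rw [max_eq_right h0, min_eq_left h0]
    nlinarith

lemma pucciSup_le {n : ℕ} {lam Lam κ : ℝ} (hlL : lam ≤ Lam) (hκ : 0 ≤ κ)
    {N : Matrix (Fin n) (Fin n) ℝ} (hN : N.IsHermitian)
    (h : ∀ ξ : En n, ∑ i, ∑ j, ξ i * N i j * ξ j ≤ κ * ‖ξ‖ ^ 2) :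
    pucciSup lam Lam N ≤ Lam * κ * n - lam * (κ * n - N.trace) := by
  have ht : N.trace = ∑ i, hN.eigenvalues i := by simpa using hN.trace_eq_sum_eigenvalues
  rw [pucciSup, dif_pos hN, ht]
  have : Lam * κ * n - lam * (κ * n - ∑ i, hN.eigenvalues i)
      = ∑ i, (lam * hN.eigenvalues i + Lam * κ - lam * κ) := by
    simp [Finset.sum_add_distrib, ← Finset.mul_sum]; ring
  rw [this]
  refine Finset.sum_le_sum fun i _ => ?_
  have hi := hN.eigenvalues_le h i
  rcases le_total 0 (hN.eigenvalues i) with h0 | h0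
  · rw [max_eq_left h0, min_eq_right h0]
    nlinarith
  · rw [max_eq_right h0, min_eq_left h0]
    nlinarith

/-- The quadratic polynomial with value `c`, gradient `z` and Hessian `B` at `x`. -/
def quadPoly {n : ℕ} (c : ℝ) (x z : En n) (B : En n →L[ℝ] En n) (y : En n) : ℝ :=
  c + inner ℝ z (y - x) + (1 / 2) * inner ℝ (B (y - x)) (y - x)

lemma contDiff_quadPoly {n : ℕ} (c : ℝ) (x z : En n) (B : En n →L[ℝ] En n) :
    ContDiff ℝ 2 (quadPoly c x z B) := by
  unfold quadPoly
  have h1 : ContDiff ℝ 2 fun y : En n => y - x := contDiff_id.sub contDiff_const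
  exact (contDiff_const.add (contDiff_const.inner ℝ h1)).add
    (contDiff_const.mul ((B.contDiff.comp h1).inner ℝ h1))

lemma fderiv_quadPoly {n : ℕ} (c : ℝ) (x z : En n) {B : En n →L[ℝ] En n}
    (hB : ∀ v w, inner ℝ (B v) w = inner ℝ v (B w)) (y v : En n) :
    fderiv ℝ (quadPoly c x z B) y v = inner ℝ z v + inner ℝ (B (y - x)) v := by
  have h1 : HasFDerivAt (fun y : En n => y - x) (ContinuousLinearMap.id ℝ (En n)) y :=
    (hasFDerivAt_id y).sub_const x
  have h2 : HasFDerivAt (fun y : En n => B (y - x)) B y := by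
    have := B.hasFDerivAt.comp y h1
    rwa [ContinuousLinearMap.comp_id] at this
  have h3 := ((((hasFDerivAt_const z y).inner ℝ h1).const_add c).add
    ((h2.inner ℝ h1).const_mul (1 / 2)))
  have h4 : HasFDerivAt (quadPoly c x z B) _ y := h3
  rw [h4.fderiv]
  simp only [one_div, add_apply, ContinuousLinearMap.coe_comp,
    Function.comp_apply, ContinuousLinearMap.prod_apply, fderivInnerCLM_apply,
    ContinuousLinearMap.id_apply, smul_apply, zero_apply, inner_zero_left, smul_eq_mul]
  rw [hB v (y - x), real_inner_comm (B (y - x)) v]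
  ring

lemma gradVec_quadPoly {n : ℕ} (c : ℝ) (x z : En n) {B : En n →L[ℝ] En n}
    (hB : ∀ v w, inner ℝ (B v) w = inner ℝ v (B w)) :
    gradVec (quadPoly c x z B) x = z := by
  ext i
  simp [gradVec, fderiv_quadPoly c x z hB, EuclideanSpace.inner_single_right]

lemma hessMat_quadPoly {n : ℕ} (c : ℝ) (x z : En n) {B : En n →L[ℝ] En n}
    (hB : ∀ v w, inner ℝ (B v) w = inner ℝ v (B w)) (i j : Fin n) :
    hessMat (quadPoly c x z B) x i j = B (EuclideanSpace.single i 1) j := by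
  have h : (fun y => fderiv ℝ (quadPoly c x z B) y (EuclideanSpace.single j 1))
      = fun y => z j + (B (y - x)) j := by
    ext y
    simp [fderiv_quadPoly c x z hB, EuclideanSpace.inner_single_right]
  have h1 : HasFDerivAt (fun y : En n => y - x) (ContinuousLinearMap.id ℝ (En n)) x :=
    (hasFDerivAt_id x).sub_const x
  have h2 : HasFDerivAt (fun y : En n => z j + (B (y - x)) j)
      ((EuclideanSpace.proj j).comp B) x := by
    have := ((EuclideanSpace.proj (𝕜 := ℝ) j).comp B).hasFDerivAt.comp x h1
    rw [ContinuousLinearMap.comp_id] at this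
    exact this.const_add (z j)
  rw [hessMat, Matrix.of_apply, h, h2.fderiv]
  rfl

/-- The weighted Hessian `D_p(z) B D_p(z)` has the quadratic form `ξ ↦ ⟪B D_p ξ, D_p ξ⟫`. -/
lemma weighted_hessian {n : ℕ} (p c : ℝ) (x z : En n) {B : En n →L[ℝ] En n}
    (hB : ∀ v w, inner ℝ (B v) w = inner ℝ v (B w)) {N : Matrix (Fin n) (Fin n) ℝ}
    (hN : N = Dp p (gradVec (quadPoly c x z B) x) * hessMat (quadPoly c x z B) x
      * Dp p (gradVec (quadPoly c x z B) x)) :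
    N.IsHermitian ∧ (∀ ξ : En n, ∑ i, ∑ j, ξ i * N i j * ξ j =
      inner ℝ (B (diagL (fun i => |z i| ^ (p / 2)) ξ)) (diagL (fun i => |z i| ^ (p / 2)) ξ)) ∧
    N.trace = ∑ i, |z i| ^ p * B (EuclideanSpace.single i 1) i := by
  have hsym : ∀ i j, B (EuclideanSpace.single i 1) j = B (EuclideanSpace.single j 1) i := by
    intro i j
    have := hB (EuclideanSpace.single i 1) (EuclideanSpace.single j 1)
    simpa [EuclideanSpace.inner_single_right, EuclideanSpace.inner_single_left] using this
  have hNij : ∀ i j, N i j = |z i| ^ (p / 2) * B (EuclideanSpace.single i 1) j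
      * |z j| ^ (p / 2) := by
    intro i j
    rw [hN, gradVec_quadPoly c x z hB]
    simp [Dp, Matrix.mul_diagonal, Matrix.diagonal_mul, hessMat_quadPoly c x z hB]
  refine ⟨?_, fun ξ => ?_, ?_⟩
  · ext i j
    simp only [Matrix.conjTranspose_apply, star_trivial, hNij, hsym j i]
    ring
  · have hsum : ∀ v : En n, B v = ∑ i, v i • B (EuclideanSpace.single i 1) := by
      intro v
      have hv : v = ∑ i, v i • EuclideanSpace.single i (1 : ℝ) := by
        ext j; simp [Pi.single_apply]
      conv_lhs => rw [hv]
      simp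
    rw [hsum (diagL _ ξ), sum_inner]
    refine Finset.sum_congr rfl fun i _ => ?_
    rw [inner_smul_left, En.inner_eq_sum, Finset.mul_sum]
    refine Finset.sum_congr rfl fun j _ => ?_
    simp [hNij]; ring
  · refine Finset.sum_congr rfl fun i _ => ?_
    have : |z i| ^ (p / 2) * |z i| ^ (p / 2) = |z i| ^ p := by
      rcases eq_or_ne (p / 2) 0 with h0 | h0
      · have : p = 0 := by linarith
        simp [this]
      · rw [← Real.mul_rpow (abs_nonneg _) (abs_nonneg _), ← pow_two,
          ← Real.rpow_natCast, ← Real.rpow_mul (abs_nonneg _)]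
        congr 1; push_cast; ring
    rw [Matrix.diag_apply, hNij, ← this]; ring

lemma vnorm_eq_norm {n : ℕ} (z : En n) : vnorm (z : Fin n → ℝ) = ‖z‖ := by
  simp [vnorm, EuclideanSpace.norm_eq]

/-- The square `D_p(z)²` is controlled by `Σ |z_i|^p`. -/
lemma norm_sq_diagL_rpow_le {n : ℕ} {p : ℝ} (z ξ : En n) :
    ‖diagL (fun i => |z i| ^ (p / 2)) ξ‖ ^ 2 ≤ (∑ i, |z i| ^ p) * ‖ξ‖ ^ 2 := by
  rw [En.norm_sq_eq_sum, En.norm_sq_eq_sum, Finset.mul_sum]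
  refine Finset.sum_le_sum fun i _ => ?_
  have h1 : (|z i| ^ (p / 2)) ^ 2 = |z i| ^ p := by
    rw [← Real.rpow_natCast, ← Real.rpow_mul (abs_nonneg _)]
    congr 1; push_cast; ring
  rw [diagL_apply, mul_pow, h1]
  exact mul_le_mul_of_nonneg_right (Finset.single_le_sum (f := fun i => |z i| ^ p)
    (fun j _ => by positivity) (Finset.mem_univ i)) (sq_nonneg _)

lemma le_of_forall_pos_le_add_mul {a b c : ℝ} (h : ∀ η > 0, a ≤ b + η * c) : a ≤ b := by
  refine le_of_forall_pos_le_add fun ε hε => ?_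
  have h1 := h (ε / (|c| + 1)) (by positivity)
  have h2 : ε / (|c| + 1) * c ≤ ε := by
    rw [div_mul_eq_mul_div, div_le_iff₀ (by positivity)]
    nlinarith [le_abs_self c]
  linarith

lemma IsViscSuper.pucciSuper {n : ℕ} {lam Lam p : ℝ} (hlL : lam ≤ Lam) {Ω : Set (En n)}
    {u f : En n → ℝ} (h : IsViscSuper lam Lam p Ω u f) : PucciSuper lam Lam p 0 Ω u f := by
  intro x hx z A hA hjet κ hκ hpos
  set Z := ∑ i, |z i| ^ p with hZ
  have hZ0 : 0 ≤ Z := Finset.sum_nonneg fun i _ => by positivity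
  refine le_of_forall_pos_le_add_mul (c := 2 * lam * Z - 2 * lam * Z * n + 2 * Lam * Z * n)
    fun η hη => ?_
  set B : En n →L[ℝ] En n := A - (2 * η) • ContinuousLinearMap.id ℝ (En n) with hB
  have hBA : ∀ v, B v = A v - (2 * η) • v := fun v => by simp [hB]
  have hBsym : ∀ v w, inner ℝ (B v) w = inner ℝ v (B w) := by
    intro v w
    rw [hBA, hBA, inner_sub_left, inner_sub_right, hA, inner_smul_left, inner_smul_right]
    simp
  have hBq : ∀ v, inner ℝ (B v) v = inner ℝ (A v) v - 2 * η * ‖v‖ ^ 2 := by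
    intro v
    rw [hBA, inner_sub_left, inner_smul_left, real_inner_self_eq_norm_sq]
    simp
  have h1 := h x hx (quadPoly (u x) x z B) (contDiff_quadPoly _ _ _ _).contDiffOn (by
    refine Filter.Eventually.filter_mono nhdsWithin_le_nhds ?_
    filter_upwards [hjet η hη] with y hy
    simp only [quadPoly, hBq, sub_self, map_zero, inner_zero_right, mul_zero, add_zero]
    linarith)
  obtain ⟨hN, hform, htr⟩ := weighted_hessian p (u x) x z hBsym rfl
  have h2 := le_pucciInf (lam := lam) (κ := κ + 2 * η * Z) hlL (by positivity) hN (by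
    intro ξ
    rw [hform, hBq]
    nlinarith [hpos ξ, norm_sq_diagL_rpow_le (p := p) z ξ])
  rw [htr] at h2
  rw [gradVec_quadPoly _ x z hBsym, vnorm_eq_norm] at h1
  rw [gradVec_quadPoly _ x z hBsym] at h2
  have h3 : ∑ i, |z i| ^ p * B (EuclideanSpace.single i 1) i
      = ∑ i, |z i| ^ p * A (EuclideanSpace.single i 1) i - 2 * η * Z := by
    simp [hBA, mul_sub, Finset.sum_sub_distrib, hZ, Finset.mul_sum, mul_comm]
  rw [h3] at h2
  nlinarith

lemma IsViscSub.pucciSuper_const_sub {n : ℕ} {lam Lam p : ℝ} (hlL : lam ≤ Lam)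
    {Ω : Set (En n)} {u f : En n → ℝ} (h : IsViscSub lam Lam p Ω u f) (S : ℝ) :
    PucciSuper lam Lam p 0 Ω (fun x => S - u x) (fun x => -f x) := by
  intro x hx z A hA hjet κ hκ hpos
  set Z := ∑ i, |z i| ^ p with hZ
  have hZ0 : 0 ≤ Z := Finset.sum_nonneg fun i _ => by positivity
  refine le_of_forall_pos_le_add_mul (c := 2 * lam * Z - 2 * lam * Z * n + 2 * Lam * Z * n)
    fun η hη => ?_
  set B : En n →L[ℝ] En n := (2 * η) • ContinuousLinearMap.id ℝ (En n) - A with hB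
  have hBA : ∀ v, B v = (2 * η) • v - A v := fun v => by simp [hB]
  have hBsym : ∀ v w, inner ℝ (B v) w = inner ℝ v (B w) := by
    intro v w
    rw [hBA, hBA, inner_sub_left, inner_sub_right, hA, inner_smul_left, inner_smul_right]
    simp
  have hBq : ∀ v, inner ℝ (B v) v = 2 * η * ‖v‖ ^ 2 - inner ℝ (A v) v := by
    intro v
    rw [hBA, inner_sub_left, inner_smul_left, real_inner_self_eq_norm_sq]
    simp
  have h1 := h x hx (quadPoly (u x) x (-z) B) (contDiff_quadPoly _ _ _ _).contDiffOn (by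
    refine Filter.Eventually.filter_mono nhdsWithin_le_nhds ?_
    filter_upwards [hjet η hη] with y hy
    simp only [quadPoly, hBq, sub_self, map_zero, inner_zero_right, mul_zero, add_zero,
      inner_neg_left]
    linarith)
  obtain ⟨hN, hform, htr⟩ := weighted_hessian p (u x) x (-z) hBsym rfl
  have habs : ∀ i, |(-z) i| = |z i| := fun i => by simp
  simp only [habs] at hform htr
  have h2 := pucciSup_le (lam := lam) (κ := κ + 2 * η * Z) hlL (by positivity) hN (by
    intro ξ
    rw [hform, hBq]
    nlinarith [hpos ξ, norm_sq_diagL_rpow_le (p := p) z ξ])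
  rw [htr] at h2
  rw [gradVec_quadPoly _ x (-z) hBsym, vnorm_eq_norm, norm_neg] at h1
  rw [gradVec_quadPoly _ x (-z) hBsym] at h2
  have h3 : ∑ i, |z i| ^ p * B (EuclideanSpace.single i 1) i
      = 2 * η * Z - ∑ i, |z i| ^ p * A (EuclideanSpace.single i 1) i := by
    simp [hBA, mul_sub, Finset.sum_sub_distrib, hZ, Finset.mul_sum, mul_comm]
  rw [h3] at h2
  nlinarith

lemma PucciSuper.mono {n : ℕ} {lam Lam p Γ : ℝ} {Ω Ω' : Set (En n)} {u f f' : En n → ℝ}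
    (h : PucciSuper lam Lam p Γ Ω u f) (hΩ : Ω' ⊆ Ω) (hf : ∀ x ∈ Ω', f x ≤ f' x) :
    PucciSuper lam Lam p Γ Ω' u f' :=
  fun x hx z A hA hj κ hκ hp => (h x (hΩ hx) z A hA hj κ hκ hp).trans (by linarith [hf x hx])

/-- The inequality of `PucciSuper` at the jet `(b z, c (A + Γ z ⊗ z))`. -/
lemma PucciSuper.apply_jet {n : ℕ} {lam Lam p Γ b c κ : ℝ} {Ω : Set (En n)} {u f : En n → ℝ}
    (hp : 0 ≤ p) (h : PucciSuper lam Lam p 0 Ω u f) (hΓ : 0 ≤ Γ) (hb : 0 < b) (hc : 0 < c)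
    {x : En n} (hx : x ∈ Ω) {z : En n} {A : En n →L[ℝ] En n}
    (hA : ∀ v w, inner ℝ (A v) w = inner ℝ v (A w))
    (hj : JetBelow u x (b • z) (c • (A + Γ • (innerSL ℝ z).smulRight z))) (hκ : 0 ≤ κ)
    (hpos : ∀ ξ : En n, -κ * ‖ξ‖ ^ 2 ≤
      inner ℝ (A (diagL (fun i => |z i| ^ (p / 2)) ξ)) (diagL (fun i => |z i| ^ (p / 2)) ξ)) :
    lam * (b ^ p * c * (∑ i, |z i| ^ p * A (EuclideanSpace.single i 1) i + κ * n
      + Γ * ∑ i, |z i| ^ (p + 2)))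
      ≤ b ^ p * c * (Lam * κ * n) + b ^ (p + 1) * (Lam * ‖z‖ ^ (p + 1)) + f x := by
  have hB : ∀ v, (c • (A + Γ • (innerSL ℝ z).smulRight z)) v
      = c • (A v + (Γ * inner ℝ z v) • z) := fun v => by
    simp [smul_smul, mul_assoc]
  have habs : ∀ (q : ℝ) i, |(b • z) i| ^ q = b ^ q * |z i| ^ q := fun q i => by
    rw [PiLp.smul_apply, smul_eq_mul, abs_mul, abs_of_pos hb,
      Real.mul_rpow hb.le (abs_nonneg _)]
  have hdiag : ∀ ξ : En n, diagL (fun i => |(b • z) i| ^ (p / 2)) ξ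
      = b ^ (p / 2) • diagL (fun i => |z i| ^ (p / 2)) ξ := fun ξ => by
    ext i
    rw [diagL_apply, habs, PiLp.smul_apply, diagL_apply, smul_eq_mul]
    ring
  have hb2 : b ^ (p / 2) * b ^ (p / 2) = b ^ p := by
    rw [← Real.rpow_add hb]; congr 1; ring
  have h1 := h x hx (b • z) _ (by
    intro v w
    simp only [hB, inner_smul_left, inner_smul_right, inner_add_left, inner_add_right, hA,
      conj_trivial, real_inner_comm z v]
    ring) hj (b ^ p * c * κ) (by positivity) (by
    intro ξ
    rw [hdiag, hB]
    simp only [map_smul, inner_smul_left, inner_smul_right, inner_add_left, conj_trivial]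
    set S := diagL (fun i => |z i| ^ (p / 2)) ξ
    have e1 : c * (b ^ (p / 2) * (b ^ (p / 2) * inner ℝ (A S) S) +
        Γ * (b ^ (p / 2) * inner ℝ z S) * (b ^ (p / 2) * inner ℝ z S))
        = b ^ p * c * (inner ℝ (A S) S + Γ * (inner ℝ z S) ^ 2) := by
      rw [← hb2]; ring
    have e2 : 0 ≤ b ^ p * c := by positivity
    have e3 := mul_le_mul_of_nonneg_left (hpos ξ) e2
    have e4 : 0 ≤ b ^ p * c * (Γ * (inner ℝ z S) ^ 2) := by positivity
    nlinarith [e1])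
  have hsum : ∑ i, |(b • z) i| ^ p * (c • (A + Γ • (innerSL ℝ z).smulRight z))
      (EuclideanSpace.single i 1) i = b ^ p * c * (∑ i, |z i| ^ p * A (EuclideanSpace.single i 1) i
      + Γ * ∑ i, |z i| ^ (p + 2)) := by
    rw [Finset.mul_sum (a := Γ), ← Finset.sum_add_distrib, Finset.mul_sum]
    refine Finset.sum_congr rfl fun i _ => ?_
    have e : |z i| ^ (p + 2) = |z i| ^ p * (z i * z i) := by
      rw [Real.rpow_add_of_nonneg (abs_nonneg _) hp (by norm_num), Real.rpow_two, sq_abs, pow_two]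
    rw [habs, hB, e]
    simp only [PiLp.smul_apply, PiLp.add_apply, smul_eq_mul, EuclideanSpace.inner_single_right,
      conj_trivial]
    ring
  rw [hsum, norm_smul, Real.norm_of_nonneg hb.le,
    Real.mul_rpow hb.le (norm_nonneg _)] at h1
  linarith

lemma PucciSuper.scale {n : ℕ} {lam Lam p : ℝ} (hLam : 0 ≤ Lam) (hp : 0 ≤ p)
    {Ω : Set (En n)} {u f : En n → ℝ} (h : PucciSuper lam Lam p 0 Ω u f) {r m : ℝ}
    (hr : 0 < r) (hr1 : r ≤ 1) (hm : 0 < m) (x₀ : En n) :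
    PucciSuper lam Lam p 0 {x | x₀ + r • x ∈ Ω} (fun x => u (x₀ + r • x) / m)
      (fun x => r ^ (p + 2) / m ^ (p + 1) * f (x₀ + r • x)) := by
  intro x hx z A hA hj κ hκ hpos
  have h1 := h.apply_jet hp (le_refl 0) (b := m / r) (c := m / r ^ 2) (by positivity)
    (by positivity) hx (z := z) (A := A) hA (by
    intro η hη
    have h2 := hj (η * r ^ 2 / m) (by positivity)
    have hcont : Tendsto (fun y : En n => r⁻¹ • (y - x₀)) (𝓝 (x₀ + r • x)) (𝓝 x) := by
      have : Continuous fun y : En n => r⁻¹ • (y - x₀) := by fun_prop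
      simpa [smul_smul, hr.ne'] using this.tendsto (x₀ + r • x)
    filter_upwards [hcont.eventually h2] with y hy
    have e1 : x₀ + r • r⁻¹ • (y - x₀) = y := by simp [smul_smul, hr.ne']
    have e2 : r⁻¹ • (y - x₀) - x = r⁻¹ • (y - (x₀ + r • x)) := by
      rw [← sub_sub, smul_sub r⁻¹ (y - x₀)]; simp [smul_smul, hr.ne']
    rw [e1, e2, le_div_iff₀ hm] at hy
    simp only [map_smul, inner_smul_left, inner_smul_right, norm_smul, conj_trivial, zero_smul,
      add_zero, smul_apply] at hy ⊢
    refine le_trans (le_of_eq ?_) hy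
    rw [norm_inv, Real.norm_of_nonneg hr.le]
    field_simp) hκ hpos
  have e3 : (m / r) ^ p * (m / r ^ 2) = m ^ (p + 1) / r ^ (p + 2) := by
    rw [Real.div_rpow hm.le hr.le, Real.rpow_add hm, Real.rpow_add hr, Real.rpow_one,
      Real.rpow_two]
    field_simp
  have e4 : (m / r) ^ (p + 1) = m ^ (p + 1) / r ^ (p + 2) * r := by
    rw [Real.div_rpow hm.le hr.le, show p + 2 = p + 1 + 1 by ring, Real.rpow_add hr (p + 1),
      Real.rpow_one]
    field_simp
  rw [e3, e4] at h1
  set X := m ^ (p + 1)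
  set W := r ^ (p + 2)
  have hX : 0 < X := by positivity
  have hW : 0 < W := by positivity
  have h5 : Lam * ‖z‖ ^ (p + 1) * r ≤ Lam * ‖z‖ ^ (p + 1) :=
    mul_le_of_le_one_right (by positivity) hr1
  have h6 := mul_le_mul_of_nonneg_left h1 (div_pos hW hX).le
  have e5 : W / X * (lam * (X / W * (∑ i, |z i| ^ p * A (EuclideanSpace.single i 1) i + κ * n
      + 0 * ∑ i, |z i| ^ (p + 2)))) = lam * (∑ i, |z i| ^ p * A (EuclideanSpace.single i 1) i
      + κ * n + 0 * ∑ i, |z i| ^ (p + 2)) := by field_simp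
  have e6 : W / X * (X / W * (Lam * κ * n) + X / W * r * (Lam * ‖z‖ ^ (p + 1)) + f (x₀ + r • x))
      = Lam * κ * n + Lam * ‖z‖ ^ (p + 1) * r + W / X * f (x₀ + r • x) := by field_simp
  rw [e5, e6] at h6
  linarith

lemma one_add_add_sq_le_exp {s : ℝ} (hs : |s| ≤ 1) : 1 + s + s ^ 2 / 2 - |s| ^ 3 ≤ Real.exp s := by
  have h := Real.exp_bound hs (n := 3) (by norm_num)
  simp only [Finset.sum_range_succ, Finset.sum_range_zero, Nat.factorial] at h
  norm_num at h
  have := (abs_le.1 h).1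
  have h3 : 0 ≤ |s| ^ 3 := by positivity
  linarith

set_option maxHeartbeats 1000000 in
/-- A jet of `log (1 + u) / Γ` induces a jet of `u`. -/
lemma JetBelow.of_log {n : ℕ} {Γ : ℝ} {Ω : Set (En n)} {u : En n → ℝ} (hΩ : IsOpen Ω)
    (hu : ∀ x ∈ Ω, 0 ≤ u x) (hΓ : 0 < Γ) {x : En n} (hx : x ∈ Ω) {z : En n} {A : En n →L[ℝ] En n}
    (hj : JetBelow (fun x => Real.log (1 + u x) / Γ) x z A) :
    JetBelow u x ((Γ * (1 + u x)) • z)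
      ((Γ * (1 + u x)) • (A + Γ • (innerSL ℝ z).smulRight z)) := by
  intro η hη
  have hux := hu x hx
  set m := 1 + u x with hm
  have hm0 : 0 < m := by linarith
  set η' := η / (2 * (Γ * m)) with hη'
  have hη'0 : 0 < η' := by positivity
  set C := Γ * (‖z‖ + ‖A‖ + η') with hC
  have hC0 : 0 < C := by positivity
  set ρ := min 1 (min (1 / C) (η / (2 * m * (C ^ 2 + C ^ 3))))
  have hρ : 0 < ρ := by positivity
  filter_upwards [hj η' hη'0, hΩ.mem_nhds hx, Metric.ball_mem_nhds x hρ] with y hy hyΩ hyρ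
  set v := y - x
  have hvρ : ‖v‖ < ρ := by rwa [mem_ball_iff_norm] at hyρ
  have hv1 : ‖v‖ ≤ 1 := hvρ.le.trans (min_le_left _ _)
  have hvC : ‖v‖ ≤ 1 / C := hvρ.le.trans ((min_le_right _ _).trans (min_le_left _ _))
  have hvη : ‖v‖ ≤ η / (2 * m * (C ^ 2 + C ^ 3)) :=
    hvρ.le.trans ((min_le_right _ _).trans (min_le_right _ _))
  rw [le_div_iff₀ hC0] at hvC
  rw [le_div_iff₀ (by positivity)] at hvη
  have huy := hu y hyΩ
  set a := Γ * inner ℝ z v with ha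
  set s := Γ * (inner ℝ z v + (1 / 2) * inner ℝ (A v) v - η' * ‖v‖ ^ 2) with hs
  have hiz : |inner ℝ z v| ≤ ‖z‖ * ‖v‖ := abs_real_inner_le_norm z v
  have hiA : |inner ℝ (A v) v| ≤ ‖A‖ * ‖v‖ ^ 2 := by
    refine (abs_real_inner_le_norm _ _).trans ?_
    have := A.le_opNorm v
    nlinarith [norm_nonneg v]
  have hsa : |s - a| ≤ C * ‖v‖ ^ 2 := by
    have e : s - a = Γ * ((1 / 2) * inner ℝ (A v) v - η' * ‖v‖ ^ 2) := by rw [hs, ha]; ring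
    rw [e, abs_mul, abs_of_pos hΓ, hC, mul_assoc]
    refine mul_le_mul_of_nonneg_left ?_ hΓ.le
    have h2 : 0 ≤ ‖z‖ * ‖v‖ ^ 2 := by positivity
    have h3 : 0 ≤ η' * ‖v‖ ^ 2 := by positivity
    have h4 : 0 ≤ ‖A‖ * ‖v‖ ^ 2 := by positivity
    rw [abs_le] at hiA ⊢
    constructor <;> nlinarith [hiA.1, hiA.2]
  have hvv : ‖v‖ ^ 2 ≤ ‖v‖ := by nlinarith [norm_nonneg v]
  have haC : |a| ≤ C * ‖v‖ := by
    rw [ha, abs_mul, abs_of_pos hΓ, hC, mul_assoc]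
    refine mul_le_mul_of_nonneg_left (hiz.trans ?_) hΓ.le
    have h2 : 0 ≤ ‖A‖ * ‖v‖ := by positivity
    have h3 : 0 ≤ η' * ‖v‖ := by positivity
    linarith
  have hsC : |s| ≤ C * ‖v‖ := by
    have e : s = Γ * (inner ℝ z v + ((1 / 2) * inner ℝ (A v) v - η' * ‖v‖ ^ 2)) := by
      rw [hs]; ring
    rw [e, abs_mul, abs_of_pos hΓ, hC, mul_assoc]
    refine mul_le_mul_of_nonneg_left ?_ hΓ.le
    have h2 : ‖A‖ * ‖v‖ ^ 2 ≤ ‖A‖ * ‖v‖ := mul_le_mul_of_nonneg_left hvv (norm_nonneg _)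
    have h3 : η' * ‖v‖ ^ 2 ≤ η' * ‖v‖ := mul_le_mul_of_nonneg_left hvv hη'0.le
    have h4 : 0 ≤ ‖A‖ * ‖v‖ ^ 2 := by positivity
    have h5 : 0 ≤ η' * ‖v‖ ^ 2 := by positivity
    rw [abs_le] at hiA hiz ⊢
    constructor <;> nlinarith [hiA.1, hiA.2, hiz.1, hiz.2]
  have hs3 : |s| ^ 3 ≤ C ^ 3 * ‖v‖ ^ 3 := by
    rw [← mul_pow]; exact pow_le_pow_left₀ (abs_nonneg _) hsC 3
  have hs2 : a ^ 2 - 2 * C ^ 2 * ‖v‖ ^ 3 ≤ s ^ 2 := by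
    have e : |(s - a) * (s + a)| ≤ (C * ‖v‖ ^ 2) * (C * ‖v‖ + C * ‖v‖) := by
      rw [abs_mul]
      exact mul_le_mul hsa ((abs_add_le _ _).trans (add_le_add hsC haC)) (abs_nonneg _)
        (by positivity)
    nlinarith [(abs_le.1 e).1]
  have hexp := one_add_add_sq_le_exp (s := s) (by linarith [mul_comm C ‖v‖])
  have hlog : Real.exp s ≤ (1 + u y) / m := by
    rw [← Real.le_log_iff_exp_le (by positivity),
      Real.log_div (by positivity) (by positivity), hs]
    have := mul_le_mul_of_nonneg_left hy hΓ.le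
    rw [mul_div_cancel₀ _ hΓ.ne'] at this
    have e : Γ * (Real.log (1 + u x) / Γ) = Real.log m := by field_simp; rw [hm]
    nlinarith
  rw [le_div_iff₀ hm0] at hlog
  have hB : inner ℝ (((Γ * m) • (A + Γ • (innerSL ℝ z).smulRight z)) v) v
      = Γ * m * inner ℝ (A v) v + m * a ^ 2 := by
    simp [inner_smul_left, inner_add_left, ha]
    ring
  have hη2 : Γ * m * η' = η / 2 := by rw [hη']; field_simp
  have hlow : m * (1 + s + (a ^ 2 - 2 * C ^ 2 * ‖v‖ ^ 3) / 2 - C ^ 3 * ‖v‖ ^ 3) ≤ 1 + u y := by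
    refine le_trans ?_ hlog
    rw [mul_comm]
    exact mul_le_mul_of_nonneg_right (by linarith) hm0.le
  have hv3 : m * (C ^ 2 + C ^ 3) * ‖v‖ ^ 3 ≤ η / 2 * ‖v‖ ^ 2 := by
    have : m * (C ^ 2 + C ^ 3) * ‖v‖ ≤ η / 2 := by linarith
    calc _ = m * (C ^ 2 + C ^ 3) * ‖v‖ * ‖v‖ ^ 2 := by ring
      _ ≤ _ := mul_le_mul_of_nonneg_right this (by positivity)
  rw [hB, inner_smul_left, conj_trivial]
  have e1 : m * s = Γ * m * inner ℝ z v + 1 / 2 * (Γ * m * inner ℝ (A v) v)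
      - η / 2 * ‖v‖ ^ 2 := by rw [← hη2, hs]; ring
  nlinarith

lemma PucciSuper.log {n : ℕ} {lam Lam p Γ : ℝ} {Ω : Set (En n)} {u f : En n → ℝ}
    (hp : 0 ≤ p) (h : PucciSuper lam Lam p 0 Ω u f) (hΩ : IsOpen Ω)
    (hu : ∀ x ∈ Ω, 0 ≤ u x) (hΓ : 1 ≤ Γ) :
    PucciSuper lam Lam p Γ Ω (fun x => Real.log (1 + u x) / Γ) (fun x => |f x|) := by
  intro x hx z A hA hj κ hκ hpos
  have hux := hu x hx
  set b := Γ * (1 + u x) with hb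
  have hb1 : 1 ≤ b := by nlinarith
  have hb0 : 0 < b := by linarith
  have h1 := h.apply_jet hp (by linarith) hb0 hb0 hx hA
    (hj.of_log hΩ hu (by linarith) hx) hκ hpos
  rw [Real.rpow_add_one hb0.ne'] at h1
  have hbp : 1 ≤ b ^ p * b := one_le_mul_of_one_le_of_one_le (Real.one_le_rpow hb1 hp) hb1
  set X := b ^ p * b
  have h2 : f x ≤ X * |f x| := (le_abs_self _).trans (le_mul_of_one_le_left (abs_nonneg _) hbp)
  have h3 : X * (lam * (∑ i, |z i| ^ p * A (EuclideanSpace.single i 1) i + κ * n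
      + Γ * ∑ i, |z i| ^ (p + 2))) ≤ X * (Lam * κ * n + Lam * ‖z‖ ^ (p + 1) + |f x|) := by
    linarith
  exact le_of_mul_le_mul_left h3 (by linarith)

section Regularization

variable {E : Type*} [NormedAddCommGroup E] [InnerProductSpace ℝ E]

lemma norm_add_sq_div_le {s t : ℝ} (hs : 0 < s) (ht : 0 < t) (a b : E) :
    ‖a + b‖ ^ 2 / (2 * (s + t)) ≤ ‖a‖ ^ 2 / (2 * s) + ‖b‖ ^ 2 / (2 * t) := by
  have h : 0 ≤ ‖t • a - s • b‖ ^ 2 := sq_nonneg _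
  rw [norm_sub_sq_real, norm_smul, norm_smul, inner_smul_left, inner_smul_right,
    Real.norm_of_nonneg hs.le, Real.norm_of_nonneg ht.le, conj_trivial] at h
  rw [norm_add_sq_real, div_add_div _ _ (by positivity) (by positivity),
    div_le_div_iff₀ (by positivity) (by positivity)]
  nlinarith

lemma exists_forall_ge_sub_norm_sq [FiniteDimensional ℝ E] {m : E → ℝ} (hm : Continuous m)
    {s c δ : ℝ} {x₀ : E} (hδ : 0 < δ) (hs : δ < s)
    (h : ∀ y, m y ≤ c + ‖y - x₀‖ ^ 2 / (2 * s)) (x : E) :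
    ∃ y₀, ∀ y, m y - ‖x - y‖ ^ 2 / (2 * δ) ≤ m y₀ - ‖x - y₀‖ ^ 2 / (2 * δ) := by
  have hc : Continuous fun y => m y - ‖x - y‖ ^ 2 / (2 * δ) := by fun_prop
  refine hc.exists_forall_ge ?_
  set τ := (s - δ) / 2 with hτ
  have hτ0 : 0 < τ := by rw [hτ]; linarith
  have hb : ∀ y, m y - ‖x - y‖ ^ 2 / (2 * δ) ≤ c + ‖x - x₀‖ ^ 2 / (2 * τ)
      + (1 / (2 * (δ + τ)) - 1 / (2 * δ)) * ‖y - x‖ ^ 2 := fun y => by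
    have h1 := h y
    have h2 := norm_add_sq_div_le (s := δ + τ) (t := τ) (by linarith) hτ0 (y - x) (x - x₀)
    rw [show δ + τ + τ = s by rw [hτ]; ring, sub_add_sub_cancel] at h2
    rw [norm_sub_rev x y]
    have e : (1 / (2 * (δ + τ)) - 1 / (2 * δ)) * ‖y - x‖ ^ 2
      = ‖y - x‖ ^ 2 / (2 * (δ + τ)) - ‖y - x‖ ^ 2 / (2 * δ) := by ring
    rw [e]; linarith
  have hneg : 1 / (2 * (δ + τ)) - 1 / (2 * δ) < 0 :=
    sub_neg.2 (one_div_lt_one_div_of_lt (by positivity) (by linarith))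
  refine tendsto_atBot_mono hb (tendsto_atBot_add_const_left _ _ ?_)
  refine Tendsto.const_mul_atTop_of_neg hneg ?_
  have h1 : Tendsto (fun y : E => ‖y - x‖) (cocompact E) atTop := by
    simpa only [dist_eq_norm] using tendsto_dist_right_cocompact_atTop x
  exact (tendsto_pow_atTop two_ne_zero).comp h1

/-- Lasry–Lions type regularization: the envelope from below, by paraboloids of opening `1 / δ`,
of the inf-convolution of `w` over a compact set. -/
lemma exists_regularization [FiniteDimensional ℝ E] {K : Set E} (hK : IsCompact K)
    (hne : K.Nonempty) {w : E → ℝ} (hw : ContinuousOn w K) {ε δ : ℝ} (hε : 0 < ε) (hδ : 0 < δ) :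
    ∃ (e : E → ℝ) (G : E → E),
      (∀ x v, e x + inner ℝ (G x) v - ‖v‖ ^ 2 / (2 * δ) ≤ e (x + v)) ∧
      (∀ x v, e (x + v) ≤ e x + inner ℝ (G x) v + ‖v‖ ^ 2 / (2 * ε)) ∧
      (∀ x, ∀ x' ∈ K, e x ≤ w x' + ‖x - x'‖ ^ 2 / (2 * ε)) ∧
      (∀ y c, (∀ x, ∀ x' ∈ K, c - ‖x - y‖ ^ 2 / (2 * δ) ≤ w x' + ‖x - x'‖ ^ 2 / (2 * ε)) →
        ∀ x, c - ‖x - y‖ ^ 2 / (2 * δ) ≤ e x) := by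
  set s := ε + δ with hs
  have hs0 : 0 < s := by positivity
  have hFc : ∀ y, ContinuousOn (fun x' => w x' + ‖y - x'‖ ^ 2 / (2 * s)) K := fun y => by
    fun_prop
  choose a haK ha using fun y => hK.exists_isMinOn hne (hFc y)
  set m : E → ℝ := fun y => w (a y) + ‖y - a y‖ ^ 2 / (2 * s) with hm
  have hmle : ∀ y, ∀ x' ∈ K, m y ≤ w x' + ‖y - x'‖ ^ 2 / (2 * s) := fun y x' hx' => ha y hx'
  have hupper : ∀ y d, m (y + d) ≤ m y + inner ℝ (s⁻¹ • (y - a y)) d + ‖d‖ ^ 2 / (2 * s) := by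
    intro y d
    refine (hmle (y + d) (a y) (haK y)).trans (le_of_eq ?_)
    rw [add_sub_right_comm, norm_add_sq_real, inner_smul_left, conj_trivial]
    simp only [hm]; field_simp; ring
  have hmc : Continuous m := by
    obtain ⟨D, hD⟩ := hK.isBounded.exists_norm_le
    have hloc : ∀ y d, m (y + d) - m y ≤ s⁻¹ * (‖y‖ + D) * ‖d‖ + ‖d‖ ^ 2 / (2 * s) := by
      intro y d
      have h1 := hupper y d
      have h2 : inner ℝ (s⁻¹ • (y - a y)) d ≤ s⁻¹ * (‖y‖ + D) * ‖d‖ := by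
        refine (real_inner_le_norm _ _).trans (mul_le_mul_of_nonneg_right ?_ (norm_nonneg _))
        rw [norm_smul, norm_inv, Real.norm_of_nonneg hs0.le]
        exact mul_le_mul_of_nonneg_left ((norm_sub_le _ _).trans
          (add_le_add_right (hD _ (haK y)) _)) (by positivity)
      linarith
    refine continuous_iff_continuousAt.2 fun y => ?_
    have hlim : Tendsto (fun y' : E => s⁻¹ * (‖y‖ + ‖y'‖ + D) * ‖y' - y‖
        + ‖y' - y‖ ^ 2 / (2 * s)) (𝓝 y) (𝓝 0) := by
      have : Continuous fun y' : E => s⁻¹ * (‖y‖ + ‖y'‖ + D) * ‖y' - y‖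
        + ‖y' - y‖ ^ 2 / (2 * s) := by fun_prop
      simpa using this.tendsto y
    refine tendsto_iff_dist_tendsto_zero.2 (squeeze_zero (fun _ => dist_nonneg) (fun y' => ?_) hlim)
    have h1 := hloc y (y' - y)
    have h2 := hloc y' (y - y')
    rw [add_sub_cancel] at h1 h2
    rw [norm_sub_rev y y'] at h2
    have h3 : 0 ≤ s⁻¹ * ‖y‖ * ‖y' - y‖ := by positivity
    have h4 : 0 ≤ s⁻¹ * ‖y'‖ * ‖y' - y‖ := by positivity
    rw [Real.dist_eq, abs_le]
    constructor <;> nlinarith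
  obtain ⟨x₀, hx₀⟩ := hne
  choose b hb using exists_forall_ge_sub_norm_sq hmc hδ (show δ < s by linarith)
    (fun y => hmle y x₀ hx₀)
  have hquad : ∀ x d, m (b x + d) ≤ m (b x) + inner ℝ (δ⁻¹ • (b x - x)) d
      + ‖d‖ ^ 2 / (2 * s) := by
    intro x d
    have hmax : ∀ t : ℝ, m (b x + t • d) ≤ m (b x) + t * inner ℝ (δ⁻¹ • (b x - x)) d
        + t ^ 2 * (‖d‖ ^ 2 / (2 * δ)) := fun t => by
      have h1 := hb x (b x + t • d)
      have e : ‖x - (b x + t • d)‖ ^ 2 = ‖x - b x‖ ^ 2 + 2 * t * inner ℝ (b x - x) d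
          + t ^ 2 * ‖d‖ ^ 2 := by
        rw [← sub_sub, norm_sub_sq_real, inner_smul_right, norm_smul, mul_pow, Real.norm_eq_abs,
          sq_abs, ← neg_sub (b x) x, inner_neg_left]
        ring
      rw [e] at h1
      rw [inner_smul_left, conj_trivial]
      have e2 : (‖x - b x‖ ^ 2 + 2 * t * inner ℝ (b x - x) d + t ^ 2 * ‖d‖ ^ 2) / (2 * δ)
        = ‖x - b x‖ ^ 2 / (2 * δ) + t * (δ⁻¹ * inner ℝ (b x - x) d)
          + t ^ 2 * (‖d‖ ^ 2 / (2 * δ)) := by field_simp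
      linarith
    have hconc : ∀ t : ℝ, 0 ≤ t → t ≤ 1 → (1 - t) * m (b x) + t * m (b x + d)
        - t * (1 - t) * (‖d‖ ^ 2 / (2 * s)) ≤ m (b x + t • d) := fun t ht ht1 => by
      have h1 := hmle (b x) _ (haK (b x + t • d))
      have h2 := hmle (b x + d) _ (haK (b x + t • d))
      set α := a (b x + t • d)
      have e1 : ‖b x + t • d - α‖ ^ 2 = ‖b x - α‖ ^ 2 + 2 * t * inner ℝ (b x - α) d
          + t ^ 2 * ‖d‖ ^ 2 := by
        rw [add_sub_right_comm, norm_add_sq_real, inner_smul_right, norm_smul, mul_pow,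
          Real.norm_eq_abs, sq_abs]
        ring
      have e2 : ‖b x + d - α‖ ^ 2 = ‖b x - α‖ ^ 2 + 2 * inner ℝ (b x - α) d + ‖d‖ ^ 2 := by
        rw [add_sub_right_comm, norm_add_sq_real]
      have e3 : m (b x + t • d) = w α + ‖b x + t • d - α‖ ^ 2 / (2 * s) := rfl
      have h3 := mul_le_mul_of_nonneg_left h1 (sub_nonneg.2 ht1)
      have h4 := mul_le_mul_of_nonneg_left h2 ht
      rw [e3, e1]
      rw [e2] at h4
      refine le_trans (by linarith) (le_of_eq (?_ : (1 - t) * (w α + ‖b x - α‖ ^ 2 / (2 * s))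
        + t * (w α + (‖b x - α‖ ^ 2 + 2 * inner ℝ (b x - α) d + ‖d‖ ^ 2) / (2 * s))
        - t * (1 - t) * (‖d‖ ^ 2 / (2 * s)) = _))
      field_simp
      ring
    have h1 : ∀ t > 0, m (b x + d) ≤ m (b x) + inner ℝ (δ⁻¹ • (b x - x)) d
        + ‖d‖ ^ 2 / (2 * s) + t * (‖d‖ ^ 2 / (2 * δ)) := by
      intro t ht
      set t' := min t 1
      have ht' : 0 < t' := by positivity
      have h1 := hmax t'
      have h2 := hconc t' ht'.le (min_le_right _ _)
      have h3 : 0 ≤ ‖d‖ ^ 2 / (2 * s) := by positivity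
      have h4 : 0 ≤ ‖d‖ ^ 2 / (2 * δ) := by positivity
      have h5 : t' * (m (b x + d)) ≤ t' * (m (b x) + inner ℝ (δ⁻¹ • (b x - x)) d
        + ‖d‖ ^ 2 / (2 * s) + t' * (‖d‖ ^ 2 / (2 * δ))) := by nlinarith [mul_nonneg ht'.le (mul_nonneg ht'.le h3)]
      have h6 := le_of_mul_le_mul_left h5 ht'
      have h7 := mul_le_mul_of_nonneg_right (min_le_left t 1) h4
      linarith
    exact le_of_forall_pos_le_add_mul h1
  refine ⟨fun x => m (b x) - ‖x - b x‖ ^ 2 / (2 * δ), fun x => δ⁻¹ • (b x - x), ?_, ?_, ?_, ?_⟩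
  · intro x v
    refine le_trans (le_of_eq ?_) (hb (x + v) (b x))
    beta_reduce
    rw [add_sub_right_comm x v, norm_add_sq_real, inner_smul_left, conj_trivial, ← neg_sub x (b x),
      inner_neg_left]
    field_simp
    ring
  · intro x v
    set d := b (x + v) - b x with hd
    have hbd : b (x + v) = b x + d := by rw [hd]; abel
    have h1 := hquad x d
    have h2 := norm_add_sq_div_le hε hδ v (d - v)
    rw [add_sub_cancel] at h2
    have e1 : ‖x + v - (b x + d)‖ ^ 2 = ‖x - b x‖ ^ 2 + 2 * inner ℝ (b x - x) (d - v)
        + ‖d - v‖ ^ 2 := by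
      rw [show x + v - (b x + d) = -((b x - x) + (d - v)) by abel, norm_neg, norm_add_sq_real,
        norm_sub_rev (b x) x]
    simp only [hbd, e1]
    rw [inner_smul_left, conj_trivial] at h1 ⊢
    rw [inner_sub_right]
    have e2 : (‖x - b x‖ ^ 2 + 2 * (inner ℝ (b x - x) d - inner ℝ (b x - x) v) + ‖d - v‖ ^ 2)
      / (2 * δ) = ‖x - b x‖ ^ 2 / (2 * δ) + δ⁻¹ * inner ℝ (b x - x) d
        - δ⁻¹ * inner ℝ (b x - x) v + ‖d - v‖ ^ 2 / (2 * δ) := by field_simp; ring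
    linarith
  · intro x x' hx'
    have h1 := hmle (b x) x' hx'
    have h2 := norm_add_sq_div_le hε hδ (x - x') (b x - x)
    rw [sub_add_sub_cancel', norm_sub_rev (b x) x] at h2
    linarith
  · intro y c hc x
    refine le_trans ?_ (hb x y)
    have h1 := hc (a y + (ε / s) • (y - a y)) (a y) (haK y)
    have e1 : a y + (ε / s) • (y - a y) - y = -((δ / s) • (y - a y)) := by
      have : δ / s = 1 - ε / s := by field_simp; rw [hs]; ring
      rw [this, sub_smul, one_smul]; abel
    rw [e1, add_sub_cancel_left, norm_neg, norm_smul, norm_smul, mul_pow, mul_pow,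
      Real.norm_of_nonneg (by positivity), Real.norm_of_nonneg (by positivity)] at h1
    have e2 : (ε / s) ^ 2 * ‖y - a y‖ ^ 2 / (2 * ε) + (δ / s) ^ 2 * ‖y - a y‖ ^ 2 / (2 * δ)
        = ‖y - a y‖ ^ 2 / (2 * s) := by
      field_simp
      rw [← hs, mul_comm]
    have e3 : m y = w (a y) + ‖y - a y‖ ^ 2 / (2 * s) := rfl
    linarith

end Regularization

section SecondOrder

variable {E : Type*} [NormedAddCommGroup E] [InnerProductSpace ℝ E]

lemma hasFDerivAt_of_abs_sub_le {e : E → ℝ} {x z : E} {L : ℝ}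
    (h : ∀ v, |e (x + v) - e x - inner ℝ z v| ≤ L * ‖v‖ ^ 2) :
    HasFDerivAt e (innerSL ℝ z) x := by
  rw [hasFDerivAt_iff_isLittleO_nhds_zero]
  refine (Asymptotics.IsBigO.of_bound L (Eventually.of_forall fun v => ?_) :
    (fun v => e (x + v) - e x - innerSL ℝ z v) =O[𝓝 0] fun v => ‖v‖ ^ 2).trans_isLittleO ?_
  · simpa using h v
  · exact Asymptotics.isLittleO_norm_pow_id one_lt_two

lemma lipschitzWith_of_abs_sub_le {e : E → ℝ} {G : E → E} {L : NNReal}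
    (h : ∀ x v, |e (x + v) - e x - inner ℝ (G x) v| ≤ L * ‖v‖ ^ 2) :
    LipschitzWith (6 * L) G := by
  refine LipschitzWith.of_dist_le_mul fun y x => ?_
  rw [dist_eq_norm, dist_eq_norm]
  set k := y - x with hk
  set D := G y - G x with hD
  have hkey : ∀ v, inner ℝ D v ≤ L * (‖k‖ ^ 2 + ‖v‖ ^ 2 + ‖k + v‖ ^ 2) := fun v => by
    have h1 := (abs_le.1 (h y v)).1
    have h2 := (abs_le.1 (h x k)).1
    have h3 := (abs_le.1 (h x (k + v))).2
    have e1 : x + k = y := by rw [hk]; abel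
    rw [← add_assoc, e1, inner_add_right] at h3
    rw [e1] at h2
    rw [hD, inner_sub_left]
    linarith
  rcases eq_or_ne D 0 with h0 | h0
  · rw [h0, norm_zero]; positivity
  have hDp : 0 < ‖D‖ := norm_pos_iff.2 h0
  rcases eq_or_ne k 0 with hk0 | hk0
  · have : y = x := sub_eq_zero.1 hk0
    rw [hD, this, sub_self, norm_zero]
    positivity
  have hkp : 0 < ‖k‖ := norm_pos_iff.2 hk0
  have h1 := hkey ((‖k‖ / ‖D‖) • D)
  have hn : ‖(‖k‖ / ‖D‖) • D‖ = ‖k‖ := by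
    rw [norm_smul, Real.norm_of_nonneg (by positivity)]; field_simp
  have hs : ‖k + (‖k‖ / ‖D‖) • D‖ ^ 2 ≤ (2 * ‖k‖) ^ 2 := by
    refine pow_le_pow_left₀ (norm_nonneg _) ((norm_add_le _ _).trans ?_) 2
    rw [hn]; linarith
  rw [inner_smul_right, real_inner_self_eq_norm_sq, hn] at h1
  have h2 : ‖k‖ / ‖D‖ * ‖D‖ ^ 2 = ‖k‖ * ‖D‖ := by field_simp
  rw [h2] at h1
  have h3 : ‖k‖ * ‖D‖ ≤ ‖k‖ * (6 * L * ‖k‖) := by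
    refine h1.trans ?_
    have := mul_le_mul_of_nonneg_left hs L.2
    simp only [NNReal.val_eq_coe] at this
    nlinarith
  exact le_of_mul_le_mul_left h3 hkp

/-- Second-order Taylor expansion at a point of differentiability of the gradient. -/
lemma eventually_taylor {F : E → ℝ} {G : E → E} (hF : ∀ x, HasFDerivAt F (innerSL ℝ (G x)) x)
    {x : E} {A : E →L[ℝ] E} (hA : HasFDerivAt G A x)
    (hs : ∀ v w, inner ℝ (A v) w = inner ℝ v (A w)) {η : ℝ} (hη : 0 < η) :
    ∀ᶠ y in 𝓝 x, |F y - (F x + inner ℝ (G x) (y - x) + (1 / 2) * inner ℝ (A (y - x)) (y - x))|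
      ≤ η * ‖y - x‖ ^ 2 := by
  have h1 := (hasFDerivAt_iff_isLittleO.1 hA).def hη
  obtain ⟨r, hr, hball⟩ := Metric.eventually_nhds_iff_ball.1 h1
  filter_upwards [Metric.ball_mem_nhds x hr] with y hy
  set φ : E → ℝ := fun y => F y - (inner ℝ (G x) (y - x) + (1 / 2) * inner ℝ (A (y - x)) (y - x))
  have hφ : ∀ y', HasFDerivAt φ (innerSL ℝ (G y' - G x - A (y' - x))) y' := fun y' => by
    have h1 : HasFDerivAt (fun y : E => y - x) (ContinuousLinearMap.id ℝ E) y' :=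
      (hasFDerivAt_id y').sub_const x
    have h2 : HasFDerivAt (fun y : E => A (y - x)) A y' := by
      have := A.hasFDerivAt.comp y' h1
      rwa [ContinuousLinearMap.comp_id] at this
    have h4 := (hF y').sub (((hasFDerivAt_const (G x) y').inner ℝ h1).add
      ((h2.inner ℝ h1).const_mul (1 / 2)))
    refine h4.congr_fderiv ?_
    ext v
    simp only [one_div, add_apply, sub_apply, ContinuousLinearMap.coe_comp,
      Function.comp_apply, ContinuousLinearMap.prod_apply, fderivInnerCLM_apply,
      ContinuousLinearMap.id_apply, smul_apply, zero_apply, inner_zero_left, smul_eq_mul,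
      innerSL_apply_apply, inner_sub_left]
    rw [hs v (y' - x), real_inner_comm (A (y' - x)) v]
    ring
  have hconv := (convex_closedBall x ‖y - x‖).norm_image_sub_le_of_norm_hasFDerivWithin_le
    (f := φ) (fun z _ => (hφ z).hasFDerivWithinAt) (C := η * ‖y - x‖) (fun z hz => by
      rw [innerSL_apply_norm]
      have hz' : ‖z - x‖ ≤ ‖y - x‖ := by rwa [mem_closedBall_iff_norm] at hz
      have hzr : z ∈ ball x r := by
        rw [mem_ball_iff_norm] at hy ⊢; linarith
      exact (hball z hzr).trans (mul_le_mul_of_nonneg_left hz' hη.le))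
    (mem_closedBall_self (norm_nonneg _)) (show y ∈ closedBall x ‖y - x‖ by
      rw [mem_closedBall_iff_norm])
  have e1 : φ y - φ x = F y - (F x + inner ℝ (G x) (y - x)
      + (1 / 2) * inner ℝ (A (y - x)) (y - x)) := by
    simp [φ]; ring
  rw [e1, Real.norm_eq_abs] at hconv
  linarith [hconv, sq (‖y - x‖), mul_assoc η ‖y - x‖ ‖y - x‖]

/-- The derivative of a gradient field is symmetric. -/
lemma inner_symm_of_hasFDerivAt {F : E → ℝ} {G : E → E}
    (hF : ∀ x, HasFDerivAt F (innerSL ℝ (G x)) x) {x : E} {A : E →L[ℝ] E}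
    (hA : HasFDerivAt G A x) (v w : E) : inner ℝ (A v) w = inner ℝ v (A w) := by
  have h := second_derivative_symmetric_of_eventually (f' := fun y => innerSL ℝ (G y))
    (f'' := (innerSL ℝ).comp A) (Eventually.of_forall hF)
    ((innerSL ℝ : E →L[ℝ] E →L[ℝ] ℝ).hasFDerivAt.comp x hA) v w
  simpa [real_inner_comm] using h

lemma gradient_eq_zero_of_forall_le {F : E → ℝ} {z x : E} (hF : HasFDerivAt F (innerSL ℝ z) x)
    (hmin : ∀ y, F x ≤ F y) : z = 0 := by
  have h := (show IsLocalMin F x from Eventually.of_forall hmin).hasFDerivAt_eq_zero hF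
  have := congrArg (fun l : E →L[ℝ] ℝ => l z) h
  simpa using this

lemma inner_nonneg_of_forall_le {F : E → ℝ} {G : E → E}
    (hF : ∀ x, HasFDerivAt F (innerSL ℝ (G x)) x) {x : E} {A : E →L[ℝ] E}
    (hA : HasFDerivAt G A x) (hmin : ∀ y, F x ≤ F y) (v : E) : 0 ≤ inner ℝ (A v) v := by
  have hG := gradient_eq_zero_of_forall_le (hF x) hmin
  refine le_of_forall_pos_le_add_mul (c := 2 * ‖v‖ ^ 2) fun η hη => ?_
  have h1 := eventually_taylor hF hA (inner_symm_of_hasFDerivAt hF hA) hη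
  have hc : Tendsto (fun t : ℝ => x + t • v) (𝓝[>] 0) (𝓝 x) := by
    have : Continuous fun t : ℝ => x + t • v := by fun_prop
    simpa using (this.tendsto 0).mono_left nhdsWithin_le_nhds
  obtain ⟨t, ht, ht0⟩ := ((hc.eventually h1).and self_mem_nhdsWithin).exists
  rw [hG, add_sub_cancel_left, inner_zero_left, map_smul, inner_smul_left, inner_smul_right,
    norm_smul, mul_pow, Real.norm_eq_abs, sq_abs, conj_trivial] at ht
  have h2 := (abs_le.1 ht).2
  have h3 := hmin (x + t • v)
  have h4 : 0 ≤ t ^ 2 * (inner ℝ (A v) v + η * (2 * ‖v‖ ^ 2)) := by nlinarith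
  exact le_of_mul_le_mul_left (by simpa using h4) (by positivity : 0 < t ^ 2)

end SecondOrder

lemma hasDerivAt_abs_rpow_mul_self {p : ℝ} (hp : 0 ≤ p) (x : ℝ) :
    HasDerivAt (fun x : ℝ => |x| ^ p * x) ((p + 1) * |x| ^ p) x := by
  have hpos : ∀ y : ℝ, 0 < y → HasDerivAt (fun x : ℝ => |x| ^ p * x) ((p + 1) * |y| ^ p) y := by
    intro y hy
    have h1 := Real.hasDerivAt_rpow_const (x := y) (p := p + 1) (Or.inl hy.ne')
    rw [add_sub_cancel_right] at h1
    rw [abs_of_pos hy]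
    refine h1.congr_of_eventuallyEq ?_
    filter_upwards [lt_mem_nhds hy] with z hz
    rw [abs_of_pos hz, Real.rpow_add_one hz.ne']
  rcases lt_trichotomy x 0 with hx | hx | hx
  · have h1 := ((hpos (-x) (by linarith)).comp x (hasDerivAt_neg x)).neg
    exact (h1.congr_deriv (by simp)).congr_of_eventuallyEq (Eventually.of_forall fun y => by simp)
  · subst hx
    rcases hp.eq_or_lt with h0 | h0
    · subst h0
      simpa using hasDerivAt_id' (0 : ℝ)
    · rw [abs_zero, Real.zero_rpow h0.ne', mul_zero, hasDerivAt_iff_tendsto_slope]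
      have hc : Continuous fun y : ℝ => |y| ^ p := continuous_abs.rpow_const fun _ => Or.inr hp
      have h1 := (hc.tendsto 0).mono_left (nhdsWithin_le_nhds (s := {0}ᶜ))
      rw [abs_zero, Real.zero_rpow h0.ne'] at h1
      refine h1.congr' ?_
      filter_upwards [self_mem_nhdsWithin] with y hy
      have hy0 : y ≠ 0 := hy
      rw [slope_def_field]
      field_simp
      simp
  · exact hpos x hx

lemma exists_between_eq_mul {η g : ℝ → ℝ} (h : ∀ t, HasDerivAt η (g t) t) (t s : ℝ) :
    ∃ θ ∈ Icc (0 : ℝ) 1, η (t + s) - η t = g (t + θ * s) * s := by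
  have h1 : ∀ θ : ℝ, HasDerivAt (fun θ => η (t + θ * s)) (g (t + θ * s) * s) θ := fun θ => by
    have h2 : HasDerivAt (fun θ : ℝ => t + θ * s) s θ := by
      simpa using ((hasDerivAt_id θ).mul_const s).const_add t
    exact (h (t + θ * s)).comp θ h2
  obtain ⟨θ, hθ, h3⟩ := exists_hasDerivAt_eq_slope (fun θ => η (t + θ * s))
    (fun θ => g (t + θ * s) * s) zero_lt_one
    (fun θ _ => (h1 θ).continuousAt.continuousWithinAt) (fun θ _ => h1 θ)
  refine ⟨θ, ⟨hθ.1.le, hθ.2.le⟩, ?_⟩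
  simpa using h3.symm

/-- A convex cost `η` whose derivative `g` inverts `ζ ↦ |ζ|^p ζ + δ ζ`. -/
lemma exists_cost {p δ : ℝ} (hp : 0 ≤ p) (hδ : 0 < δ) (hδ1 : δ ≤ 1) :
    ∃ g η : ℝ → ℝ, (∀ t, |g t| ^ p * g t + δ * g t = t) ∧
      (∀ t, HasDerivAt η (g t) t) ∧
      (∀ t, HasDerivAt g ((p + 1) * |g t| ^ p + δ)⁻¹ t) ∧
      (∀ t s, η (t + s) ≤ η t + g t * s + s ^ 2 / δ) ∧
      (∀ t, |t| - 2 ≤ η t) ∧ (∀ t, 0 ≤ η t) ∧ (∀ t, |t| ≤ 10 → η t ≤ 100) ∧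
      (∀ t, |t| ≤ 2 → |t| / 2 ≤ |g t|) ∧ (∀ t, |g t| ≤ max 1 |t|) := by
  set Φ : ℝ → ℝ := fun x => |x| ^ p * x + δ * x with hΦ
  have hd : ∀ x, HasDerivAt Φ ((p + 1) * |x| ^ p + δ) x := fun x =>
    (hasDerivAt_abs_rpow_mul_self hp x).add (by simpa using (hasDerivAt_id x).const_mul δ)
  have hdpos : ∀ x : ℝ, 0 < (p + 1) * |x| ^ p + δ := fun x => by positivity
  have hmono : StrictMono Φ := strictMono_of_deriv_pos fun x => by
    rw [(hd x).deriv]; exact hdpos x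
  have hcont : Continuous Φ := continuous_iff_continuousAt.2 fun x => (hd x).continuousAt
  have hsurj : Function.Surjective Φ := by
    refine hcont.surjective ?_ ?_
    · refine tendsto_atTop_mono' _ ?_ (tendsto_id.const_mul_atTop hδ)
      filter_upwards [eventually_ge_atTop 0] with x hx
      simp only [hΦ, id]
      have : 0 ≤ |x| ^ p * x := by positivity
      linarith
    · refine tendsto_atBot_mono' _ ?_ (tendsto_id.const_mul_atBot hδ)
      filter_upwards [eventually_le_atBot 0] with x hx
      simp only [hΦ, id]
      have : |x| ^ p * x ≤ 0 := mul_nonpos_of_nonneg_of_nonpos (by positivity) hx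
      linarith
  set e := hmono.orderIsoOfSurjective Φ hsurj with he
  set g : ℝ → ℝ := fun t => e.symm t with hg
  have hgΦ : ∀ t, Φ (g t) = t := fun t => e.apply_symm_apply t
  have hgc : Continuous g := e.symm.continuous
  have hgm : Monotone g := e.symm.monotone
  have hΦ0 : Φ 0 = 0 := by simp [hΦ]
  have hg0 : g 0 = 0 := hmono.injective (by rw [hgΦ, hΦ0])
  have hgd : ∀ t, HasDerivAt g ((p + 1) * |g t| ^ p + δ)⁻¹ t := fun t =>
    HasDerivAt.of_local_left_inverse hgc.continuousAt (hd (g t)) (hdpos _).ne'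
      (Eventually.of_forall hgΦ)
  have hη : ∀ t, HasDerivAt (fun t => ∫ s in (0 : ℝ)..t, g s) (g t) t := fun t =>
    intervalIntegral.integral_hasDerivAt_right (hgc.intervalIntegrable _ _)
      hgc.stronglyMeasurable.stronglyMeasurableAtFilter hgc.continuousAt
  set η : ℝ → ℝ := fun t => ∫ s in (0 : ℝ)..t, g s
  have hη0 : η 0 = 0 := intervalIntegral.integral_same
  have habs : ∀ t, |g t| ^ p * |g t| + δ * |g t| = |t| := fun t => by
    have h1 : |t| = |g t| * (|g t| ^ p + δ) := by
      conv_lhs => rw [← hgΦ t]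
      rw [hΦ]
      simp only
      rw [← add_mul, abs_mul, abs_of_pos (add_pos_of_nonneg_of_pos (by positivity) hδ), mul_comm]
    rw [h1]; ring
  have hle : ∀ t, |g t| ≤ max 1 |t| := fun t => by
    rcases le_total |g t| 1 with h | h
    · exact h.trans (le_max_left _ _)
    · refine le_trans ?_ (le_max_right _ _)
      rw [← habs t]
      have := Real.one_le_rpow h hp
      nlinarith [mul_nonneg hδ.le (abs_nonneg (g t)), abs_nonneg (g t)]
  have hge : ∀ t, |g t| ≤ 1 → |t| / 2 ≤ |g t| := fun t h => by
    rw [← habs t]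
    have := Real.rpow_le_one (abs_nonneg (g t)) h hp
    nlinarith [abs_nonneg (g t)]
  have hge2 : ∀ t, |t| ≤ 2 → |t| / 2 ≤ |g t| := fun t ht => by
    rcases le_total |g t| 1 with h | h
    · exact hge t h
    · linarith
  have hg2 : ∀ t, 2 ≤ |t| → 1 ≤ |g t| := fun t ht => by
    by_contra! h
    have := hge t h.le
    linarith
  have hnn : ∀ t, 0 ≤ t → 0 ≤ g t := fun t ht => hg0 ▸ hgm ht
  have hnp : ∀ t, t ≤ 0 → g t ≤ 0 := fun t ht => hg0 ▸ hgm ht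
  have hη_nonneg : ∀ t, 0 ≤ η t := fun t => by
    obtain ⟨θ, hθ, h1⟩ := exists_between_eq_mul hη 0 t
    rw [zero_add, zero_add, hη0, sub_zero] at h1
    rw [h1]
    rcases le_total 0 t with h | h
    · exact mul_nonneg (hnn _ (mul_nonneg hθ.1 h)) h
    · exact mul_nonneg_of_nonpos_of_nonpos (hnp _ (mul_nonpos_of_nonneg_of_nonpos hθ.1 h)) h
  have hlip : ∀ t s, (g (t + s) - g t) * s ≤ s ^ 2 / δ := fun t s => by
    rw [le_div_iff₀ hδ]
    have h1 := hgΦ (t + s)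
    have h2 := hgΦ t
    have hm : Monotone fun x : ℝ => |x| ^ p * x := monotone_of_deriv_nonneg
      (fun x => (hasDerivAt_abs_rpow_mul_self hp x).differentiableAt) fun x => by
        rw [(hasDerivAt_abs_rpow_mul_self hp x).deriv]; positivity
    simp only [hΦ] at h1 h2
    rcases le_total 0 s with hs | hs
    · have h3 := hm (hgm (show t ≤ t + s by linarith))
      have h4 : δ * (g (t + s) - g t) ≤ s := by simp only at h3; linarith
      nlinarith
    · have h3 := hm (hgm (show t + s ≤ t by linarith))
      have h4 : s ≤ δ * (g (t + s) - g t) := by simp only at h3; linarith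
      nlinarith
  refine ⟨g, η, hgΦ, hη, hgd, ?_, ?_, hη_nonneg, ?_, hge2, hle⟩
  · intro t s
    obtain ⟨θ, hθ, h1⟩ := exists_between_eq_mul hη t s
    have h2 : (g (t + θ * s) - g t) * s ≤ (g (t + s) - g t) * s := by
      rcases le_total 0 s with hs | hs
      · exact mul_le_mul_of_nonneg_right (sub_le_sub_right
          (hgm (by nlinarith [hθ.2])) _) hs
      · exact mul_le_mul_of_nonpos_right (sub_le_sub_right
          (hgm (by nlinarith [hθ.2])) _) hs
    linarith [hlip t s]
  · intro t
    rcases le_total |t| 2 with ht | ht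
    · linarith [hη_nonneg t]
    rcases le_total 0 t with h | h
    · rw [abs_of_nonneg h] at ht ⊢
      obtain ⟨θ, hθ, h1⟩ := exists_between_eq_mul hη 2 (t - 2)
      rw [add_sub_cancel] at h1
      have h3 : 2 ≤ 2 + θ * (t - 2) := by nlinarith [hθ.1]
      have h4 := hg2 (2 + θ * (t - 2)) (h3.trans (le_abs_self _))
      rw [abs_of_nonneg (hnn _ (by linarith))] at h4
      nlinarith [hη_nonneg 2]
    · rw [abs_of_nonpos h] at ht ⊢
      obtain ⟨θ, hθ, h1⟩ := exists_between_eq_mul hη (-2) (t + 2)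
      rw [neg_add_cancel_comm_assoc] at h1
      have h3 : -2 + θ * (t + 2) ≤ -2 := by nlinarith [hθ.1]
      have h4 := hg2 (-2 + θ * (t + 2)) (by rw [abs_of_nonpos (by linarith)]; linarith)
      rw [abs_of_nonpos (hnp _ (by linarith))] at h4
      nlinarith [hη_nonneg (-2)]
  · intro t ht
    obtain ⟨θ, hθ, h1⟩ := exists_between_eq_mul hη 0 t
    rw [zero_add, zero_add, hη0, sub_zero] at h1
    rw [h1]
    refine (le_abs_self _).trans ?_
    rw [abs_mul]
    have h2 : |g (θ * t)| ≤ 10 := (hle _).trans (max_le (by norm_num) (by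
      rw [abs_mul, abs_of_nonneg hθ.1]
      nlinarith [hθ.1, hθ.2, abs_nonneg t]))
    nlinarith [abs_nonneg t, abs_nonneg (g (θ * t))]

lemma En.eq_sum_smul_single {n : ℕ} (v : En n) :
    v = ∑ i, v i • EuclideanSpace.single i (1 : ℝ) := by
  ext j; simp [Pi.single_apply]

lemma En.norm_le_sum_abs {n : ℕ} (v : En n) : ‖v‖ ≤ ∑ i, |v i| := by
  conv_lhs => rw [En.eq_sum_smul_single v]
  refine (norm_sum_le _ _).trans (le_of_eq (Finset.sum_congr rfl fun i _ => ?_))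
  rw [norm_smul, PiLp.norm_single, norm_one, mul_one, Real.norm_eq_abs]

lemma En.norm_le_mul_of_forall_abs_le {n : ℕ} {v : En n} {c : ℝ} (h : ∀ i, |v i| ≤ c) :
    ‖v‖ ≤ n * c := by
  refine (En.norm_le_sum_abs v).trans ((Finset.sum_le_sum fun i _ => h i).trans ?_)
  simp

/-- If `I + d A` is conjugate to a nonnegative matrix, its determinant is at most the `n`-th power
of its trace. -/
lemma abs_det_id_add_diagL_comp_le {n : ℕ} {d : Fin n → ℝ} (hd : ∀ i, 0 < d i)
    {A : En n →L[ℝ] En n} (hA : ∀ v w, inner ℝ (A v) w = inner ℝ v (A w))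
    (hlow : ∀ v : En n, -∑ i, v i ^ 2 / d i ≤ inner ℝ (A v) v) {τ : ℝ}
    (hτ : n + ∑ i, d i * A (EuclideanSpace.single i 1) i ≤ τ) :
    |(ContinuousLinearMap.id ℝ (En n) + (diagL d).comp A).det| ≤ τ ^ n := by
  have hsym : ∀ i j, A (EuclideanSpace.single i 1) j = A (EuclideanSpace.single j 1) i := by
    intro i j
    have := hA (EuclideanSpace.single i 1) (EuclideanSpace.single j 1)
    simpa [EuclideanSpace.inner_single_right, EuclideanSpace.inner_single_left] using this
  set M : Matrix (Fin n) (Fin n) ℝ := Matrix.of fun i j => A (EuclideanSpace.single j 1) i with hM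
  set S : Matrix (Fin n) (Fin n) ℝ := Matrix.diagonal fun i => √(d i) with hS
  set N : Matrix (Fin n) (Fin n) ℝ := 1 + S * M * S with hNdef
  have hNij : ∀ i j, N i j = (1 : Matrix (Fin n) (Fin n) ℝ) i j
      + √(d i) * A (EuclideanSpace.single j 1) i * √(d j) := by
    intro i j
    simp [hNdef, hS, hM, Matrix.mul_diagonal, Matrix.diagonal_mul]
  have hsq : ∀ i, √(d i) * √(d i) = d i := fun i => Real.mul_self_sqrt (hd i).le
  have hdet : (ContinuousLinearMap.id ℝ (En n) + (diagL d).comp A).det = N.det := by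
    rw [hNdef, Matrix.det_one_add_mul_comm, ← mul_assoc, ContinuousLinearMap.det,
      ← LinearMap.det_toMatrix (EuclideanSpace.basisFun (Fin n) ℝ).toBasis]
    congr 1
    ext i j
    rw [LinearMap.toMatrix_apply]
    simp [hS, hM, Matrix.diagonal_mul_diagonal, hsq, Matrix.diagonal_mul, Matrix.one_apply]
  have hN : N.IsHermitian := by
    ext i j
    simp only [Matrix.conjTranspose_apply, star_trivial, hNij, hsym j i, Matrix.one_apply,
      eq_comm (a := i)]
    ring
  have hquad : ∀ ξ : En n, 0 * ‖ξ‖ ^ 2 ≤ ∑ i, ∑ j, ξ i * N i j * ξ j := by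
    intro ξ
    set v : En n := diagL (fun i => √(d i)) ξ with hv
    have hsum : A v = ∑ j, v j • A (EuclideanSpace.single j 1) := by
      conv_lhs => rw [En.eq_sum_smul_single v]
      simp
    have h1 : ∑ i, ∑ j, ξ i * N i j * ξ j = ‖ξ‖ ^ 2 + inner ℝ (A v) v := by
      rw [En.norm_sq_eq_sum, real_inner_comm, En.inner_eq_sum, ← Finset.sum_add_distrib]
      refine Finset.sum_congr rfl fun i _ => ?_
      rw [hsum]
      simp only [hNij, mul_add, add_mul, Finset.sum_add_distrib, Matrix.one_apply]
      congr 1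
      · simp [pow_two]
      · rw [WithLp.ofLp_sum, Finset.sum_apply, Finset.mul_sum]
        refine Finset.sum_congr rfl fun j _ => ?_
        simp [hv]; ring
    have h2 : ∑ i, v i ^ 2 / d i = ‖ξ‖ ^ 2 := by
      rw [En.norm_sq_eq_sum]
      refine Finset.sum_congr rfl fun i _ => ?_
      rw [hv, diagL_apply, mul_pow, Real.sq_sqrt (hd i).le, mul_div_cancel_left₀ _ (hd i).ne']
    rw [h1, zero_mul]
    linarith [hlow v]
  have htr : ∑ i, hN.eigenvalues i = n + ∑ i, d i * A (EuclideanSpace.single i 1) i := by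
    have h1 : N.trace = ∑ i, hN.eigenvalues i := by simpa using hN.trace_eq_sum_eigenvalues
    have h2 : ∀ i, N i i = 1 + d i * A (EuclideanSpace.single i 1) i := fun i => by
      rw [hNij, Matrix.one_apply_eq, mul_right_comm, hsq]
    rw [← h1, Matrix.trace]
    simp [h2, Finset.sum_add_distrib]
  have hpos : ∀ i, 0 ≤ hN.eigenvalues i := hN.le_eigenvalues hquad
  have hle : ∀ i, hN.eigenvalues i ≤ τ := fun i =>
    (Finset.single_le_sum (fun j _ => hpos j) (Finset.mem_univ i)).trans (htr.le.trans hτ)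
  rw [hdet, hN.det_eq_prod_eigenvalues]
  simp only [RCLike.ofReal_real_eq_id, id]
  rw [Finset.abs_prod]
  calc ∏ i, |hN.eigenvalues i| ≤ ∏ _i : Fin n, τ :=
        Finset.prod_le_prod (fun i _ => abs_nonneg _) fun i _ => by
          rw [abs_of_nonneg (hpos i)]; exact hle i
    _ = τ ^ n := by simp

/-- Determinant estimate at a contact point. -/
lemma abs_det_contact_le {n : ℕ} {lam Lam p Γ δ ε F τ : ℝ} (hlam : 0 < lam) (hlL : lam ≤ Lam)
    (hp : 0 ≤ p) (hδ : 0 < δ) {z : En n} {A : En n →L[ℝ] En n}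
    (hA : ∀ v w, inner ℝ (A v) w = inner ℝ v (A w))
    (hlow : ∀ v : En n, -∑ i, v i ^ 2 / ((p + 1) * |z i| ^ p + δ) ≤ inner ℝ (A v) v)
    (hup : ∀ v : En n, inner ℝ (A v) v ≤ ‖v‖ ^ 2 / ε)
    (hP : ∀ κ ≥ 0, (∀ ξ : En n, -κ * ‖ξ‖ ^ 2 ≤
      inner ℝ (A (diagL (fun i => |z i| ^ (p / 2)) ξ)) (diagL (fun i => |z i| ^ (p / 2)) ξ)) →
      lam * (∑ i, |z i| ^ p * A (EuclideanSpace.single i 1) i + κ * n + Γ * ∑ i, |z i| ^ (p + 2))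
      ≤ Lam * κ * n + Lam * ‖z‖ ^ (p + 1) + F)
    (hτ : (p + 1) / lam * (Lam * n + Lam * ‖z‖ ^ (p + 1)
      - lam * Γ * ∑ i, |z i| ^ (p + 2) + F) + δ * (n / ε) ≤ τ) :
    |(ContinuousLinearMap.id ℝ (En n)
        + (diagL fun i => (p + 1) * |z i| ^ p + δ).comp A).det| ≤ τ ^ n := by
  refine abs_det_id_add_diagL_comp_le (fun i => by positivity) hA hlow (le_trans ?_ hτ)
  have hp1 : 0 < p + 1 := by linarith
  have h1 := hP (1 / (p + 1)) (by positivity) (fun ξ => by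
    refine le_trans ?_ (hlow _)
    rw [neg_mul, neg_le_neg_iff, En.norm_sq_eq_sum, Finset.mul_sum]
    refine Finset.sum_le_sum fun i _ => ?_
    have hz : (|z i| ^ (p / 2)) ^ 2 = |z i| ^ p := by
      rw [← Real.rpow_natCast, ← Real.rpow_mul (abs_nonneg _)]
      congr 1; push_cast; ring
    have h0 : 0 ≤ |z i| ^ p := by positivity
    rw [diagL_apply, mul_pow, hz, one_div, inv_mul_eq_div, div_le_div_iff₀ (by positivity) hp1]
    nlinarith [sq_nonneg (ξ i)])
  have h2 : ∑ i, A (EuclideanSpace.single i 1) i ≤ n / ε := by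
    have h3 : ∀ i, A (EuclideanSpace.single i 1) i ≤ 1 / ε := fun i => by
      have := hup (EuclideanSpace.single i 1)
      simpa [EuclideanSpace.inner_single_right] using this
    refine (Finset.sum_le_sum fun i _ => h3 i).trans (le_of_eq ?_)
    simp [div_eq_mul_inv]
  have h4 : ∑ i, ((p + 1) * |z i| ^ p + δ) * A (EuclideanSpace.single i 1) i
      = (p + 1) * ∑ i, |z i| ^ p * A (EuclideanSpace.single i 1) i
        + δ * ∑ i, A (EuclideanSpace.single i 1) i := by
    rw [Finset.mul_sum, Finset.mul_sum, ← Finset.sum_add_distrib]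
    exact Finset.sum_congr rfl fun i _ => by ring
  rw [h4, ← add_assoc]
  refine add_le_add ?_ (mul_le_mul_of_nonneg_left h2 hδ.le)
  have h5 : Lam * (1 / (p + 1)) * n ≤ Lam * n := by
    have : 1 / (p + 1) ≤ 1 := by rw [div_le_one hp1]; linarith
    have h6 : 0 ≤ Lam * n := mul_nonneg (by linarith) (Nat.cast_nonneg n)
    nlinarith
  set X := ∑ i, |z i| ^ p * A (EuclideanSpace.single i 1) i
  have h7 : lam * (X + 1 / (p + 1) * n) ≤ Lam * n + Lam * ‖z‖ ^ (p + 1)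
        - lam * Γ * ∑ i, |z i| ^ (p + 2) + F := by linarith
  calc n + (p + 1) * X = (p + 1) / lam * (lam * (X + 1 / (p + 1) * n)) := by field_simp; ring
    _ ≤ _ := mul_le_mul_of_nonneg_left h7 (by positivity)

/-- The good gradient term absorbs the bad ones away from the vertex. -/
lemma gradient_terms_le {n : ℕ} {lam Lam p Γ c : ℝ} (hlam : 0 < lam) (hlL : lam ≤ Lam)
    (hp : 0 ≤ p) (hc : 0 < c)
    (hΓ : Lam / lam * (n / c ^ (p + 2) + n ^ (p + 1) / c) ≤ Γ) {z : En n} (hz : ∃ i, c ≤ |z i|) :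
    Lam * n + Lam * ‖z‖ ^ (p + 1) ≤ lam * Γ * ∑ i, |z i| ^ (p + 2) := by
  obtain ⟨i₀, hi₀⟩ := hz
  obtain ⟨i, -, hi⟩ := Finset.exists_max_image Finset.univ (fun i => |z i|) ⟨i₀, Finset.mem_univ _⟩
  set t := |z i| with ht
  have hct : c ≤ t := hi₀.trans (hi i₀ (Finset.mem_univ _))
  have ht0 : 0 < t := hc.trans_le hct
  have hLam : 0 < Lam := by linarith
  have h1 : ‖z‖ ≤ n * t := En.norm_le_mul_of_forall_abs_le fun j => hi j (Finset.mem_univ _)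
  have h2 : ‖z‖ ^ (p + 1) ≤ n ^ (p + 1) * t ^ (p + 1) := by
    rw [← Real.mul_rpow (Nat.cast_nonneg _) ht0.le]
    exact Real.rpow_le_rpow (norm_nonneg _) h1 (by linarith)
  have h3 : t ^ (p + 1) ≤ t ^ (p + 2) / c := by
    rw [le_div_iff₀ hc, show p + 2 = p + 1 + 1 by ring, Real.rpow_add_one ht0.ne' (p + 1)]
    exact mul_le_mul_of_nonneg_left hct (by positivity)
  have h4 : 1 ≤ t ^ (p + 2) / c ^ (p + 2) := by
    rw [le_div_iff₀ (by positivity), one_mul]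
    exact Real.rpow_le_rpow hc.le hct (by linarith)
  have h5 : t ^ (p + 2) ≤ ∑ i, |z i| ^ (p + 2) :=
    Finset.single_le_sum (f := fun i => |z i| ^ (p + 2)) (fun j _ => by positivity)
      (Finset.mem_univ i)
  have hn0 : (0 : ℝ) ≤ n := Nat.cast_nonneg n
  have h6 : 0 ≤ Γ := le_trans (by positivity) hΓ
  calc Lam * n + Lam * ‖z‖ ^ (p + 1)
      ≤ Lam * (n * (t ^ (p + 2) / c ^ (p + 2))) + Lam * (n ^ (p + 1) * (t ^ (p + 2) / c)) := by
        refine add_le_add (mul_le_mul_of_nonneg_left (le_mul_of_one_le_right hn0 h4) hLam.le)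
          (mul_le_mul_of_nonneg_left (h2.trans (mul_le_mul_of_nonneg_left h3 (by positivity)))
            hLam.le)
    _ = lam * (Lam / lam * (n / c ^ (p + 2) + n ^ (p + 1) / c)) * t ^ (p + 2) := by
        field_simp
    _ ≤ lam * Γ * ∑ i, |z i| ^ (p + 2) := by
        refine mul_le_mul (mul_le_mul_of_nonneg_left hΓ hlam.le) h5 (by positivity)
          (by positivity)

/-- The vector map `ζ ↦ (φ ζ₁, …, φ ζₙ)`. -/
def coordMap {n : ℕ} (φ : ℝ → ℝ) (x : En n) : En n := WithLp.toLp 2 fun i => φ (x i)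

@[simp] lemma coordMap_apply {n : ℕ} (φ : ℝ → ℝ) (x : En n) (i : Fin n) :
    coordMap φ x i = φ (x i) := rfl

lemma hasFDerivAt_coordMap {n : ℕ} {φ φ' : ℝ → ℝ} (h : ∀ t, HasDerivAt φ (φ' t) t) (x : En n) :
    HasFDerivAt (coordMap φ) (diagL fun i => φ' (x i)) x := by
  rw [← hasFDerivWithinAt_univ, hasFDerivWithinAt_euclidean]
  intro i
  rw [hasFDerivWithinAt_univ]
  have h1 := (h (x i)).hasFDerivAt.comp x (EuclideanSpace.proj (𝕜 := ℝ) i).hasFDerivAt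
  refine h1.congr_fderiv ?_
  ext v
  simp [mul_comm]

lemma hasFDerivAt_sum_coord {n : ℕ} {η g : ℝ → ℝ} (h : ∀ t, HasDerivAt η (g t) t) (x : En n) :
    HasFDerivAt (fun x : En n => ∑ i, η (x i)) (innerSL ℝ (coordMap g x)) x := by
  have h1 := HasFDerivAt.fun_sum (u := Finset.univ) fun i _ =>
    (h (x i)).hasFDerivAt.comp x (EuclideanSpace.proj (𝕜 := ℝ) i).hasFDerivAt
  refine h1.congr_fderiv ?_
  ext v
  simp [En.inner_eq_sum, mul_comm]

/-- The transport cost used for the sliding argument. -/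
lemma exists_cost_vec {n : ℕ} {p δ : ℝ} (hn : 1 ≤ n) (hp : 0 ≤ p) (hδ : 0 < δ) (hδ1 : δ ≤ 1) :
    ∃ (H : En n → ℝ) (g : En n → En n),
      (∀ x, HasFDerivAt H (innerSL ℝ (g x)) x) ∧
      (∀ x, HasFDerivAt g (diagL fun i => ((p + 1) * |g x i| ^ p + δ)⁻¹) x) ∧
      (∀ x, coordMap (fun t => |t| ^ p * t + δ * t) (g x) = x) ∧
      (∀ x v, H (x + v) ≤ H x + inner ℝ (g x) v + ‖v‖ ^ 2 / δ) ∧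
      (∀ x, 0 ≤ H x) ∧ (∀ x, ‖x‖ - 2 * n ≤ H x) ∧ (∀ x, ‖x‖ ≤ 10 → H x ≤ 100 * n) ∧
      (∀ x, 1 / 2 ≤ ‖x‖ → ∃ i, 1 / (4 * n : ℝ) ≤ |g x i|) ∧ (∀ x, ‖x‖ ≤ 1 → ‖g x‖ ≤ n) := by
  obtain ⟨g, η, h1, h2, h3, h4, h5, h6, h7, h8, h9⟩ := exists_cost hp hδ hδ1
  have hn0 : (1 : ℝ) ≤ n := by exact_mod_cast hn
  refine ⟨fun x => ∑ i, η (x i), coordMap g, hasFDerivAt_sum_coord h2,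
    fun x => hasFDerivAt_coordMap h3 x, fun x => ?_, fun x v => ?_,
    fun x => Finset.sum_nonneg fun i _ => h6 _, fun x => ?_, fun x hx => ?_, fun x hx => ?_,
    fun x hx => ?_⟩
  · ext i
    simp [h1]
  · rw [En.inner_eq_sum, En.norm_sq_eq_sum, Finset.sum_div, ← Finset.sum_add_distrib,
      ← Finset.sum_add_distrib]
    exact Finset.sum_le_sum fun i _ => h4 (x i) (v i)
  · have : ∑ i, |x i| - 2 * n = ∑ i, (|x i| - 2) := by
      simp [Finset.sum_sub_distrib, mul_comm]
    refine (sub_le_sub_right (En.norm_le_sum_abs x) _).trans ?_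
    rw [this]
    exact Finset.sum_le_sum fun i _ => h5 (x i)
  · refine (Finset.sum_le_sum fun i _ => h7 (x i) ((En.abs_apply_le_norm x i).trans hx)).trans ?_
    simp [mul_comm]
  · obtain ⟨i, hi⟩ : ∃ i, 1 / (2 * n : ℝ) ≤ |x i| := by
      by_contra! h
      have h10 : ∑ i, |x i| < ∑ _i : Fin n, 1 / (2 * n : ℝ) :=
        Finset.sum_lt_sum_of_nonempty ⟨⟨0, hn⟩, Finset.mem_univ _⟩ fun i _ => h i
      have h11 : ∑ _i : Fin n, 1 / (2 * n : ℝ) = 1 / 2 := by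
        rw [Finset.sum_const, Finset.card_univ, Fintype.card_fin, nsmul_eq_mul]; field_simp
      linarith [En.norm_le_sum_abs x]
    refine ⟨i, ?_⟩
    rw [coordMap_apply]
    have h10 : 1 / (4 * n : ℝ) = 1 / (2 * n) / 2 := by field_simp; norm_num
    rw [h10]
    rcases le_total |x i| 2 with h | h
    · exact (div_le_div_of_nonneg_right hi (by norm_num)).trans (h8 _ h)
    · have h12 := h8 2 (by norm_num)
      have h13 : 1 / (2 * n : ℝ) ≤ 1 := by rw [div_le_one (by positivity)]; linarith
      have h14 : 1 ≤ |g (x i)| := by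
        by_contra! hlt
        have h15 : |g (x i)| ^ p ≤ 1 := Real.rpow_le_one (abs_nonneg _) hlt.le hp
        have h16 := congrArg abs (h1 (x i))
        rw [← add_mul, abs_mul, abs_of_pos (by positivity)] at h16
        nlinarith [abs_nonneg (g (x i))]
      linarith
  · have h10 : ‖coordMap g x‖ ≤ n * 1 := En.norm_le_mul_of_forall_abs_le fun i =>
      (h9 (x i)).trans (max_le le_rfl ((En.abs_apply_le_norm x i).trans hx))
    linarith

lemma exists_lipschitzOnWith_coordMap {n : ℕ} {p δ : ℝ} (hp : 0 ≤ p) (hδ : 0 < δ) {B : ℝ}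
    (hB : 0 ≤ B) : ∃ C : NNReal, LipschitzOnWith C
      (coordMap (n := n) (fun t => |t| ^ p * t + δ * t)) (closedBall 0 B) := by
  have hd : ∀ t : ℝ, HasDerivAt (fun t => |t| ^ p * t + δ * t) ((p + 1) * |t| ^ p + δ) t :=
    fun t => (hasDerivAt_abs_rpow_mul_self hp t).add (by
      simpa using (hasDerivAt_id t).const_mul δ)
  set L := n * ((p + 1) * B ^ p + δ) with hL
  have hL0 : 0 ≤ L := by positivity
  refine ⟨L.toNNReal, (convex_closedBall (0 : En n) B).lipschitzOnWith_of_nnnorm_hasFDerivWithin_le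
    (fun x _ => (hasFDerivAt_coordMap hd x).hasFDerivWithinAt) fun x hx => ?_⟩
  rw [← NNReal.coe_le_coe, coe_nnnorm, Real.coe_toNNReal _ hL0]
  refine ContinuousLinearMap.opNorm_le_bound _ hL0 fun v => ?_
  rw [hL, mul_assoc]
  refine En.norm_le_mul_of_forall_abs_le fun i => ?_
  rw [diagL_apply, abs_mul, abs_of_pos (by positivity)]
  have h1 : |x i| ≤ B := (En.abs_apply_le_norm x i).trans (by simpa using hx)
  refine mul_le_mul ?_ (En.abs_apply_le_norm v i) (abs_nonneg _) (by positivity)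
  have := Real.rpow_le_rpow (abs_nonneg _) h1 hp
  nlinarith

lemma volume_image_eq_zero_of_lipschitzOnWith {n : ℕ} {C : NNReal} {T : En n → En n}
    {s : Set (En n)} (hT : LipschitzOnWith C T s) (hs : volume s = 0) : volume (T '' s) = 0 := by
  have h0 : μH[(Module.finrank ℝ (En n) : ℝ)] s = 0 :=
    Measure.absolutelyContinuous_isAddHaarMeasure _ volume hs
  have h1 := hT.hausdorffMeasure_image_le (d := Module.finrank ℝ (En n)) (by positivity)
  rw [h0, mul_zero] at h1
  exact Measure.absolutelyContinuous_isAddHaarMeasure volume μH[(Module.finrank ℝ (En n) : ℝ)]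
    (le_antisymm h1 bot_le)

lemma volume_le_lintegral_of_forall_exists {n : ℕ} {K Y : Set (En n)} {T G : En n → En n}
    (hK : MeasurableSet K) {C : NNReal} (hT : LipschitzOnWith C T K)
    (hG : ∀ᵐ x, DifferentiableAt ℝ G x) {b : En n → ℝ} (hb : Measurable b)
    (h : ∀ y ∈ Y, ∃ x ∈ K, T x = y ∧
      (DifferentiableAt ℝ G x → ∃ T', HasFDerivAt T T' x ∧ |T'.det| ≤ b x)) :
    volume Y ≤ ∫⁻ x in K, ENNReal.ofReal (b x) := by
  set s := K ∩ ({x | DifferentiableAt ℝ T x} ∩ {x | |(fderiv ℝ T x).det| ≤ b x}) with hs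
  have hdet : Measurable fun x => |(fderiv ℝ T x).det| :=
    (continuous_abs.comp ContinuousLinearMap.continuous_det).measurable.comp (measurable_fderiv ℝ T)
  have hsm : MeasurableSet s :=
    hK.inter ((measurableSet_of_differentiableAt ℝ T).inter (measurableSet_le hdet hb))
  have h0 : volume (T '' (K ∩ {x | ¬ DifferentiableAt ℝ G x})) = 0 :=
    volume_image_eq_zero_of_lipschitzOnWith (hT.mono inter_subset_left)
      (measure_mono_null inter_subset_right hG)
  have hsub : Y ⊆ T '' s ∪ T '' (K ∩ {x | ¬ DifferentiableAt ℝ G x}) := by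
    intro y hy
    obtain ⟨x, hx, rfl, hd⟩ := h y hy
    by_cases hGx : DifferentiableAt ℝ G x
    · obtain ⟨T', hT', hle⟩ := hd hGx
      refine Or.inl ⟨x, ⟨hx, hT'.differentiableAt, ?_⟩, rfl⟩
      simpa [hT'.fderiv] using hle
    · exact Or.inr ⟨x, ⟨hx, hGx⟩, rfl⟩
  calc volume Y ≤ volume (T '' s) + volume (T '' (K ∩ {x | ¬ DifferentiableAt ℝ G x})) :=
        (measure_mono hsub).trans (measure_union_le _ _)
    _ = volume (T '' s) := by rw [h0, add_zero]
    _ ≤ ∫⁻ x in s, ENNReal.ofReal |(fderiv ℝ T x).det| :=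
        addHaar_image_le_lintegral_abs_det_fderiv _ hsm
          fun x hx => hx.2.1.hasFDerivAt.hasFDerivWithinAt
    _ ≤ ∫⁻ x in s, ENNReal.ofReal (b x) :=
        setLIntegral_mono hb.ennreal_ofReal fun x hx => ENNReal.ofReal_le_ofReal hx.2.2
    _ ≤ ∫⁻ x in K, ENNReal.ofReal (b x) := lintegral_mono_set inter_subset_left

/-- Existence of a contact point for the regularization `e` of `w` and the sliding cost `H`. -/
lemma exists_contact {n : ℕ} {w e H : En n → ℝ} {g : En n → En n} {ε δ R B : ℝ} {y x₁ : En n}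
    (hε : 0 < ε) (hδ : 0 < δ)
    (hw : ContinuousOn w (closedBall 0 R)) (hw0 : ∀ x ∈ closedBall (0 : En n) R, 0 ≤ w x)
    (hHc : Continuous H)
    (hH : ∀ x v, H (x + v) ≤ H x + inner ℝ (g x) v + ‖v‖ ^ 2 / δ)
    (hH0 : ∀ x, 0 ≤ H x) (hHfar : ∀ x, R - 2 ≤ ‖x‖ → B < H (x - y))
    (he1 : ∀ x, ∀ x' ∈ closedBall (0 : En n) R, e x ≤ w x' + ‖x - x'‖ ^ 2 / (2 * ε))
    (he2 : ∀ y c, (∀ x, ∀ x' ∈ closedBall (0 : En n) R,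
      c - ‖x - y‖ ^ 2 / δ ≤ w x' + ‖x - x'‖ ^ 2 / (2 * ε)) → ∀ x, c - ‖x - y‖ ^ 2 / δ ≤ e x)
    (hx₁ : x₁ ∈ closedBall (0 : En n) R) (hxB : w x₁ + H (x₁ - y) ≤ B) :
    ∃ x x', x' ∈ closedBall (0 : En n) R ∧ ‖x - x'‖ ^ 2 ≤ 2 * ε * B ∧ ‖x‖ < R - 2 ∧ w x' ≤ B ∧
      e x = w x' + ‖x - x'‖ ^ 2 / (2 * ε) ∧ ∀ x₀, e x + H (x - y) ≤ e x₀ + H (x₀ - y) := by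
  have hK : IsCompact (closedBall (0 : En n) R ×ˢ closedBall (0 : En n) R) :=
    (isCompact_closedBall _ _).prod (isCompact_closedBall _ _)
  have hcont : ContinuousOn (fun q : En n × En n => w q.2 + ‖q.1 - q.2‖ ^ 2 / (2 * ε) + H (q.1 - y))
      (closedBall (0 : En n) R ×ˢ closedBall (0 : En n) R) := by
    have h1 : ContinuousOn (fun q : En n × En n => w q.2)
        (closedBall (0 : En n) R ×ˢ closedBall (0 : En n) R) :=
      hw.comp continuousOn_snd fun q hq => hq.2
    have h2 : Continuous fun q : En n × En n => H (q.1 - y) := hHc.comp (by fun_prop)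
    exact (h1.add (by fun_prop)).add h2.continuousOn
  obtain ⟨⟨x, x'⟩, ⟨hxK, hx'K⟩, hmin⟩ := hK.exists_isMinOn ⟨(x₁, x₁), hx₁, hx₁⟩ hcont
  simp only at hxK hx'K
  set c := w x' + ‖x - x'‖ ^ 2 / (2 * ε) + H (x - y) with hc
  have hcB : c ≤ B := by
    have h1 := hmin (show (x₁, x₁) ∈ _ from ⟨hx₁, hx₁⟩)
    simp only [mem_ofPred_eq, sub_self, norm_zero] at h1
    rw [← hc] at h1
    norm_num at h1
    linarith
  have hle : ∀ x₂, ∀ x₂' ∈ closedBall (0 : En n) R,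
      c ≤ w x₂' + ‖x₂ - x₂'‖ ^ 2 / (2 * ε) + H (x₂ - y) := by
    intro x₂ x₂' hx₂'
    by_cases hx₂ : x₂ ∈ closedBall (0 : En n) R
    · exact hmin (show (x₂, x₂') ∈ _ from ⟨hx₂, hx₂'⟩)
    · have h1 : R < ‖x₂‖ := by simpa using hx₂
      have h2 := hHfar x₂ (by linarith)
      have h3 := hw0 x₂' hx₂'
      have h4 : 0 ≤ ‖x₂ - x₂'‖ ^ 2 / (2 * ε) := by positivity
      linarith
  have hw' := hw0 x' hx'K
  have hHx := hH0 (x - y)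
  have hsq : 0 ≤ ‖x - x'‖ ^ 2 / (2 * ε) := by positivity
  have hlow : ∀ x₀, c - H (x₀ - y) ≤ e x₀ := by
    intro x₀
    set a := g (x₀ - y)
    have key : ∀ x₂, ‖x₂ - (x₀ - (δ / 2) • a)‖ ^ 2 / δ
        = ‖x₂ - x₀‖ ^ 2 / δ + inner ℝ a (x₂ - x₀) + δ / 4 * ‖a‖ ^ 2 := by
      intro x₂
      rw [show x₂ - (x₀ - (δ / 2) • a) = (x₂ - x₀) + (δ / 2) • a by abel, norm_add_sq_real,
        norm_smul, inner_smul_right, real_inner_comm, Real.norm_of_nonneg (by positivity)]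
      field_simp
      ring
    have h1 := he2 (x₀ - (δ / 2) • a) (c - H (x₀ - y) + δ / 4 * ‖a‖ ^ 2) (fun x₂ x₂' hx₂' => by
      have h2 := hle x₂ x₂' hx₂'
      have h3 := hH (x₀ - y) (x₂ - x₀)
      rw [show x₀ - y + (x₂ - x₀) = x₂ - y by abel] at h3
      rw [key]
      linarith) x₀
    rw [key, sub_self] at h1
    simp at h1
    linarith
  have hex : e x = w x' + ‖x - x'‖ ^ 2 / (2 * ε) := by
    have h1 := hlow x
    have h2 := he1 x x' hx'K
    linarith
  refine ⟨x, x', hx'K, ?_, ?_, by linarith, hex, fun x₀ => ?_⟩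
  · have h1 : ‖x - x'‖ ^ 2 / (2 * ε) ≤ B := by linarith
    rw [div_le_iff₀ (by positivity)] at h1
    linarith
  · by_contra! h
    linarith [hHfar x h]
  · have := hlow x₀
    linarith

lemma JetBelow.of_contact {n : ℕ} {w e : En n → ℝ} {G : En n → En n} {ε : ℝ} {K : Set (En n)}
    {x x' : En n} {A : En n →L[ℝ] En n}
    (hed : ∀ x, HasFDerivAt e (innerSL ℝ (G x)) x) (hA : HasFDerivAt G A x)
    (he1 : ∀ x, ∀ x' ∈ K, e x ≤ w x' + ‖x - x'‖ ^ 2 / (2 * ε)) (hK : K ∈ 𝓝 x')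
    (hex : e x = w x' + ‖x - x'‖ ^ 2 / (2 * ε)) : JetBelow w x' (G x) A := by
  intro η hη
  have h1 := eventually_taylor hed hA (inner_symm_of_hasFDerivAt hed hA) hη
  have h2 : Tendsto (fun y' : En n => x + (y' - x')) (𝓝 x') (𝓝 x) := by
    have : Continuous fun y' : En n => x + (y' - x') := by fun_prop
    simpa using this.tendsto x'
  filter_upwards [h2.eventually h1, hK] with y' hy' hy'K
  have h3 := he1 (x + (y' - x')) y' hy'K
  rw [show x + (y' - x') - y' = x - x' by abel] at h3
  rw [show x + (y' - x') - x = y' - x' by abel] at hy'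
  have h4 := (abs_le.1 hy').1
  linarith

lemma contact_inner_le {n : ℕ} {e : En n → ℝ} {G : En n → En n} {ε : ℝ} {x : En n}
    {A : En n →L[ℝ] En n} (hed : ∀ x, HasFDerivAt e (innerSL ℝ (G x)) x) (hA : HasFDerivAt G A x)
    (hup : ∀ x v, e (x + v) ≤ e x + inner ℝ (G x) v + ‖v‖ ^ 2 / (2 * ε)) (v : En n) :
    inner ℝ (A v) v ≤ ‖v‖ ^ 2 / ε := by
  have hF : ∀ q, HasFDerivAt (fun q => ‖q - x‖ ^ 2 / (2 * ε) + inner ℝ (G x) (q - x) - e q)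
      (innerSL ℝ (ε⁻¹ • (q - x) + G x - G q)) q := by
    intro q
    have h0 : HasFDerivAt (fun q => q - x) (ContinuousLinearMap.id ℝ (En n)) q :=
      (hasFDerivAt_id q).sub_const x
    have h1 := (h0.norm_sq.mul_const (2 * ε)⁻¹).add ((innerSL ℝ (G x)).hasFDerivAt.comp q h0)
    refine (h1.sub (hed q)).congr_fderiv ?_
    ext v
    simp
    ring
  have hG : HasFDerivAt (fun q => ε⁻¹ • (q - x) + G x - G q)
      (ε⁻¹ • ContinuousLinearMap.id ℝ (En n) - A) x :=
    ((((hasFDerivAt_id x).sub_const x).const_smul ε⁻¹).add_const (G x)).sub hA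
  have h := inner_nonneg_of_forall_le hF hG (fun q => by
    have := hup x (q - x)
    rw [add_sub_cancel] at this
    simp
    linarith) v
  simp [inner_sub_left, inner_smul_left] at h
  rw [div_eq_inv_mul]
  linarith

lemma contact_le_inner {n : ℕ} {e H : En n → ℝ} {g G : En n → En n} {x y : En n}
    {d : Fin n → ℝ}
    {A : En n →L[ℝ] En n} (hed : ∀ x, HasFDerivAt e (innerSL ℝ (G x)) x) (hA : HasFDerivAt G A x)
    (hHd : ∀ x, HasFDerivAt H (innerSL ℝ (g x)) x) (hgd : HasFDerivAt g (diagL d) (x - y))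
    (hmin : ∀ x₀, e x + H (x - y) ≤ e x₀ + H (x₀ - y)) (v : En n) :
    -∑ i, d i * v i ^ 2 ≤ inner ℝ (A v) v := by
  have hs : ∀ q, HasFDerivAt (fun q => q - y) (ContinuousLinearMap.id ℝ (En n)) q :=
    fun q => (hasFDerivAt_id q).sub_const y
  have hF : ∀ q, HasFDerivAt (fun q => e q + H (q - y)) (innerSL ℝ (G q + g (q - y))) q := by
    intro q
    refine ((hed q).add ((hHd (q - y)).comp q (hs q))).congr_fderiv ?_
    ext v
    simp
  have hG : HasFDerivAt (fun q => G q + g (q - y)) (A + diagL d) x :=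
    (hA.add (hgd.comp x (hs x))).congr_fderiv (by ext; simp)
  have h := inner_nonneg_of_forall_le hF hG hmin v
  have h2 : inner ℝ (diagL d v) v = ∑ i, d i * v i ^ 2 := by
    rw [En.inner_eq_sum]
    exact Finset.sum_congr rfl fun i _ => by rw [diagL_apply]; ring
  rw [add_apply, inner_add_left, h2] at h
  linarith

lemma contact_gradient {n : ℕ} {e H : En n → ℝ} {g G : En n → En n} {x y : En n}
    (hed : ∀ x, HasFDerivAt e (innerSL ℝ (G x)) x)
    (hHd : ∀ x, HasFDerivAt H (innerSL ℝ (g x)) x)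
    (hmin : ∀ x₀, e x + H (x - y) ≤ e x₀ + H (x₀ - y)) : G x = -g (x - y) := by
  have hs : HasFDerivAt (fun q => q - y) (ContinuousLinearMap.id ℝ (En n)) x :=
    (hasFDerivAt_id x).sub_const y
  have hF : HasFDerivAt (fun q => e q + H (q - y)) (innerSL ℝ (G x + g (x - y))) x := by
    refine ((hed x).add ((hHd (x - y)).comp x hs)).congr_fderiv ?_
    ext v
    simp
  exact eq_neg_of_add_eq_zero_left (gradient_eq_zero_of_forall_le hF hmin)

lemma contact_det_le {n : ℕ} {lam Lam p Γ δ ε τ : ℝ} (hlam : 0 < lam) (hlL : lam ≤ Lam)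
    (hp : 0 ≤ p) (hδ : 0 < δ) {w e H f : En n → ℝ} {g G : En n → En n} {Ω K : Set (En n)}
    (hHd : ∀ x, HasFDerivAt H (innerSL ℝ (g x)) x)
    (hgd : ∀ x, HasFDerivAt g (diagL fun i => ((p + 1) * |g x i| ^ p + δ)⁻¹) x)
    (hed : ∀ x, HasFDerivAt e (innerSL ℝ (G x)) x)
    (hup : ∀ x v, e (x + v) ≤ e x + inner ℝ (G x) v + ‖v‖ ^ 2 / (2 * ε))
    (he1 : ∀ x, ∀ x' ∈ K, e x ≤ w x' + ‖x - x'‖ ^ 2 / (2 * ε))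
    (hP : PucciSuper lam Lam p Γ Ω w f) {x x' y : En n} (hx'Ω : x' ∈ Ω) (hx' : K ∈ 𝓝 x')
    (hex : e x = w x' + ‖x - x'‖ ^ 2 / (2 * ε))
    (hmin : ∀ x₀, e x + H (x - y) ≤ e x₀ + H (x₀ - y)) (hGx : DifferentiableAt ℝ G x)
    (hτ : (p + 1) / lam * (Lam * n + Lam * ‖G x‖ ^ (p + 1)
      - lam * Γ * ∑ i, |G x i| ^ (p + 2) + f x') + δ * (n / ε) ≤ τ) :
    ∃ T', HasFDerivAt (fun x => x + coordMap (fun t => |t| ^ p * t + δ * t) (G x)) T' x ∧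
      |T'.det| ≤ τ ^ n := by
  have hA := hGx.hasFDerivAt
  set A := fderiv ℝ G x
  have hsymm := inner_symm_of_hasFDerivAt hed hA
  have hd : ∀ t : ℝ, HasDerivAt (fun t => |t| ^ p * t + δ * t) ((p + 1) * |t| ^ p + δ) t :=
    fun t => (hasDerivAt_abs_rpow_mul_self hp t).add (by
      simpa using (hasDerivAt_id t).const_mul δ)
  have hgrad := contact_gradient hed hHd hmin
  refine ⟨_, (hasFDerivAt_id x).add ((hasFDerivAt_coordMap hd (G x)).comp x hA), ?_⟩
  refine abs_det_contact_le hlam hlL hp hδ hsymm (fun v => ?_) (contact_inner_le hed hA hup)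
    (hP x' hx'Ω (G x) A hsymm (JetBelow.of_contact hed hA he1 hx' hex)) hτ
  refine le_trans (le_of_eq ?_) (contact_le_inner hed hA hHd (hgd (x - y)) hmin v)
  rw [hgrad]
  simp only [PiLp.neg_apply, abs_neg]
  congr 1
  exact Finset.sum_congr rfl fun i _ => by rw [div_eq_inv_mul]

lemma exists_lipschitzOnWith_add_coordMap {n : ℕ} {p δ : ℝ} (hp : 0 ≤ p) (hδ : 0 < δ) {R : ℝ}
    (hR : 0 ≤ R) {G : En n → En n} {L : NNReal} (hG : LipschitzWith L G) :
    ∃ C : NNReal, LipschitzOnWith C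
      (fun x => x + coordMap (fun t => |t| ^ p * t + δ * t) (G x)) (closedBall 0 R) := by
  obtain ⟨C, hC⟩ := exists_lipschitzOnWith_coordMap (n := n) hp hδ
    (B := ‖G 0‖ + L * R) (by positivity)
  have hmaps : MapsTo G (closedBall 0 R) (closedBall 0 (‖G 0‖ + L * R)) := by
    intro x hx
    have h1 := hG.dist_le_mul x 0
    rw [mem_closedBall] at hx
    rw [dist_eq_norm] at h1
    have h2 : ‖G x‖ ≤ ‖G 0‖ + ‖G x - G 0‖ := norm_le_norm_add_norm_sub' _ _
    rw [mem_closedBall_zero_iff]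
    nlinarith [L.coe_nonneg]
  exact ⟨_, LipschitzWith.id.lipschitzOnWith.add (hC.comp hG.lipschitzOnWith hmaps)⟩

lemma volume_le_lintegral_contact {n : ℕ} (hn : 1 ≤ n) {lam Lam p Γ : ℝ} (hlam : 0 < lam)
    (hlL : lam ≤ Lam) (hp : 0 ≤ p)
    (hΓ : Lam / lam * (n / (1 / (4 * n)) ^ (p + 2) + n ^ (p + 1) / (1 / (4 * n))) ≤ Γ)
    {R : ℝ} (hR : R = 102 * n + 4) {w F F' : En n → ℝ} {Ω : Set (En n)}
    (hΩ : closedBall 0 R ⊆ Ω) (hw : ContinuousOn w (closedBall 0 R))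
    (hw0 : ∀ x ∈ closedBall (0 : En n) R, 0 ≤ w x) (hP : PucciSuper lam Lam p Γ Ω w F)
    {δ ε θ ρ : ℝ} (hδ : 0 < δ) (hδ1 : δ ≤ 1) (hε : 0 < ε) (hρ0 : 0 ≤ ρ)
    (hρ : 2 * ε * (100 * n + 1) ≤ ρ ^ 2) (hρ1 : ρ ≤ 1 / 8)
    (hF'm : Measurable F')
    (hF : ∀ x ∈ closedBall (0 : En n) R, ∀ x' ∈ closedBall (0 : En n) R,
      ‖x - x'‖ ≤ ρ → F x' ≤ F' x + θ)
    {x₁ : En n} (hx₁ : ‖x₁‖ ≤ 9) (hwx₁ : w x₁ ≤ 1) :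
    volume (closedBall (0 : En n) (1 / 4)) ≤ ∫⁻ x in closedBall (0 : En n) R, ENNReal.ofReal
      (((p + 1) / lam * (indicator (cthickening ρ (closedBall 0 (7 / 8) ∩ {x | w x ≤ 100 * n + 1}))
        (fun _ => Lam * n + Lam * n ^ (p + 1)) x + F' x + θ) + δ * (n / ε)) ^ n) := by
  have hn0 : (1 : ℝ) ≤ n := by exact_mod_cast hn
  have hLam : 0 < Lam := hlam.trans_le hlL
  have hΓ0 : 0 ≤ Γ := le_trans (by positivity) hΓ
  set S := closedBall (0 : En n) (7 / 8) ∩ {x | w x ≤ 100 * n + 1} with hS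
  set c₀ := Lam * n + Lam * (n : ℝ) ^ (p + 1) with hc₀
  have hc₀0 : 0 ≤ c₀ := by positivity
  obtain ⟨H, g, hHd, hgd, hgi, hHup, hH0, hHcoer, hH10, hgfar, hgnear⟩ :=
    exists_cost_vec hn hp hδ hδ1
  obtain ⟨e, G, hlow, hup, he1, he2⟩ := exists_regularization (isCompact_closedBall (0 : En n) R)
    ⟨0, by simp; linarith⟩ hw hε (half_pos hδ)
  rw [show 2 * (δ / 2) = δ by ring] at hlow he2
  have habs : ∀ x v, |e (x + v) - e x - inner ℝ (G x) v| ≤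
      ((1 / (2 * ε) + 1 / δ).toNNReal : ℝ) * ‖v‖ ^ 2 := by
    intro x v
    rw [Real.coe_toNNReal _ (by positivity), abs_le, add_mul, one_div_mul_eq_div,
      one_div_mul_eq_div]
    have h1 := hlow x v
    have h2 := hup x v
    have h3 : 0 ≤ ‖v‖ ^ 2 / (2 * ε) := by positivity
    have h4 : 0 ≤ ‖v‖ ^ 2 / δ := by positivity
    constructor <;> linarith
  have hed : ∀ x, HasFDerivAt e (innerSL ℝ (G x)) x := fun x =>
    hasFDerivAt_of_abs_sub_le (habs x)
  have hGL := lipschitzWith_of_abs_sub_le habs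
  obtain ⟨C, hC⟩ := exists_lipschitzOnWith_add_coordMap hp hδ (R := R) (by linarith) hGL
  refine volume_le_lintegral_of_forall_exists isClosed_closedBall.measurableSet hC
    hGL.ae_differentiableAt ?_ fun y hy => ?_
  · have h1 : Measurable (indicator (cthickening ρ S) fun _ : En n => c₀) :=
      measurable_const.indicator isClosed_cthickening.measurableSet
    fun_prop
  rw [mem_closedBall_zero_iff] at hy
  have hHc : Continuous H := continuous_iff_continuousAt.2 fun x => (hHd x).continuousAt
  obtain ⟨x, x', hx'K, hxx', hxR, hwx', hex, hmin⟩ := exists_contact (B := 100 * n + 1) (y := y)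
    (x₁ := x₁) hε hδ hw hw0 hHc hHup hH0 (fun x hx => by
      have h1 := hHcoer (x - y)
      have h2 := norm_sub_norm_le x y
      linarith) he1 he2 (by rw [mem_closedBall_zero_iff]; linarith) (by
      have h1 := norm_sub_le x₁ y
      have h2 := hH10 (x₁ - y) (by linarith)
      linarith)
  have hxx : ‖x - x'‖ ≤ ρ := by
    refine le_of_sq_le_sq ?_ hρ0
    exact hxx'.trans hρ
  have hgrad := contact_gradient hed hHd hmin
  have hx'n : ‖x'‖ ≤ ‖x‖ + ρ := by
    have := norm_le_norm_add_norm_sub x x'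
    linarith
  have hxK : x ∈ closedBall (0 : En n) R := by rw [mem_closedBall_zero_iff]; linarith
  refine ⟨x, hxK, ?_, fun hGx => ?_⟩
  · have h1 := hgi (x - y)
    have h2 : coordMap (fun t => |t| ^ p * t + δ * t) (G x) = -(x - y) := by
      rw [hgrad]
      refine Eq.trans ?_ (congrArg Neg.neg h1)
      ext i
      simp
      ring
    simp only [h2]
    abel
  · refine contact_det_le hlam hlL hp hδ hHd hgd hed hup he1 hP (hΩ hx'K) ?_ hex hmin hGx ?_
    · refine closedBall_mem_nhds_of_mem ?_
      rw [mem_ball_zero_iff]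
      linarith
    refine add_le_add_left (mul_le_mul_of_nonneg_left ?_ (by positivity)) _
    have hFx := hF x hxK x' hx'K hxx
    have hsum : 0 ≤ ∑ i, |G x i| ^ (p + 2) := by positivity
    rcases le_or_gt (1 / 2) ‖x - y‖ with hfar | hnear
    · have h1 := gradient_terms_le (n := n) hlam hlL hp (c := 1 / (4 * n)) (by positivity) hΓ
        (z := G x) (by
          obtain ⟨i, hi⟩ := hgfar _ hfar
          exact ⟨i, by simpa [hgrad] using hi⟩)
      have h2 : 0 ≤ indicator (cthickening ρ S) (fun _ : En n => c₀) x :=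
        indicator_nonneg (fun _ _ => hc₀0) x
      linarith
    · have h1 : ‖G x‖ ≤ n := by
        rw [hgrad, norm_neg]
        exact hgnear _ (by linarith)
      have hxn : ‖x‖ ≤ ‖y‖ + ‖x - y‖ := norm_le_norm_add_norm_sub' _ _
      have hx'S : x' ∈ S := ⟨by rw [mem_closedBall_zero_iff]; linarith, hwx'⟩
      have hmem : x ∈ cthickening ρ S :=
        mem_cthickening_of_dist_le x x' ρ S hx'S (by rw [dist_eq_norm]; exact hxx)
      rw [indicator_of_mem hmem]
      have h2 : Lam * ‖G x‖ ^ (p + 1) ≤ Lam * (n : ℝ) ^ (p + 1) :=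
        mul_le_mul_of_nonneg_left (Real.rpow_le_rpow (norm_nonneg _) h1 (by linarith)) hLam.le
      have h3 : 0 ≤ lam * Γ * ∑ i, |G x i| ^ (p + 2) := by positivity
      linarith

lemma add_add_pow_le {a b c : ℝ} (ha : 0 ≤ a) (hb : 0 ≤ b) (hc : 0 ≤ c) (n : ℕ) :
    (a + b + c) ^ n ≤ 3 ^ n * a ^ n + 3 ^ n * b ^ n + 3 ^ n * c ^ n := by
  simp only [← mul_pow]
  have key : ∀ d, a ≤ d → b ≤ d → c ≤ d → (a + b + c) ^ n ≤ (3 * d) ^ n := fun d h1 h2 h3 =>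
    pow_le_pow_left₀ (by positivity) (by linarith) n
  have ha' : 0 ≤ (3 * a) ^ n := by positivity
  have hb' : 0 ≤ (3 * b) ^ n := by positivity
  have hc' : 0 ≤ (3 * c) ^ n := by positivity
  rcases le_total a b with h1 | h1 <;> rcases le_total b c with h2 | h2 <;>
    rcases le_total a c with h3 | h3
  · linarith [key c h3 h2 le_rfl]
  · linarith [key c (h1.trans h2) h2 le_rfl]
  · linarith [key b h1 le_rfl h2]
  · linarith [key b h1 le_rfl h2]
  · linarith [key c h3 h2 le_rfl]
  · linarith [key a le_rfl h1 h3]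
  · linarith [key a le_rfl h1 (h2.trans h1)]
  · linarith [key a le_rfl h1 h3]

lemma volume_le_add_of_pucciSuper {n : ℕ} (hn : 1 ≤ n) {lam Lam p Γ : ℝ} (hlam : 0 < lam)
    (hlL : lam ≤ Lam) (hp : 0 ≤ p)
    (hΓ : Lam / lam * (n / (1 / (4 * n)) ^ (p + 2) + n ^ (p + 1) / (1 / (4 * n))) ≤ Γ)
    {R : ℝ} (hR : R = 102 * n + 4) {w F : En n → ℝ} {Ω : Set (En n)}
    (hΩ : closedBall 0 R ⊆ Ω) (hw : ContinuousOn w (closedBall 0 R))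
    (hw0 : ∀ x ∈ closedBall (0 : En n) R, 0 ≤ w x) (hP : PucciSuper lam Lam p Γ Ω w F)
    (hFc : ContinuousOn F (closedBall 0 R)) (hF0 : ∀ x ∈ closedBall (0 : En n) R, 0 ≤ F x)
    {σ : ℝ} (hσ : 0 < σ) {x₁ : En n} (hx₁ : ‖x₁‖ ≤ 9) (hwx₁ : w x₁ ≤ 1) :
    volume (closedBall (0 : En n) (1 / 4)) ≤
      ENNReal.ofReal (3 ^ n * ((p + 1) / lam * (Lam * n + Lam * n ^ (p + 1))) ^ n) *
        volume (closedBall (0 : En n) (7 / 8) ∩ {x | w x ≤ 100 * n + 1}) +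
      (ENNReal.ofReal (3 ^ n * ((p + 1) / lam) ^ n) *
        (∫⁻ x in closedBall (0 : En n) R, ENNReal.ofReal (F x ^ n)) +
      ENNReal.ofReal (3 ^ n * (((p + 1) / lam + 1) * σ) ^ n) *
        volume (closedBall (0 : En n) R)) := by
  have hn0 : (1 : ℝ) ≤ n := by exact_mod_cast hn
  have hLam : 0 < Lam := hlam.trans_le hlL
  set S := closedBall (0 : En n) (7 / 8) ∩ {x | w x ≤ 100 * n + 1} with hS
  set c₀ := Lam * n + Lam * (n : ℝ) ^ (p + 1) with hc₀
  have hc₀0 : 0 ≤ c₀ := by positivity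
  set K := closedBall (0 : En n) R with hK
  have hKc : IsCompact K := isCompact_closedBall _ _
  have hKm : MeasurableSet K := isClosed_closedBall.measurableSet
  set C₁ := (p + 1) / lam with hC₁
  have hC₁0 : 0 < C₁ := by positivity
  have hF'm : Measurable (K.indicator F) := by
    classical
    rw [← piecewise_eq_indicator]
    exact hFc.measurable_piecewise continuousOn_const hKm
  have hF'0 : ∀ x, 0 ≤ K.indicator F x := indicator_nonneg hF0
  have hSK : closedBall (0 : En n) (7 / 8) ⊆ K := closedBall_subset_closedBall (by linarith)
  have hSc : IsCompact S := by
    have h1 : ContinuousOn w (closedBall 0 (7 / 8)) := hw.mono hSK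
    have h2 : IsClosed S := h1.preimage_isClosed_of_isClosed isClosed_closedBall isClosed_Iic
    exact (isCompact_closedBall _ _).of_isClosed_subset h2 inter_subset_left
  have hlim : Tendsto (fun ρ => ENNReal.ofReal (3 ^ n * (C₁ * c₀) ^ n) *
      volume (cthickening ρ S) + (ENNReal.ofReal (3 ^ n * C₁ ^ n) *
        (∫⁻ x in K, ENNReal.ofReal (F x ^ n)) +
      ENNReal.ofReal (3 ^ n * ((C₁ + 1) * σ) ^ n) * volume K)) (𝓝[>] 0)
      (𝓝 (ENNReal.ofReal (3 ^ n * (C₁ * c₀) ^ n) *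
      volume S + (ENNReal.ofReal (3 ^ n * C₁ ^ n) *
        (∫⁻ x in K, ENNReal.ofReal (F x ^ n)) +
      ENNReal.ofReal (3 ^ n * ((C₁ + 1) * σ) ^ n) * volume K))) :=
    (ENNReal.Tendsto.const_mul ((tendsto_measure_cthickening_of_isCompact hSc).mono_left
      nhdsWithin_le_nhds) (Or.inr ENNReal.ofReal_ne_top)).add tendsto_const_nhds
  refine ge_of_tendsto hlim ?_
  obtain ⟨ρ₀, hρ₀, hρF⟩ := Metric.uniformContinuousOn_iff.1
    (hKc.uniformContinuousOn_of_continuous hFc) σ hσ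
  filter_upwards [Ioo_mem_nhdsGT hρ₀, Ioo_mem_nhdsGT (show (0 : ℝ) < 1 / 8 by norm_num)]
    with ρ hρ1 hρ2
  have hρ0 : 0 < ρ := hρ1.1
  set ε := ρ ^ 2 / (2 * (100 * n + 1)) with hε
  have hε0 : 0 < ε := by positivity
  have hδ0 : 0 < min 1 (σ * ε / n) := lt_min one_pos (by positivity)
  refine (volume_le_lintegral_contact (F' := K.indicator F) hn hlam hlL hp hΓ hR hΩ hw hw0 hP
    (δ := min 1 (σ * ε / n)) hδ0 (min_le_left _ _) hε0 (θ := σ) hρ0.le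
    (le_of_eq (by rw [hε]; field_simp)) hρ2.2.le hF'm (fun x hx x' hx' hxx => ?_) hx₁ hwx₁).trans ?_
  · rw [indicator_of_mem hx]
    have h1 := hρF x hx x' hx' (by rw [dist_eq_norm]; linarith [hρ1.2])
    rw [Real.dist_eq, abs_lt] at h1
    linarith
  have hδε : min 1 (σ * ε / n) * (n / ε) ≤ σ := by
    have h1 : σ = σ * ε / n * (n / ε) := by field_simp
    nth_rewrite 2 [h1]
    exact mul_le_mul_of_nonneg_right (min_le_right _ _) (by positivity)
  have hδε0 : 0 ≤ min 1 (σ * ε / n) * (n / ε) := mul_nonneg hδ0.le (by positivity)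
  calc _ ≤ ∫⁻ x in K, (ENNReal.ofReal (3 ^ n * (C₁ * c₀) ^ n) *
        (cthickening ρ S).indicator 1 x + (ENNReal.ofReal (3 ^ n * C₁ ^ n) *
        ENNReal.ofReal (K.indicator F x ^ n) +
        ENNReal.ofReal (3 ^ n * ((C₁ + 1) * σ) ^ n))) := by
        refine lintegral_mono fun x => ?_
        set i₀ := (cthickening ρ S).indicator (fun _ => c₀) x with hi₀
        have hi₀0 : 0 ≤ i₀ := indicator_nonneg (fun _ _ => hc₀0) x
        have h1 : (C₁ * (i₀ + K.indicator F x + σ) + min 1 (σ * ε / n) * (n / ε)) ^ n ≤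
            3 ^ n * (C₁ * i₀) ^ n + 3 ^ n * (C₁ * K.indicator F x) ^ n +
              3 ^ n * ((C₁ + 1) * σ) ^ n := by
          refine le_trans ?_ (add_add_pow_le (by positivity)
            (mul_nonneg hC₁0.le (hF'0 x)) (by positivity) n)
          refine pow_le_pow_left₀ (add_nonneg (mul_nonneg hC₁0.le (by linarith [hF'0 x])) hδε0) ?_ n
          linarith
        refine (ENNReal.ofReal_le_ofReal h1).trans ?_
        have h2 := hF'0 x
        rw [add_assoc, ENNReal.ofReal_add (by positivity) (by positivity),
          ENNReal.ofReal_add (by positivity) (by positivity)]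
        refine add_le_add ?_ (add_le_add_left ?_ _)
        · by_cases hx : x ∈ cthickening ρ S
          · simp [hi₀, hx]
          · simp [hi₀, hx, show n ≠ 0 by omega]
        · rw [← ENNReal.ofReal_mul (by positivity), mul_pow, mul_assoc]
    _ = ENNReal.ofReal (3 ^ n * (C₁ * c₀) ^ n) * volume (cthickening ρ S ∩ K) +
        (ENNReal.ofReal (3 ^ n * C₁ ^ n) * (∫⁻ x in K, ENNReal.ofReal (K.indicator F x ^ n)) +
        ENNReal.ofReal (3 ^ n * ((C₁ + 1) * σ) ^ n) * volume K) := by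
        have hcm : MeasurableSet (cthickening ρ S) := isClosed_cthickening.measurableSet
        have hm1 : Measurable ((cthickening ρ S).indicator (1 : En n → ENNReal)) :=
          measurable_one.indicator hcm
        have hm2 : Measurable fun x => ENNReal.ofReal (K.indicator F x ^ n) :=
          (hF'm.pow_const n).ennreal_ofReal
        rw [lintegral_add_left (hm1.const_mul _), lintegral_const_mul _ hm1,
          lintegral_add_left (hm2.const_mul _), lintegral_const_mul _ hm2,
          lintegral_indicator_one hcm, Measure.restrict_apply hcm]
        simp
    _ ≤ _ := by
        refine add_le_add (mul_le_mul_right (measure_mono inter_subset_left) _) (add_le_add_left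
          (mul_le_mul_right (le_of_eq ?_) _) _)
        exact setLIntegral_congr_fun hKm fun x hx => by simp only [indicator_of_mem hx]

/-- Measure estimate at unit scale for nonnegative supersolutions. -/
lemma exists_measure_estimate_unit {n : ℕ} (hn : 1 ≤ n) {lam Lam p : ℝ} (hlam : 0 < lam)
    (hlL : lam ≤ Lam) (hp : 0 ≤ p) :
    ∃ M μ ε₀ : ℝ, 1 < M ∧ 0 < μ ∧ 0 < ε₀ ∧ ∀ (u f : En n → ℝ) (Ω : Set (En n)), IsOpen Ω →
      closedBall 0 (102 * n + 4) ⊆ Ω → ContinuousOn u Ω → (∀ x ∈ Ω, 0 ≤ u x) →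
      ContinuousOn f Ω → PucciSuper lam Lam p 0 Ω u f →
      ∫⁻ x in closedBall (0 : En n) (102 * n + 4), ENNReal.ofReal (|f x| ^ n) ≤
        ENNReal.ofReal ε₀ →
      ∀ x₁ : En n, ‖x₁‖ ≤ 9 → u x₁ ≤ 1 →
      ENNReal.ofReal μ ≤ volume (closedBall (0 : En n) 1 ∩ {x | u x ≤ M}) := by
  have hn0 : (1 : ℝ) ≤ n := by exact_mod_cast hn
  have hLam : 0 < Lam := hlam.trans_le hlL
  set Γ := max 1 (Lam / lam * (n / (1 / (4 * n)) ^ (p + 2) + n ^ (p + 1) / (1 / (4 * n)))) with hΓ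
  have hΓ1 : 1 ≤ Γ := le_max_left _ _
  set R : ℝ := 102 * n + 4 with hR
  have hfin : ∀ r : ℝ, volume (closedBall (0 : En n) r) ≠ ⊤ := fun r =>
    measure_closedBall_lt_top.ne
  set V := (volume (closedBall (0 : En n) (1 / 4))).toReal with hV
  have hV0 : 0 < V := ENNReal.toReal_pos (measure_closedBall_pos _ _ (by norm_num)).ne' (hfin _)
  set VK := (volume (closedBall (0 : En n) R)).toReal with hVK
  have hVK0 : 0 < VK := ENNReal.toReal_pos (measure_closedBall_pos _ _ (by positivity)).ne' (hfin _)
  set k₁ : ℝ := 3 ^ n * ((p + 1) / lam * (Lam * n + Lam * n ^ (p + 1))) ^ n with hk₁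
  set k₂ : ℝ := 3 ^ n * ((p + 1) / lam) ^ n with hk₂
  have hk₁0 : 0 < k₁ := by positivity
  have hk₂0 : 0 < k₂ := by positivity
  obtain ⟨σ, hσ, hσV⟩ : ∃ σ : ℝ, 0 < σ ∧ 3 ^ n * (((p + 1) / lam + 1) * σ) ^ n * VK ≤ V / 3 := by
    have h1 : Tendsto (fun σ : ℝ => 3 ^ n * (((p + 1) / lam + 1) * σ) ^ n * VK) (𝓝[>] 0)
        (𝓝 0) := by
      have h2 : Continuous fun σ : ℝ => 3 ^ n * (((p + 1) / lam + 1) * σ) ^ n * VK := by fun_prop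
      have h3 := (h2.tendsto 0).mono_left (nhdsWithin_le_nhds (s := Ioi 0))
      simpa [show n ≠ 0 by omega] using h3
    have h4 := (h1.eventually (ge_mem_nhds (show 0 < V / 3 by positivity))).and
      self_mem_nhdsWithin
    obtain ⟨σ, h5, h6⟩ := h4.exists
    exact ⟨σ, h6, h5⟩
  refine ⟨Real.exp (Γ * (100 * n + 1)), V / 3 / k₁, V / 3 / k₂, Real.one_lt_exp_iff.2 (by positivity),
    by positivity, by positivity, fun u f Ω hΩo hΩ hu hu0 hf hP hfε x₁ hx₁ hux₁ => ?_⟩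
  have hu0' : ∀ x ∈ closedBall (0 : En n) R, 0 ≤ u x := fun x hx => hu0 x (hΩ hx)
  have hwc : ContinuousOn (fun x => Real.log (1 + u x) / Γ) (closedBall 0 R) :=
    ((continuousOn_const.add (hu.mono hΩ)).log fun x hx => by
      exact (add_pos_of_pos_of_nonneg one_pos (hu0' x hx)).ne').div_const _
  have hx₁R : x₁ ∈ closedBall (0 : En n) R := by rw [mem_closedBall_zero_iff]; linarith
  have key := volume_le_add_of_pucciSuper hn hlam hlL hp (le_max_right _ _) hR hΩ hwc
    (fun x hx => div_nonneg (Real.log_nonneg (by linarith [hu0' x hx])) (by linarith))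
    (hP.log hp hΩo hu0 hΓ1) (hf.mono hΩ).abs (fun x _ => abs_nonneg _) hσ hx₁ (by
      rw [div_le_one (by linarith)]
      have := Real.log_le_sub_one_of_pos (show 0 < 1 + u x₁ by linarith [hu0' x₁ hx₁R])
      linarith)
  set S := closedBall (0 : En n) (7 / 8) ∩ {x | Real.log (1 + u x) / Γ ≤ 100 * n + 1} with hS
  have hSS : S ⊆ closedBall (0 : En n) 1 ∩ {x | u x ≤ Real.exp (Γ * (100 * n + 1))} := by
    rintro x ⟨hx1, hx2⟩
    refine ⟨closedBall_subset_closedBall (by norm_num) hx1, ?_⟩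
    have hux := hu0' x (closedBall_subset_closedBall (by linarith) hx1)
    rw [mem_ofPred_eq, div_le_iff₀ (by linarith), Real.log_le_iff_le_exp (by linarith)] at hx2
    rw [mem_ofPred_eq, mul_comm]
    linarith
  refine le_trans ?_ (measure_mono hSS)
  have hSfin : volume S ≠ ⊤ := ((measure_mono inter_subset_left).trans_lt
    measure_closedBall_lt_top).ne
  have h1 : ENNReal.ofReal k₁ * volume S = ENNReal.ofReal (k₁ * (volume S).toReal) := by
    rw [ENNReal.ofReal_mul hk₁0.le, ENNReal.ofReal_toReal hSfin]
  have h2 : ENNReal.ofReal k₂ * (∫⁻ x in closedBall (0 : En n) R, ENNReal.ofReal (|f x| ^ n)) ≤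
      ENNReal.ofReal (V / 3) := by
    refine (mul_le_mul_right hfε _).trans (le_of_eq ?_)
    rw [← ENNReal.ofReal_mul hk₂0.le]
    congr 1
    field_simp
  have h3 : ENNReal.ofReal (3 ^ n * (((p + 1) / lam + 1) * σ) ^ n) *
      volume (closedBall (0 : En n) R) ≤ ENNReal.ofReal (V / 3) := by
    rw [← ENNReal.ofReal_toReal (hfin R), ← ENNReal.ofReal_mul (by positivity)]
    exact ENNReal.ofReal_le_ofReal hσV
  have h4 : ENNReal.ofReal V ≤ ENNReal.ofReal (k₁ * (volume S).toReal + (V / 3 + V / 3)) := by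
    rw [ENNReal.ofReal_add (by positivity) (by positivity), ← h1,
      ENNReal.ofReal_add (by positivity) (by positivity), hV, ENNReal.ofReal_toReal (hfin _)]
    exact key.trans (add_le_add le_rfl (add_le_add h2 h3))
  rw [ENNReal.ofReal_le_ofReal_iff (by positivity)] at h4
  rw [← ENNReal.ofReal_toReal hSfin]
  refine ENNReal.ofReal_le_ofReal ?_
  rw [div_le_iff₀ hk₁0]
  linarith

lemma setLIntegral_comp_add_smul {n : ℕ} (x₀ : En n) {r : ℝ} (hr : 0 < r) (h : En n → ENNReal)
    (s : Set (En n)) :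
    ∫⁻ x in (fun x => x₀ + r • x) ⁻¹' s, h (x₀ + r • x) =
      ENNReal.ofReal ((r ^ n)⁻¹) * ∫⁻ x in s, h x := by
  have hemb : MeasurableEmbedding fun x : En n => x₀ + r • x :=
    ((Homeomorph.smulOfNeZero r hr.ne').trans (Homeomorph.addLeft x₀)).measurableEmbedding
  have hmap : Measure.map (fun x : En n => x₀ + r • x) volume =
      ENNReal.ofReal ((r ^ n)⁻¹) • volume := by
    have h1 : Measure.map ((fun x : En n => x₀ + x) ∘ fun x => r • x) volume = _ :=
      (Measure.map_map (measurable_const_add x₀) (measurable_const_smul r)).symm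
    refine h1.trans ?_
    rw [Measure.map_addHaar_smul _ hr.ne', Measure.map_smul, map_add_left_eq_self,
      abs_of_pos (by positivity)]
    simp
  rw [← hemb.lintegral_map h, ← hemb.restrict_map, hmap, Measure.restrict_smul,
    lintegral_smul_measure, smul_eq_mul]

lemma volume_preimage_add_smul {n : ℕ} (x₀ : En n) {r : ℝ} (hr : 0 < r) (s : Set (En n)) :
    volume ((fun x => x₀ + r • x) ⁻¹' s) = ENNReal.ofReal ((r ^ n)⁻¹) * volume s := by
  simpa using setLIntegral_comp_add_smul x₀ hr (fun _ => 1) s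

lemma preimage_add_smul_closedBall {n : ℕ} (x₀ : En n) {r : ℝ} (hr : 0 < r) (R : ℝ) :
    (fun x => x₀ + r • x) ⁻¹' closedBall x₀ (R * r) = closedBall (0 : En n) R := by
  ext x
  rw [mem_preimage, mem_closedBall, dist_eq_norm, add_sub_cancel_left, norm_smul,
    Real.norm_of_nonneg hr.le, mul_comm, mul_le_mul_iff_left₀ hr, mem_closedBall_zero_iff]

/-- Measure estimate for nonnegative supersolutions on balls of radius at most one. -/
lemma exists_measure_estimate {n : ℕ} (hn : 1 ≤ n) {lam Lam p : ℝ} (hlam : 0 < lam)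
    (hlL : lam ≤ Lam) (hp : 0 ≤ p) :
    ∃ M μ ε₀ : ℝ, 1 < M ∧ 0 < μ ∧ 0 < ε₀ ∧ ∀ (u f : En n → ℝ) (Ω : Set (En n)), IsOpen Ω →
      ContinuousOn u Ω → (∀ x ∈ Ω, 0 ≤ u x) → ContinuousOn f Ω → PucciSuper lam Lam p 0 Ω u f →
      ∫⁻ x in Ω, ENNReal.ofReal (|f x| ^ n) ≤ ENNReal.ofReal ε₀ →
      ∀ (x₀ x₁ : En n) (r m : ℝ), 0 < r → r ≤ 1 → 1 ≤ m →
      closedBall x₀ ((102 * n + 4) * r) ⊆ Ω → x₁ ∈ closedBall x₀ (9 * r) → u x₁ ≤ m →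
      ENNReal.ofReal (μ * r ^ n) ≤ volume (closedBall x₀ r ∩ {x | u x ≤ M * m}) := by
  obtain ⟨M, μ, ε₀, hM, hμ, hε₀, h⟩ := exists_measure_estimate_unit hn hlam hlL hp
  refine ⟨M, μ, ε₀, hM, hμ, hε₀, fun u f Ω hΩo hu hu0 hf hP hfε x₀ x₁ r m hr hr1 hm hball hx₁ hux₁
    => ?_⟩
  have hm0 : 0 < m := by linarith
  have hcont : Continuous fun x : En n => x₀ + r • x := by fun_prop
  have hpre : (fun x : En n => x₀ + r • x) ⁻¹' closedBall x₀ ((102 * n + 4) * r) = _ :=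
    preimage_add_smul_closedBall x₀ hr (102 * n + 4)
  have hmaps : MapsTo (fun x : En n => x₀ + r • x) {x | x₀ + r • x ∈ Ω} Ω := fun x hx => hx
  have key := h _ _ _ (hΩo.preimage hcont) (by
      rw [← hpre]
      exact preimage_mono hball) ((hu.comp hcont.continuousOn hmaps).div_const m)
    (fun x hx => div_nonneg (hu0 _ hx) hm0.le)
    ((hf.comp hcont.continuousOn hmaps).const_mul (r ^ (p + 2) / m ^ (p + 1)))
    (hP.scale (hlam.le.trans hlL) hp hr hr1 hm0 x₀) ?_ (r⁻¹ • (x₁ - x₀)) ?_ ?_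
  · have h1 : closedBall (0 : En n) 1 ∩ {x | u (x₀ + r • x) / m ≤ M} =
        (fun x => x₀ + r • x) ⁻¹' (closedBall x₀ r ∩ {x | u x ≤ M * m}) := by
      rw [preimage_inter]
      have := preimage_add_smul_closedBall x₀ hr 1
      rw [one_mul] at this
      rw [this]
      congr 1
      ext x
      simp [div_le_iff₀ hm0]
    have h2 : ENNReal.ofReal μ ≤ volume (closedBall (0 : En n) 1 ∩ {x | u (x₀ + r • x) / m ≤ M}) :=
      key
    rw [h1, volume_preimage_add_smul x₀ hr] at h2
    have h3 := mul_le_mul_left h2 (ENNReal.ofReal (r ^ n))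
    rw [← ENNReal.ofReal_mul hμ.le] at h3
    refine h3.trans (le_of_eq ?_)
    rw [mul_comm, ← mul_assoc, ← ENNReal.ofReal_mul (by positivity),
      mul_inv_cancel₀ (by positivity), ENNReal.ofReal_one, one_mul]
  · set k := r ^ (p + 2) / m ^ (p + 1) with hk
    have hk0 : 0 ≤ k := by positivity
    have hkr : k ≤ r := by
      rw [hk, div_le_iff₀ (by positivity)]
      have h1 : r ^ (p + 2) ≤ r ^ (1 : ℝ) :=
        Real.rpow_le_rpow_of_exponent_ge hr hr1 (by linarith)
      have h2 : 1 ≤ m ^ (p + 1) := Real.one_le_rpow hm (by linarith)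
      rw [Real.rpow_one] at h1
      nlinarith
    have h1 : ∀ x : En n, ENNReal.ofReal (|k * f (x₀ + r • x)| ^ n) ≤
        ENNReal.ofReal (r ^ n) * ENNReal.ofReal (|f (x₀ + r • x)| ^ n) := by
      intro x
      rw [← ENNReal.ofReal_mul (by positivity), ← mul_pow]
      refine ENNReal.ofReal_le_ofReal (pow_le_pow_left₀ (abs_nonneg _) ?_ n)
      rw [abs_mul, abs_of_nonneg hk0]
      exact mul_le_mul_of_nonneg_right hkr (abs_nonneg _)
    refine (lintegral_mono h1).trans ?_
    rw [lintegral_const_mul' _ _ ENNReal.ofReal_ne_top, ← hpre,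
      setLIntegral_comp_add_smul x₀ hr fun x => ENNReal.ofReal (|f x| ^ n), ← mul_assoc,
      ← ENNReal.ofReal_mul (by positivity), mul_inv_cancel₀ (by positivity), ENNReal.ofReal_one,
      one_mul]
    exact (lintegral_mono_set hball).trans hfε
  · rw [norm_smul, norm_inv, Real.norm_of_nonneg hr.le, inv_mul_le_iff₀ hr, mul_comm,
      ← dist_eq_norm]
    exact hx₁
  · have h1 : x₀ + r • r⁻¹ • (x₁ - x₀) = x₁ := by rw [smul_inv_smul₀ hr.ne', add_sub_cancel]
    rw [Function.comp_apply, h1, div_le_one hm0]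
    exact hux₁

lemma volume_le_of_forall_exists_closedBall {n : ℕ} {F E : Set (En n)} (hE : MeasurableSet E)
    {c : ℝ} (hc : 0 < c)
    (h : ∀ x ∈ F, ∃ (y : En n) (r : ℝ), 0 < r ∧ r ≤ 1 ∧ x ∈ closedBall y r ∧ closedBall y r ⊆ F ∧
      ENNReal.ofReal (c * r ^ n) ≤ volume (closedBall y r ∩ E)) :
    volume F ≤
      ENNReal.ofReal (5 ^ n * (volume (ball (0 : En n) 1)).toReal / c) * volume (F ∩ E) := by
  choose! y r hr0 hr1 hxy hyF hμ using h
  obtain ⟨t, htF, htd, htc⟩ := Vitali.exists_disjoint_subfamily_covering_enlargement_closedBall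
    F y r 1 hr1 5 (by norm_num)
  have hcount : t.Countable := htd.countable_of_nonempty_interior fun x hx =>
    ⟨y x, ball_subset_interior_closedBall (mem_ball_self (hr0 x (htF hx)))⟩
  set ω := (volume (ball (0 : En n) 1)).toReal with hω
  have hωe : volume (ball (0 : En n) 1) = ENNReal.ofReal ω :=
    (ENNReal.ofReal_toReal measure_ball_lt_top.ne).symm
  have hω0 : 0 ≤ ω := ENNReal.toReal_nonneg
  calc volume F ≤ volume (⋃ x ∈ t, closedBall (y x) (5 * r x)) := measure_mono fun x hx => by
        obtain ⟨b, hb, hsub⟩ := htc x hx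
        exact mem_biUnion hb (hsub (hxy x hx))
    _ ≤ ∑' x : t, volume (closedBall (y x) (5 * r x)) := measure_biUnion_le _ hcount _
    _ ≤ ∑' x : t, ENNReal.ofReal (5 ^ n * ω / c) * volume (closedBall (y x) (r x) ∩ E) := by
        refine ENNReal.tsum_le_tsum fun x => ?_
        have hrx := hr0 x (htF x.2)
        rw [Measure.addHaar_closedBall _ _ (by positivity), hωe, finrank_euclideanSpace_fin,
          ← ENNReal.ofReal_mul (by positivity)]
        refine le_trans (le_of_eq ?_) (mul_le_mul_right (hμ x (htF x.2)) _)
        rw [← ENNReal.ofReal_mul (by positivity)]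
        congr 1
        rw [mul_pow]
        field_simp
    _ = ENNReal.ofReal (5 ^ n * ω / c) * ∑' x : t, volume (closedBall (y x) (r x) ∩ E) :=
        ENNReal.tsum_mul_left
    _ = ENNReal.ofReal (5 ^ n * ω / c) * volume (⋃ x ∈ t, closedBall (y x) (r x) ∩ E) := by
        rw [measure_biUnion hcount (htd.mono fun x => inter_subset_left)
          fun x _ => isClosed_closedBall.measurableSet.inter hE]
    _ ≤ _ := mul_le_mul_right (measure_mono (iUnion₂_subset fun x hx =>
        inter_subset_inter_left _ (hyF x (htF hx)))) _

/-- Geometric decay of the measure of superlevel sets. -/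
lemma exists_geometric_decay {n : ℕ} (hn : 1 ≤ n) {lam Lam p : ℝ} (hlam : 0 < lam)
    (hlL : lam ≤ Lam) (hp : 0 ≤ p) :
    ∃ M q ε₀ C : ℝ, 1 < M ∧ 0 < q ∧ q < 1 ∧ 0 < ε₀ ∧ 0 < C ∧
      ∀ (u f : En n → ℝ) (Ω : Set (En n)), IsOpen Ω →
      ContinuousOn u Ω → (∀ x ∈ Ω, 0 ≤ u x) → ContinuousOn f Ω → PucciSuper lam Lam p 0 Ω u f →
      ∫⁻ x in Ω, ENNReal.ofReal (|f x| ^ n) ≤ ENNReal.ofReal ε₀ →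
      closedBall 0 (102 * n + 4) ⊆ Ω → ∀ x₁ : En n, ‖x₁‖ ≤ 9 → u x₁ ≤ 1 → ∀ k : ℕ,
      volume (closedBall (0 : En n) 1 \ {x | u x ≤ M ^ (k + 1)}) ≤ ENNReal.ofReal (C * q ^ k) := by
  obtain ⟨M, μ, ε₀, hM, hμ, hε₀, h⟩ := exists_measure_estimate hn hlam hlL hp
  have hn0 : (1 : ℝ) ≤ n := by exact_mod_cast hn
  set ω := (volume (ball (0 : En n) 1)).toReal with hω
  have hω0 : 0 < ω := ENNReal.toReal_pos (measure_ball_pos _ _ one_pos).ne' measure_ball_lt_top.ne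
  set D := 5 ^ n * ω / μ with hD
  have hD0 : 0 < D := by positivity
  refine ⟨M, max (1 - 1 / D) (1 / 2), ε₀, (volume (closedBall (0 : En n) 1)).toReal, hM,
    lt_max_of_lt_right (by norm_num), max_lt (by linarith [one_div_pos.2 hD0]) (by norm_num), hε₀,
    ENNReal.toReal_pos (measure_closedBall_pos _ _ one_pos).ne' measure_closedBall_lt_top.ne,
    fun u f Ω hΩo hu hu0 hf hP hfε hΩ x₁ hx₁ hux₁ => ?_⟩
  set q := max (1 - 1 / D) (1 / 2) with hq
  have hq0 : 0 < q := lt_max_of_lt_right (by norm_num)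
  set K := closedBall (0 : En n) 1 with hK
  have hKΩ : K ⊆ Ω := (closedBall_subset_closedBall (by linarith)).trans hΩ
  have hmeas : ∀ t, IsClosed (K ∩ {x | u x ≤ t}) := fun t =>
    (hu.mono hKΩ).preimage_isClosed_of_isClosed isClosed_closedBall isClosed_Iic
  have hdiff : ∀ t, K \ {x | u x ≤ t} = K \ (K ∩ {x | u x ≤ t}) := fun t => by
    rw [sdiff_self_inter]
  have hfin : ∀ t, volume (K \ {x | u x ≤ t}) ≠ ⊤ := fun t =>
    ((measure_mono sdiff_subset).trans_lt measure_closedBall_lt_top).ne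
  have hne : ∀ k : ℕ, (K ∩ {x | u x ≤ M ^ (k + 1)}).Nonempty := by
    intro k
    have h1 := h u f Ω hΩo hu hu0 hf hP hfε 0 x₁ 1 1 one_pos le_rfl le_rfl (by simpa using hΩ)
      (by simpa using hx₁) hux₁
    have h2 : 0 < volume (K ∩ {x | u x ≤ M * 1}) :=
      lt_of_lt_of_le (ENNReal.ofReal_pos.2 (by positivity)) h1
    refine (nonempty_of_measure_ne_zero h2.ne').mono (inter_subset_inter_right _ fun x hx => ?_)
    have h3 : M ^ 1 ≤ M ^ (k + 1) := pow_le_pow_right₀ hM.le (by omega)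
    rw [mem_ofPred_eq] at hx ⊢
    linarith
  have hstep : ∀ k : ℕ, (volume (K \ {x | u x ≤ M ^ (k + 2)})).toReal ≤
      q * (volume (K \ {x | u x ≤ M ^ (k + 1)})).toReal := by
    intro k
    set A := K ∩ {x | u x ≤ M ^ (k + 1)} with hA
    set E := K ∩ {x | u x ≤ M ^ (k + 2)} with hE
    have hAE : A ⊆ E := inter_subset_inter_right _ fun x hx => by
      rw [mem_ofPred_eq] at hx ⊢
      exact hx.trans (pow_le_pow_right₀ hM.le (by omega))
    have hcover := volume_le_of_forall_exists_closedBall (F := K \ A) (E := E)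
      (hmeas _).measurableSet hμ fun x hx => by
        obtain ⟨x₂, hx₂, hd⟩ := (hmeas (M ^ (k + 1))).exists_infDist_eq_dist (hne k) x
        set d := dist x x₂ with hdd
        have hxn : ‖x‖ ≤ 1 := by simpa [hK] using hx.1
        have hx₂n : ‖x₂‖ ≤ 1 := by simpa [hK] using hx₂.1
        have hd0 : 0 < d := dist_pos.2 fun h0 => hx.2 (h0 ▸ hx₂)
        have hd2 : d ≤ 2 := by
          rw [hdd, dist_eq_norm]
          linarith [norm_sub_le x x₂]
        have hxt : dist x ((1 - d / 8) • x) ≤ d / 8 := by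
          rw [dist_eq_norm, sub_smul, one_smul, sub_sub_cancel, norm_smul,
            Real.norm_of_nonneg (by positivity)]
          nlinarith
        have hxtn : ‖(1 - d / 8) • x‖ ≤ 1 - d / 8 := by
          rw [norm_smul, Real.norm_of_nonneg (by linarith)]
          nlinarith
        have hsub : closedBall ((1 - d / 8) • x) (d / 8) ⊆ K \ A := by
          intro z hz
          have hz1 : ‖z - (1 - d / 8) • x‖ ≤ d / 8 := by rwa [← dist_eq_norm]
          refine ⟨?_, fun hzA => ?_⟩
          · rw [hK, mem_closedBall_zero_iff]
            have := norm_le_norm_add_norm_sub' z ((1 - d / 8) • x)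
            linarith
          · have h1 := infDist_le_dist_of_mem (x := x) hzA
            rw [hd] at h1
            have h2 := dist_triangle_right x z ((1 - d / 8) • x)
            rw [mem_closedBall] at hz
            linarith
        refine ⟨(1 - d / 8) • x, d / 8, by positivity, by linarith, hxt, hsub, ?_⟩
        have h1 := h u f Ω hΩo hu hu0 hf hP hfε ((1 - d / 8) • x) x₂ (d / 8) (M ^ (k + 1))
          (by positivity) (by linarith) (one_le_pow₀ hM.le) (by
            refine (closedBall_subset_closedBall' ?_).trans hΩ
            rw [dist_zero_right]
            nlinarith) (by
            have h2 := dist_triangle_left x₂ ((1 - d / 8) • x) x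
            rw [mem_closedBall]
            linarith) hx₂.2
        refine h1.trans (measure_mono fun z hz => ⟨hz.1, (hsub hz.1).1, ?_⟩)
        have h2 := hz.2
        rw [mem_ofPred_eq] at h2 ⊢
        rw [pow_succ' M (k + 1)]
        exact h2
    have hFfin : volume (K \ A) ≠ ⊤ := by rw [hA, ← hdiff]; exact hfin _
    have hsplit := measure_inter_add_sdiff (μ := volume) (K \ A) (hmeas (M ^ (k + 2))).measurableSet
    rw [← hE, sdiff_sdiff, union_eq_self_of_subset_left hAE] at hsplit
    rw [hdiff, hdiff, ← hA, ← hE]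
    have h1 : (volume (K \ A)).toReal =
        (volume ((K \ A) ∩ E)).toReal + (volume (K \ E)).toReal := by
      rw [← hsplit, ENNReal.toReal_add]
      · exact ((measure_mono inter_subset_left).trans_lt hFfin.lt_top).ne
      · rw [hE, ← hdiff]; exact hfin _
    have h2 : (volume (K \ A)).toReal ≤ D * (volume ((K \ A) ∩ E)).toReal := by
      have h3 := ENNReal.toReal_mono (ENNReal.mul_ne_top ENNReal.ofReal_ne_top
        ((measure_mono inter_subset_left).trans_lt hFfin.lt_top).ne) hcover
      rwa [ENNReal.toReal_mul, ENNReal.toReal_ofReal hD0.le] at h3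
    have h3 : (volume (K \ E)).toReal ≤ (1 - 1 / D) * (volume (K \ A)).toReal := by
      have h4 : 1 / D * (volume (K \ A)).toReal ≤ (volume ((K \ A) ∩ E)).toReal := by
        rw [one_div, inv_mul_le_iff₀ hD0]
        exact h2
      linarith
    exact h3.trans (mul_le_mul_of_nonneg_right (le_max_left _ _) ENNReal.toReal_nonneg)
  have hall : ∀ k : ℕ, (volume (K \ {x | u x ≤ M ^ (k + 1)})).toReal ≤
      (volume K).toReal * q ^ k := by
    intro k
    induction k with
    | zero =>
      simpa using ENNReal.toReal_mono measure_closedBall_lt_top.ne (measure_mono sdiff_subset)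
    | succ k ih =>
      refine (hstep k).trans ((mul_le_mul_of_nonneg_left ih hq0.le).trans (le_of_eq ?_))
      ring
  intro k
  rw [← ENNReal.ofReal_toReal (hfin _)]
  exact ENNReal.ofReal_le_ofReal (hall k)

/-- Power decay of the measure of superlevel sets. -/
lemma exists_power_decay {n : ℕ} (hn : 1 ≤ n) {lam Lam p : ℝ} (hlam : 0 < lam)
    (hlL : lam ≤ Lam) (hp : 0 ≤ p) :
    ∃ s t₀ ε₀ C : ℝ, 0 < s ∧ 1 < t₀ ∧ 0 < ε₀ ∧ 0 < C ∧
      ∀ (u f : En n → ℝ) (Ω : Set (En n)), IsOpen Ω →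
      ContinuousOn u Ω → (∀ x ∈ Ω, 0 ≤ u x) → ContinuousOn f Ω → PucciSuper lam Lam p 0 Ω u f →
      ∫⁻ x in Ω, ENNReal.ofReal (|f x| ^ n) ≤ ENNReal.ofReal ε₀ →
      closedBall 0 (102 * n + 4) ⊆ Ω → ∀ x₁ : En n, ‖x₁‖ ≤ 9 → u x₁ ≤ 1 → ∀ t ≥ t₀,
      volume (closedBall (0 : En n) 1 \ {x | u x ≤ t}) ≤ ENNReal.ofReal (C * t ^ (-s)) := by
  obtain ⟨M, q, ε₀, C, hM, hq, hq1, hε₀, hC, h⟩ := exists_geometric_decay hn hlam hlL hp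
  have hlM : 0 < Real.log M := Real.log_pos hM
  have hlq : Real.log q < 0 := Real.log_neg hq hq1
  set s := -Real.log q / Real.log M with hs
  have hs0 : 0 < s := div_pos (by linarith) hlM
  refine ⟨s, M, ε₀, C / q ^ 2, hs0, hM, hε₀, by positivity,
    fun u f Ω hΩo hu hu0 hf hP hfε hΩ x₁ hx₁ hux₁ t ht => ?_⟩
  obtain ⟨k, hk1, hk2⟩ := exists_nat_pow_near (ht.le.trans' hM.le) hM
  obtain ⟨j, rfl⟩ : ∃ j, k = j + 1 := Nat.exists_eq_succ_of_ne_zero (by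
    rintro rfl
    simp at hk2
    linarith)
  have ht0 : 0 < t := by linarith
  have hsub : closedBall (0 : En n) 1 \ {x | u x ≤ t} ⊆
      closedBall (0 : En n) 1 \ {x | u x ≤ M ^ (j + 1)} :=
    sdiff_subset_sdiff_right fun x hx => le_trans hx hk1
  refine (measure_mono hsub).trans ((h u f Ω hΩo hu hu0 hf hP hfε hΩ x₁ hx₁ hux₁ j).trans
    (ENNReal.ofReal_le_ofReal ?_))
  have hqM : M ^ (-s) = q := by
    rw [Real.rpow_def_of_pos (by linarith), hs]
    rw [show Real.log M * -(-Real.log q / Real.log M) = Real.log q by field_simp,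
      Real.exp_log hq]
  have h1 : q ^ (j + 2) ≤ t ^ (-s) := by
    rw [← hqM, ← Real.rpow_natCast, ← Real.rpow_mul (by linarith), mul_comm,
      Real.rpow_mul (by linarith), Real.rpow_natCast]
    exact Real.rpow_le_rpow_of_nonpos ht0 hk2.le (by linarith)
  rw [div_mul_eq_mul_div, le_div_iff₀ (by positivity)]
  calc C * q ^ j * q ^ 2 = C * q ^ (j + 2) := by ring
    _ ≤ _ := mul_le_mul_of_nonneg_left h1 hC.le

/-- One step of the blow-up argument: a large value of `u` forces a larger value nearby. -/
lemma exists_lt_of_measure_lt {n : ℕ} (hn : 1 ≤ n) {lam Lam p : ℝ} (hlam : 0 < lam)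
    (hlL : lam ≤ Lam) (hp : 0 ≤ p) :
    ∃ θ μ ε₀ : ℝ, 0 < θ ∧ θ ≤ 1 ∧ 0 < μ ∧ 0 < ε₀ ∧ ∀ (u f : En n → ℝ) (Ω : Set (En n)),
      ContinuousOn u Ω → ContinuousOn f Ω →
      (∀ S, PucciSuper lam Lam p 0 Ω (fun x => S - u x) (fun x => -f x)) →
      ∫⁻ x in Ω, ENNReal.ofReal (|f x| ^ n) ≤ ENNReal.ofReal ε₀ →
      ∀ (x₀ : En n) (r t : ℝ), 0 < r → r ≤ 1 → 1 ≤ θ * t →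
      closedBall x₀ ((102 * n + 5) * r) ⊆ Ω → t < u x₀ →
      volume (closedBall x₀ r \ {x | u x ≤ t / 4}) < ENNReal.ofReal (μ * r ^ n) →
      ∃ x ∈ closedBall x₀ ((102 * n + 5) * r), (1 + θ) * t < u x := by
  obtain ⟨M, μ, ε₀, hM, hμ, hε₀, h⟩ := exists_measure_estimate hn hlam hlL hp
  set θ := 1 / (2 * M) with hθ
  have hθ0 : 0 < θ := by positivity
  have hθM : θ * M = 1 / 2 := by rw [hθ]; field_simp
  refine ⟨θ, μ, ε₀, hθ0, by nlinarith, hμ, hε₀,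
    fun u f Ω hu hf hP hfε x₀ r t hr hr1 ht hball hux hvol => ?_⟩
  by_contra! hle
  have ht0 : 0 < t := by
    by_contra! h0
    nlinarith
  set B := ball x₀ ((102 * n + 5) * r) with hB
  have hBΩ : B ⊆ Ω := ball_subset_closedBall.trans hball
  have key := h (fun x => (1 + θ) * t - u x) (fun x => -f x) B isOpen_ball
    (continuousOn_const.sub (hu.mono hBΩ))
    (fun x hx => sub_nonneg.2 (hle x (ball_subset_closedBall hx)))
    (hf.mono hBΩ).neg ((hP ((1 + θ) * t)).mono hBΩ fun x _ => le_rfl) (by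
      simp only [abs_neg]
      exact (lintegral_mono_set hBΩ).trans hfε) x₀ x₀ r (θ * t) hr hr1 ht
    (closedBall_subset_ball (by nlinarith)) (mem_closedBall_self (by positivity))
    (by linarith)
  have hsub : closedBall x₀ r ∩ {x | (1 + θ) * t - u x ≤ M * (θ * t)} ⊆
      closedBall x₀ r \ {x | u x ≤ t / 4} := by
    refine fun x hx => ⟨hx.1, fun hx2 => ?_⟩
    have h1 : (1 + θ) * t - u x ≤ M * (θ * t) := hx.2
    have h2 : u x ≤ t / 4 := hx2
    have h3 : M * (θ * t) = t / 2 := by rw [← mul_assoc, mul_comm M, hθM]; ring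
    nlinarith
  exact absurd (key.trans (measure_mono hsub)) hvol.not_ge

/-- Upper bound for normalized solutions. -/
lemma exists_local_bound {n : ℕ} (hn : 1 ≤ n) {lam Lam p : ℝ} (hlam : 0 < lam)
    (hlL : lam ≤ Lam) (hp : 0 ≤ p) :
    ∃ T ε₀ : ℝ, 0 < T ∧ 0 < ε₀ ∧ ∀ (u f : En n → ℝ) (Ω : Set (En n)), IsOpen Ω →
      ContinuousOn u Ω → (∀ x ∈ Ω, 0 ≤ u x) → ContinuousOn f Ω → PucciSuper lam Lam p 0 Ω u f →
      (∀ S, PucciSuper lam Lam p 0 Ω (fun x => S - u x) (fun x => -f x)) →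
      ∫⁻ x in Ω, ENNReal.ofReal (|f x| ^ n) ≤ ENNReal.ofReal ε₀ →
      closedBall 0 (102 * n + 4) ⊆ Ω → ∀ x₁ : En n, ‖x₁‖ ≤ 9 → u x₁ ≤ 1 →
      ∀ x ∈ closedBall (0 : En n) (1 / 2), u x ≤ T := by
  obtain ⟨θ, μ, ε₁, hθ, hθ1, hμ, hε₁, hstep⟩ := exists_lt_of_measure_lt hn hlam hlL hp
  obtain ⟨s, t₀, ε₂, C, hs, ht₀, hε₂, hC, hdecay⟩ := exists_power_decay hn hlam hlL hp
  have hn0 : (1 : ℝ) ≤ n := by exact_mod_cast hn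
  set q := (1 + θ) ^ (-s / n) with hq
  have hq0 : 0 < q := by positivity
  have hq1 : q < 1 := Real.rpow_lt_one_of_one_lt_of_neg (by linarith)
    (div_neg_of_neg_of_pos (by linarith) (by linarith))
  have hqn : q ^ n = (1 + θ) ^ (-s) := by
    rw [hq, ← Real.rpow_natCast, ← Real.rpow_mul (by linarith)]
    congr 1
    field_simp
  set κ : ℝ := 102 * n + 5 with hκ
  set ρ := (1 - q) / (4 * κ) with hρ
  have hρ0 : 0 < ρ := div_pos (by linarith) (by positivity)
  have hκρ : κ * ρ = (1 - q) / 4 := by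
    have hκ0 : 0 < κ := by positivity
    rw [hρ]
    field_simp
  have hρ1 : ρ ≤ 1 := by nlinarith
  obtain ⟨T, hT1, hT2, hT3⟩ : ∃ T : ℝ, 1 / θ ≤ T ∧ 4 * t₀ ≤ T ∧
      C * (T / 4) ^ (-s) < μ * ρ ^ n := by
    have h1 : Tendsto (fun T : ℝ => C * (T / 4) ^ (-s)) atTop (𝓝 (C * 0)) :=
      ((tendsto_rpow_neg_atTop hs).comp (tendsto_id.atTop_div_const (by norm_num))).const_mul C
    rw [mul_zero] at h1
    exact ((eventually_ge_atTop _).and ((eventually_ge_atTop _).and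
      (h1.eventually (gt_mem_nhds (by positivity))))).exists
  have hT0 : 0 < T := by linarith
  refine ⟨T, min ε₁ ε₂, hT0, lt_min hε₁ hε₂,
    fun u f Ω hΩo hu hu0 hf hP hP' hfε hΩ x₁ hx₁ hux₁ x hx => ?_⟩
  by_contra! hTx
  have hfε₁ := hfε.trans (ENNReal.ofReal_le_ofReal (min_le_left _ _))
  have hfε₂ := hfε.trans (ENNReal.ofReal_le_ofReal (min_le_right _ _))
  have hiter : ∀ k : ℕ, ∃ z : En n, ‖z‖ ≤ 3 / 4 - q ^ k / 4 ∧ T * (1 + θ) ^ k < u z := by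
    intro k
    induction k with
    | zero =>
      refine ⟨x, ?_, by simpa using hTx⟩
      rw [mem_closedBall_zero_iff] at hx
      rw [pow_zero]
      linarith
    | succ k ih =>
      obtain ⟨z, hz, huz⟩ := ih
      have hqk : 0 < q ^ k := by positivity
      have hqk1 : q ^ k ≤ 1 := pow_le_one₀ hq0.le hq1.le
      have hθk : 1 ≤ (1 + θ) ^ k := one_le_pow₀ (by linarith)
      have hκr : κ * (ρ * q ^ k) = q ^ k / 4 - q ^ (k + 1) / 4 := by
        rw [← mul_assoc, hκρ, pow_succ]; ring
      have hsub : closedBall z (κ * (ρ * q ^ k)) ⊆ closedBall 0 1 := by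
        refine closedBall_subset_closedBall' ?_
        rw [dist_zero_right, hκr]
        have : 0 < q ^ (k + 1) := by positivity
        linarith
      have hsub' : closedBall z (κ * (ρ * q ^ k)) ⊆ Ω :=
        (hsub.trans (closedBall_subset_closedBall (by linarith))).trans hΩ
      have hr0 : 0 < ρ * q ^ k := by positivity
      obtain ⟨z', hz', huz'⟩ := hstep u f Ω hu hf hP' hfε₁ z (ρ * q ^ k) (T * (1 + θ) ^ k) hr0
        (mul_le_one₀ hρ1 hqk.le hqk1) (by
          rw [div_le_iff₀ hθ] at hT1
          nlinarith) hsub' huz (by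
          have h1 := hdecay u f Ω hΩo hu hu0 hf hP hfε₂ hΩ x₁ hx₁ hux₁ (T * (1 + θ) ^ k / 4)
            (by nlinarith)
          have h2 : closedBall z (ρ * q ^ k) ⊆ closedBall 0 1 :=
            (closedBall_subset_closedBall (by nlinarith)).trans hsub
          refine ((measure_mono (sdiff_subset_sdiff_left h2)).trans h1).trans_lt ?_
          rw [ENNReal.ofReal_lt_ofReal_iff (by positivity)]
          have h3 : (T * (1 + θ) ^ k / 4) ^ (-s) = (T / 4) ^ (-s) * (q ^ k) ^ n := by
            rw [mul_div_right_comm, Real.mul_rpow (by positivity) (by positivity), ← pow_mul,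
              mul_comm k n, pow_mul, hqn, ← Real.rpow_natCast, ← Real.rpow_natCast,
              ← Real.rpow_mul (by positivity), ← Real.rpow_mul (by positivity), mul_comm (k : ℝ)]
          rw [h3, mul_pow, ← mul_assoc, ← mul_assoc]
          exact mul_lt_mul_of_pos_right hT3 (by positivity))
      refine ⟨z', ?_, ?_⟩
      · have h1 : ‖z' - z‖ ≤ κ * (ρ * q ^ k) := by rwa [← dist_eq_norm]
        have h2 := norm_le_norm_add_norm_sub' z' z
        linarith
      · rw [pow_succ]
        linarith
  obtain ⟨b, hb⟩ := ((isCompact_closedBall (0 : En n) 1).image_of_continuousOn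
    (hu.mono ((closedBall_subset_closedBall (by linarith)).trans hΩ))).bddAbove
  obtain ⟨k, hk⟩ := pow_unbounded_of_one_lt (b / T) (show 1 < 1 + θ by linarith)
  obtain ⟨z, hz, huz⟩ := hiter k
  have h1 : u z ≤ b := hb ⟨z, by
    rw [mem_closedBall_zero_iff]
    have : 0 < q ^ k := by positivity
    linarith, rfl⟩
  rw [div_lt_iff₀ hT0] at hk
  linarith

/-- Harnack inequality for nearby points of the half ball. -/
lemma exists_harnack_of_dist_le {n : ℕ} (hn : 1 ≤ n) {lam Lam p : ℝ} (hlam : 0 < lam)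
    (hlL : lam ≤ Lam) (hp : 0 ≤ p) :
    ∃ δ K : ℝ, 0 < δ ∧ 0 < K ∧ ∀ u f : En n → ℝ, ContinuousOn u (ball 0 1) →
      (∀ x ∈ ball (0 : En n) 1, 0 ≤ u x) → ContinuousOn f (ball 0 1) →
      PucciSuper lam Lam p 0 (ball 0 1) u f →
      (∀ S, PucciSuper lam Lam p 0 (ball 0 1) (fun x => S - u x) (fun x => -f x)) →
      ∀ F : ℝ, 0 < F →
      ∫⁻ x in ball 0 1, ENNReal.ofReal (|f x| ^ n) ≤ ENNReal.ofReal ((F ^ (p + 1)) ^ n) →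
      ∀ x y : En n, y ∈ ball 0 (1 / 2) → dist x y ≤ δ → u x ≤ K * (u y + F) := by
  obtain ⟨T, ε₀, hT, hε₀, h⟩ := exists_local_bound hn hlam hlL hp
  have hn0 : (0 : ℝ) < n := by exact_mod_cast hn
  set r : ℝ := 1 / (2 * (102 * n + 5)) with hr
  have hr0 : 0 < r := by positivity
  have hr1 : r ≤ 1 := by
    rw [hr, div_le_one (by positivity)]
    linarith
  have hcr : (102 * n + 4) * r ≤ 1 / 2 := by
    rw [hr, mul_one_div, div_le_div_iff₀ (by positivity) (by norm_num)]
    linarith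
  clear_value r
  set e : ℝ := (1 / ε₀) ^ (1 / ((p + 1) * n)) with he
  have he0 : 0 < e := by positivity
  have hen : (e ^ (p + 1)) ^ n = 1 / ε₀ := by
    rw [he, ← Real.rpow_natCast, ← Real.rpow_mul (by positivity), ← Real.rpow_mul (by positivity),
      one_div_mul_cancel (by positivity), Real.rpow_one]
  refine ⟨r / 2, T * (1 + e), by positivity, by positivity,
    fun u f hu hu0 hf hP hP' F hF hfF x y hy hxy => ?_⟩
  have hsub : closedBall y ((102 * n + 4) * r) ⊆ ball 0 1 := by
    refine closedBall_subset_ball' ?_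
    rw [mem_ball] at hy
    linarith
  have hy0 : 0 ≤ u y := hu0 y (hsub (mem_closedBall_self (by positivity)))
  set m := u y + e * F with hm
  have hm0 : 0 < m := by positivity
  set g : En n → En n := fun x => y + r • x with hg
  have hgc : Continuous g := by fun_prop
  have hmaps : MapsTo g (g ⁻¹' ball 0 1) (ball 0 1) := mapsTo_preimage _ _
  have key := h (fun x => u (g x) / m) (fun x => r ^ (p + 2) / m ^ (p + 1) * f (g x))
    (g ⁻¹' ball 0 1) (isOpen_ball.preimage hgc)
    ((hu.comp hgc.continuousOn hmaps).div_const m)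
    (fun x hx => div_nonneg (hu0 _ hx) hm0.le)
    (continuousOn_const.mul (hf.comp hgc.continuousOn hmaps))
    (hP.scale (hlam.le.trans hlL) hp hr0 hr1 hm0 y)
    (fun S => by
      have h1 := (hP' (S * m)).scale (hlam.le.trans hlL) hp hr0 hr1 hm0 y
      simp only [sub_div, mul_div_cancel_right₀ _ hm0.ne', mul_neg] at h1
      exact h1)
    (by
      rw [setLIntegral_comp_add_smul y hr0
        (fun z => ENNReal.ofReal (|r ^ (p + 2) / m ^ (p + 1) * f z| ^ n))]
      have hA : 0 ≤ r ^ (p + 2) / m ^ (p + 1) := by positivity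
      simp only [abs_mul, abs_of_nonneg hA, mul_pow]
      simp only [ENNReal.ofReal_mul (pow_nonneg hA n)]
      rw [lintegral_const_mul' _ _ ENNReal.ofReal_ne_top]
      grw [hfF]
      rw [← ENNReal.ofReal_mul (by positivity), ← ENNReal.ofReal_mul (by positivity)]
      refine ENNReal.ofReal_le_ofReal ?_
      have h1 : (e ^ (p + 1) * F ^ (p + 1)) ^ n ≤ (m ^ (p + 1)) ^ n := by
        rw [← Real.mul_rpow he0.le hF.le]
        gcongr
        linarith
      rw [mul_pow, hen, one_div_mul_eq_div, div_le_iff₀ hε₀] at h1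
      have h2 : (r ^ (p + 2)) ^ n ≤ r ^ n := by
        gcongr
        exact (Real.rpow_le_rpow_of_exponent_ge hr0 hr1 (by linarith)).trans_eq (Real.rpow_one r)
      calc (r ^ n)⁻¹ * ((r ^ (p + 2) / m ^ (p + 1)) ^ n * (F ^ (p + 1)) ^ n)
          = (r ^ (p + 2)) ^ n / r ^ n * ((F ^ (p + 1)) ^ n / (m ^ (p + 1)) ^ n) := by
            rw [div_pow]; ring
        _ ≤ 1 * ε₀ := by
            refine mul_le_mul ((div_le_one (by positivity)).2 h2) ?_ (by positivity) zero_le_one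
            rw [div_le_iff₀ (by positivity)]
            linarith
        _ = ε₀ := one_mul _)
    (by
      rw [← preimage_add_smul_closedBall y hr0]
      exact preimage_mono hsub)
    0 (by norm_num) (by
      simp only [hg, smul_zero, add_zero]
      rw [div_le_one hm0]
      nlinarith [mul_pos he0 hF])
    (r⁻¹ • (x - y)) (by
      rw [mem_closedBall_zero_iff, norm_smul, norm_inv, Real.norm_of_nonneg hr0.le,
        ← dist_eq_norm, inv_mul_le_iff₀ hr0]
      linarith)
  simp only [hg, smul_inv_smul₀ hr0.ne', add_sub_cancel, div_le_iff₀ hm0] at key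
  refine key.trans ?_
  rw [mul_assoc]
  gcongr
  nlinarith

/-- Harnack inequality for arbitrary points of the half ball. -/
lemma exists_harnack {n : ℕ} (hn : 1 ≤ n) {lam Lam p : ℝ} (hlam : 0 < lam)
    (hlL : lam ≤ Lam) (hp : 0 ≤ p) :
    ∃ C : ℝ, 0 < C ∧ ∀ u f : En n → ℝ, ContinuousOn u (ball 0 1) →
      (∀ x ∈ ball (0 : En n) 1, 0 ≤ u x) → ContinuousOn f (ball 0 1) →
      PucciSuper lam Lam p 0 (ball 0 1) u f →
      (∀ S, PucciSuper lam Lam p 0 (ball 0 1) (fun x => S - u x) (fun x => -f x)) →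
      ∀ F : ℝ, 0 < F →
      ∫⁻ x in ball 0 1, ENNReal.ofReal (|f x| ^ n) ≤ ENNReal.ofReal ((F ^ (p + 1)) ^ n) →
      ∀ x ∈ ball (0 : En n) (1 / 2), ∀ y ∈ ball (0 : En n) (1 / 2), u x ≤ C * (u y + F) := by
  obtain ⟨δ, K, hδ, hK, h⟩ := exists_harnack_of_dist_le hn hlam hlL hp
  obtain ⟨N, hN⟩ := exists_nat_gt (1 / δ)
  have hN0 : (0 : ℝ) < N := (by positivity : 0 < 1 / δ).trans hN
  rw [div_lt_iff₀ hδ] at hN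
  refine ⟨(K + 1) ^ N, by positivity, fun u f hu hu0 hf hP hP' F hF hfF x hx y hy => ?_⟩
  set z : ℕ → En n := fun k => AffineMap.lineMap y x ((k : ℝ) / N) with hz
  have hzm : ∀ k ≤ N, z k ∈ ball (0 : En n) (1 / 2) := fun k hk =>
    (convex_ball 0 (1 / 2)).lineMap_mem hy hx
      ⟨by positivity, div_le_one_of_le₀ (by exact_mod_cast hk) hN0.le⟩
  have hdist : dist y x ≤ 1 := by
    rw [mem_ball] at hx hy
    linarith [dist_triangle_right y x 0]
  have hind : ∀ k ≤ N, u (z k) + F ≤ (K + 1) ^ k * (u y + F) := by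
    intro k
    induction k with
    | zero => simp [hz]
    | succ k ih =>
      intro hk
      have h1 := ih (by omega)
      have h2 := h u f hu hu0 hf hP hP' F hF hfF (z (k + 1)) (z k) (hzm k (by omega)) (by
        rw [hz, dist_lineMap_lineMap, Real.dist_eq, ← sub_div, Nat.cast_succ, add_sub_cancel_left,
          abs_of_nonneg (by positivity), one_div_mul_eq_div, div_le_iff₀ hN0]
        linarith)
      have h3 := hu0 (z k) (ball_subset_ball (by norm_num) (hzm k (by omega)))
      calc u (z (k + 1)) + F ≤ (K + 1) * (u (z k) + F) := by linarith
        _ ≤ (K + 1) * ((K + 1) ^ k * (u y + F)) := by gcongr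
        _ = (K + 1) ^ (k + 1) * (u y + F) := by ring
  have h1 := hind N le_rfl
  have h2 : z N = x := by simp [hz, div_self hN0.ne']
  rw [h2] at h1
  linarith

/-- **Harnack inequality** (Theorem 1.2): there is `C > 0`, depending only on `n, λ, Λ, p`,
such that any nonnegative bounded continuous viscosity solution `u` of the degenerate fully
nonlinear pseudo-p-Laplacian inequalities in `B₁` with `f ∈ C ∩ Lⁿ(B₁)` satisfies
`sup_{B_{1/2}} u ≤ C (inf_{B_{1/2}} u + ‖f‖_{Lⁿ(B₁)}^{1/(1+p)})`. -/
theorem harnack_inequality (n : ℕ) (hn : 1 ≤ n) (lam Lam p : ℝ)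
    (hlam : 0 < lam) (hlL : lam ≤ Lam) (hp : 0 ≤ p) :
    ∃ C : ℝ, 0 < C ∧
      ∀ u f : En n → ℝ,
        ContinuousOn u (ball (0 : En n) 1) →
        (∀ x ∈ ball (0 : En n) 1, 0 ≤ u x) →
        BddAbove ((fun x => |u x|) '' ball (0 : En n) 1) →
        ContinuousOn f (ball (0 : En n) 1) →
        IntegrableOn (fun x => |f x| ^ (n : ℝ)) (ball (0 : En n) 1) →
        IsViscSuper lam Lam p (ball (0 : En n) 1) u f →
        IsViscSub lam Lam p (ball (0 : En n) 1) u f →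
        sSup (u '' ball (0 : En n) (1/2)) ≤
          C * (sInf (u '' ball (0 : En n) (1/2))
            + LnNorm f (ball (0 : En n) 1) ^ (1 / (1 + p))) := by
  obtain ⟨C, hC, h⟩ := exists_harnack hn hlam hlL hp
  refine ⟨C, hC, fun u f hu hu0 _ hf hfi hsup hsub => ?_⟩
  have hn0 : (0 : ℝ) < n := by exact_mod_cast hn
  set I := ∫ x in ball (0 : En n) 1, |f x| ^ (n : ℝ) with hI
  have hI0 : 0 ≤ I := integral_nonneg fun x => by positivity
  set F := LnNorm f (ball (0 : En n) 1) ^ (1 / (1 + p)) with hF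
  have hF0 : 0 ≤ F := Real.rpow_nonneg (Real.rpow_nonneg hI0 _) _
  have hFI : (F ^ (p + 1)) ^ n = I := by
    rw [hF, LnNorm, ← hI, ← Real.rpow_natCast, ← Real.rpow_mul (by positivity),
      ← Real.rpow_mul (by positivity), ← Real.rpow_mul hI0]
    convert Real.rpow_one I using 2
    field_simp
    ring
  have hlint : ∫⁻ x in ball (0 : En n) 1, ENNReal.ofReal (|f x| ^ n) = ENNReal.ofReal I := by
    rw [hI, ofReal_integral_eq_lintegral_ofReal hfi
      (Eventually.of_forall fun x => by positivity)]
    simp only [Real.rpow_natCast]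
  have hxy : ∀ x ∈ ball (0 : En n) (1 / 2), ∀ y ∈ ball (0 : En n) (1 / 2),
      u x ≤ C * (u y + F) := by
    intro x hx y hy
    refine le_of_forall_pos_le_add fun τ hτ => ?_
    have h1 := h u f hu hu0 hf (hsup.pucciSuper hlL) (hsub.pucciSuper_const_sub hlL) (F + τ / C)
      (by positivity) (by
        rw [hlint, ← hFI]
        gcongr
        exact le_add_of_nonneg_right (by positivity)) x hx y hy
    have h2 : C * (τ / C) = τ := mul_div_cancel₀ _ hC.ne'
    linarith
  have hne : (u '' ball (0 : En n) (1 / 2)).Nonempty :=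
    (nonempty_ball.2 (by norm_num)).image u
  refine csSup_le hne ?_
  rintro _ ⟨x, hx, rfl⟩
  have h1 : u x / C - F ≤ sInf (u '' ball (0 : En n) (1 / 2)) := by
    refine le_csInf hne ?_
    rintro _ ⟨y, hy, rfl⟩
    have := hxy x hx y hy
    rw [sub_le_iff_le_add, div_le_iff₀ hC]
    linarith
  rw [sub_le_iff_le_add, div_le_iff₀ hC] at h1
  linarith
end
end

section
/- Let E ⊆ F ⊆ [0,1)ⁿ be Lebesgue measurable sets and let 0 < δ < 1. Assume that (i) |E| ≤ δ, and (ii) for every dyadic cube Q of generation m ≥ 1 such that |E ∩ Q| > δ·|Q|, the predecessor of Q is contained in F. Then |E| ≤ δ·|F|. -/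
open MeasureTheory

noncomputable section

/-- The dyadic cube of generation `m` indexed by `k : Fin n → ℤ`, i.e.
`Π_{i=1}^n [k_i·2^{−m}, (k_i+1)·2^{−m})`. -/
def dyadicCube (n : ℕ) (m : ℕ) (k : Fin n → ℤ) : Set (EuclideanSpace ℝ (Fin n)) :=
  {x | ∀ i, (k i : ℝ) * (2:ℝ) ^ (-(m:ℤ)) ≤ x i ∧ x i < ((k i : ℝ) + 1) * (2:ℝ) ^ (-(m:ℤ))}

open Set

/-- The index of the dyadic cube of generation `m` containing `x`. -/
def dyadicIndex {n : ℕ} (m : ℕ) (x : EuclideanSpace ℝ (Fin n)) : Fin n → ℤ :=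
  fun i => ⌊x i * 2 ^ m⌋

lemma mem_dyadicCube_iff {n m : ℕ} {k : Fin n → ℤ} {x : EuclideanSpace ℝ (Fin n)} :
    x ∈ dyadicCube n m k ↔ dyadicIndex m x = k := by
  have h2 : (0 : ℝ) < 2 ^ m := by positivity
  simp only [dyadicCube, mem_ofPred_eq, funext_iff, dyadicIndex, Int.floor_eq_iff, zpow_neg,
    zpow_natCast, ← div_eq_mul_inv, div_le_iff₀ h2, lt_div_iff₀ h2]

lemma mem_dyadicCube_dyadicIndex {n : ℕ} (m : ℕ) (x : EuclideanSpace ℝ (Fin n)) :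
    x ∈ dyadicCube n m (dyadicIndex m x) :=
  mem_dyadicCube_iff.2 rfl

lemma dyadicIndex_eq_div {n j m : ℕ} (h : j ≤ m) (x : EuclideanSpace ℝ (Fin n)) :
    dyadicIndex j x = fun i => dyadicIndex m x i / 2 ^ (m - j) := by
  obtain ⟨d, rfl⟩ := Nat.exists_eq_add_of_le h
  funext i
  have := Int.floor_div_natCast (x i * 2 ^ (j + d)) (2 ^ d)
  have h2 : (2 : ℝ) ^ d ≠ 0 := by positivity
  simp only [dyadicIndex, Nat.add_sub_cancel_left]
  push_cast at this
  rw [← this, pow_add, ← mul_assoc, mul_div_cancel_right₀ _ h2]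

lemma measurableSet_dyadicCube (n m : ℕ) (k : Fin n → ℤ) : MeasurableSet (dyadicCube n m k) := by
  have : dyadicCube n m k = ⋂ i, {x | (k i : ℝ) * (2:ℝ) ^ (-(m:ℤ)) ≤ x i} ∩
      {x | x i < ((k i : ℝ) + 1) * (2:ℝ) ^ (-(m:ℤ))} := by
    ext x
    simp [dyadicCube]
  rw [this]
  exact MeasurableSet.iInter fun i =>
    (measurableSet_le measurable_const (by fun_prop)).inter
      (measurableSet_lt (by fun_prop) measurable_const)

lemma volume_dyadicCube_zero (n : ℕ) : volume (dyadicCube n 0 0) = 1 := by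
  have : dyadicCube n 0 0 = WithLp.ofLp ⁻¹' (univ.pi fun _ => Ico (0 : ℝ) 1) := by
    ext x
    simp [dyadicCube, Set.mem_pi]
  rw [this, (PiLp.volume_preserving_ofLp (Fin n)).measure_preimage
    (MeasurableSet.univ_pi fun _ => measurableSet_Ico).nullMeasurableSet, volume_pi_pi]
  simp

lemma exists_dyadicCube_subset {n : ℕ} {U : Set (EuclideanSpace ℝ (Fin n))} (hU : IsOpen U)
    {x : EuclideanSpace ℝ (Fin n)} (hx : x ∈ U) :
    ∃ m, dyadicCube n m (dyadicIndex m x) ⊆ U := by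
  have hV : IsOpen (WithLp.toLp 2 ⁻¹' U : Set (Fin n → ℝ)) :=
    hU.preimage (PiLp.continuous_toLp 2 _)
  obtain ⟨ε, hε, hball⟩ := Metric.isOpen_iff.1 hV (WithLp.ofLp x) hx
  obtain ⟨m, hm⟩ := exists_pow_lt_of_lt_one hε (by norm_num : (1 / 2 : ℝ) < 1)
  refine ⟨m, fun y hy => hball (a := WithLp.ofLp y) ?_⟩
  rw [Metric.mem_ball, dist_pi_lt_iff hε]
  intro i
  obtain ⟨h1, h2⟩ := hy i
  obtain ⟨h3, h4⟩ := mem_dyadicCube_dyadicIndex m x i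
  rw [zpow_neg, zpow_natCast, ← inv_pow, ← one_div] at *
  rw [Real.dist_eq, abs_lt]
  constructor <;> linarith

/-- Dyadic covering: if almost every point of `A` lies in a dyadic cube contained in `G` in which
`A` has density at most `c`, then `|A| ≤ c * |G|`. -/
lemma volume_le_mul_of_dyadicCube {n : ℕ} {c : ENNReal} {A G : Set (EuclideanSpace ℝ (Fin n))}
    (h : ∀ᵐ x, x ∈ A → ∃ m, dyadicCube n m (dyadicIndex m x) ⊆ G ∧
      volume (A ∩ dyadicCube n m (dyadicIndex m x)) ≤
        c * volume (dyadicCube n m (dyadicIndex m x))) :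
    volume A ≤ c * volume G := by
  classical
  let P : ℕ → (Fin n → ℤ) → Prop := fun m k =>
    dyadicCube n m k ⊆ G ∧ volume (A ∩ dyadicCube n m k) ≤ c * volume (dyadicCube n m k)
  let C : Set (ℕ × (Fin n → ℤ)) :=
    {p | P p.1 p.2 ∧ ∀ j < p.1, ¬ P j fun i => p.2 i / 2 ^ (p.1 - j)}
  let Q : C → Set (EuclideanSpace ℝ (Fin n)) := fun p => dyadicCube n p.1.1 p.1.2
  have hdisj : Pairwise (Function.onFun Disjoint Q) := by
    rintro ⟨⟨m, k⟩, hk, hk'⟩ ⟨⟨m', k'⟩, hl, hl'⟩ hne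
    refine Set.disjoint_left.2 fun x hx hx' => hne ?_
    obtain rfl : dyadicIndex m x = k := mem_dyadicCube_iff.1 hx
    obtain rfl : dyadicIndex m' x = k' := mem_dyadicCube_iff.1 hx'
    obtain hlt | heq | hlt := lt_trichotomy m m'
    · exact absurd (dyadicIndex_eq_div hlt.le x ▸ hk) (hl' m hlt)
    · subst heq
      rfl
    · exact absurd (dyadicIndex_eq_div hlt.le x ▸ hl) (hk' m' hlt)
  have hcover : ∀ᵐ x, x ∈ A → x ∈ ⋃ p, A ∩ Q p := by
    filter_upwards [h] with x hx hxA
    have hex : ∃ m, P m (dyadicIndex m x) := hx hxA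
    refine mem_iUnion.2 ⟨⟨(Nat.find hex, dyadicIndex (Nat.find hex) x), Nat.find_spec hex,
      fun j hj => ?_⟩, hxA, mem_dyadicCube_dyadicIndex _ x⟩
    have := Nat.find_min hex hj
    rwa [dyadicIndex_eq_div hj.le x] at this
  calc volume A ≤ volume (⋃ p, A ∩ Q p) := measure_mono_ae hcover
    _ ≤ ∑' p, volume (A ∩ Q p) := measure_iUnion_le _
    _ ≤ ∑' p, c * volume (Q p) := ENNReal.tsum_le_tsum fun p => p.2.1.2
    _ = c * volume (⋃ p, Q p) := by
      rw [ENNReal.tsum_mul_left, measure_iUnion hdisj fun p => measurableSet_dyadicCube _ _ _]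
    _ ≤ c * volume G := by
      gcongr
      exact iUnion_subset fun p => p.2.1.1

/-- A dyadic form of the Lebesgue density theorem. -/
lemma ae_exists_lt_volume_inter_dyadicCube {n : ℕ} {c : ENNReal} (hc0 : c ≠ 0) (hc1 : c < 1)
    {E : Set (EuclideanSpace ℝ (Fin n))} (hE : volume E ≠ ⊤) :
    ∀ᵐ x, x ∈ E → ∃ m, c * volume (dyadicCube n m (dyadicIndex m x)) <
      volume (E ∩ dyadicCube n m (dyadicIndex m x)) := by
  set B := {x | ¬ (x ∈ E → ∃ m, c * volume (dyadicCube n m (dyadicIndex m x)) <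
      volume (E ∩ dyadicCube n m (dyadicIndex m x)))} with hB
  change volume B = 0
  have hBE : B ⊆ E := fun x hx => by
    by_contra hxE
    exact hx fun h => absurd h hxE
  have hBtop : volume B ≠ ⊤ := ((measure_mono hBE).trans_lt hE.lt_top).ne
  by_contra hB0
  have hlt : volume B < volume B / c := by
    rw [ENNReal.lt_div_iff_mul_lt (Or.inl hc0) (Or.inl (hc1.trans ENNReal.one_lt_top).ne)]
    calc volume B * c < volume B * 1 := (ENNReal.mul_lt_mul_iff_right hB0 hBtop).2 hc1
      _ = volume B := mul_one _
  obtain ⟨U, hBU, hU, hUlt⟩ := B.exists_isOpen_lt_of_lt _ hlt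
  have hle : volume B ≤ c * volume U := by
    refine volume_le_mul_of_dyadicCube (Filter.Eventually.of_forall fun x hx => ?_)
    obtain ⟨m, hm⟩ := exists_dyadicCube_subset hU (hBU hx)
    refine ⟨m, hm, (measure_mono (inter_subset_inter_left _ hBE)).trans ?_⟩
    by_contra! hcon
    exact hx fun _ => ⟨m, hcon⟩
  rw [ENNReal.lt_div_iff_mul_lt (Or.inl hc0) (Or.inl (hc1.trans ENNReal.one_lt_top).ne),
    mul_comm] at hUlt
  exact hle.not_gt hUlt

/-- **Calderón–Zygmund cube decomposition** (Lemma 2.4): if `E ⊆ F ⊆ [0,1)ⁿ` are measurable,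
`0 < δ < 1`, `|E| ≤ δ`, and every dyadic cube `Q` (of generation `m ≥ 1`) with
`|E ∩ Q| > δ|Q|` has its predecessor contained in `F`, then `|E| ≤ δ|F|`. -/
theorem calderon_zygmund (n : ℕ) (hn : 1 ≤ n) (δ : ℝ) (hδ0 : 0 < δ) (hδ1 : δ < 1)
    (E F : Set (EuclideanSpace ℝ (Fin n)))
    (hEmeas : MeasurableSet E) (hFmeas : MeasurableSet F)
    (hEF : E ⊆ F) (hFQ : F ⊆ dyadicCube n 0 0)
    (hEsmall : volume E ≤ ENNReal.ofReal δ)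
    (hdyadic : ∀ m : ℕ, 1 ≤ m → ∀ k : Fin n → ℤ, (∀ i, 0 ≤ k i ∧ k i < 2 ^ m) →
      ENNReal.ofReal δ * volume (dyadicCube n m k) < volume (E ∩ dyadicCube n m k) →
      dyadicCube n (m - 1) (fun i => k i / 2) ⊆ F) :
    volume E ≤ ENNReal.ofReal δ * volume F := by
  classical
  have hae := ae_exists_lt_volume_inter_dyadicCube (c := ENNReal.ofReal δ)
    (ENNReal.ofReal_pos.2 hδ0).ne' (ENNReal.ofReal_lt_one.2 hδ1)
    (hEsmall.trans_lt ENNReal.ofReal_lt_top).ne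
  refine volume_le_mul_of_dyadicCube ?_
  filter_upwards [hae] with x hx hxE
  have hex := hx hxE
  have hzero : dyadicIndex 0 x = 0 := mem_dyadicCube_iff.1 (hFQ (hEF hxE))
  have hspec := Nat.find_spec hex
  have hmin := fun j => Nat.find_min hex (m := j)
  generalize Nat.find hex = m at hspec hmin
  obtain _ | m := m
  · rw [hzero, volume_dyadicCube_zero, mul_one] at hspec
    exact absurd hspec ((measure_mono inter_subset_left).trans hEsmall).not_gt
  refine ⟨m, ?_, not_lt.1 (hmin m m.lt_succ_self)⟩
  have hsub := hdyadic (m + 1) (Nat.le_add_left 1 m) (dyadicIndex (m + 1) x) (fun i => ?_) hspec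
  · rw [dyadicIndex_eq_div m.le_succ x]
    simpa using hsub
  · obtain ⟨h0, h1⟩ := hFQ (hEF hxE) i
    have h2 : (0 : ℝ) < 2 ^ (m + 1) := by positivity
    simp only [Pi.zero_apply, Int.cast_zero, zero_mul, zero_add, one_mul, Nat.cast_zero,
      neg_zero, zpow_zero] at h0 h1
    refine ⟨Int.floor_nonneg.2 (mul_nonneg h0 h2.le), Int.floor_lt.2 ?_⟩
    push_cast
    exact mul_lt_of_lt_one_left h2 h1
end
end

section
/- For every x ∈ ℝⁿ with x_i ≠ 0 for all i ∈ {1,…,n}, one has −((1+p)/K^{1+p})·D_p(Dφ(x))·D²φ(x)·D_p(Dφ(x)) = I_n, where I_n is the n×n identity matrix. -/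
noncomputable section

/-- The anisotropic `paraboloid` `φ(x) = −K·((1+p)/(2+p))·Σᵢ |xᵢ|^{1+1/(1+p)}`. -/
noncomputable def phi (n : ℕ) (K p : ℝ) (x : En n) : ℝ :=
  -K * ((1 + p) / (2 + p)) * ∑ i, |x i| ^ (1 + 1 / (1 + p))

theorem hasDerivAt_abs_rpow_mul_self_s11 (r : ℝ) {t : ℝ} (ht : t ≠ 0) :
    HasDerivAt (fun s : ℝ => |s| ^ r * s) ((r + 1) * |t| ^ r) t := by
  have h := ((hasDerivAt_abs ht).rpow_const (p := r) (Or.inl (abs_ne_zero.mpr ht))).mul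
    (hasDerivAt_id t)
  refine h.congr_deriv ?_
  have hsign : (SignType.sign t : ℝ) * t = |t| := sign_mul_self t
  have hpow : |t| ^ (r - 1) * |t| = |t| ^ r := by
    rw [← Real.rpow_add_one (abs_ne_zero.mpr ht)]
    ring_nf
  simp only [id_eq]
  linear_combination r * |t| ^ (r - 1) * hsign + r * hpow

theorem hasFDerivAt_coord {n : ℕ} (i : Fin n) (x : En n) :
    HasFDerivAt (fun y : En n => y i) (EuclideanSpace.proj i : En n →L[ℝ] ℝ) x :=
  (EuclideanSpace.proj i : En n →L[ℝ] ℝ).hasFDerivAt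

theorem gradVec_phi {n : ℕ} (K : ℝ) {p : ℝ} (hp : 0 ≤ p) (x : En n) (j : Fin n) :
    gradVec (phi n K p) x j = -K * (|x j| ^ (1 / (1 + p) - 1) * x j) := by
  have hs : 1 < 1 + 1 / (1 + p) := by
    have : 0 < 1 / (1 + p) := by positivity
    linarith
  have h : HasFDerivAt (phi n K p) _ x :=
    (HasFDerivAt.fun_sum (u := Finset.univ) fun i _ =>
      (hasDerivAt_abs_rpow (x i) hs).comp_hasFDerivAt x (hasFDerivAt_coord i x)).const_mul
        (-K * ((1 + p) / (2 + p)))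
  have he : 1 + 1 / (1 + p) - 2 = 1 / (1 + p) - 1 := by ring
  have h1 : 1 + p ≠ 0 := by positivity
  have h2 : 2 + p ≠ 0 := by positivity
  have hc : (1 + p) / (2 + p) * (1 + 1 / (1 + p)) = 1 := by
    field_simp
    ring
  rw [gradVec, h.fderiv, he]
  simp only [smul_apply, sum_apply, PiLp.proj_apply,
    PiLp.single_apply, smul_eq_mul, mul_ite, mul_one, mul_zero,
    Finset.sum_ite_eq', Finset.mem_univ, if_true]
  linear_combination -K * |x j| ^ (1 / (1 + p) - 1) * x j * hc

theorem hessMat_phi {n : ℕ} (K : ℝ) {p : ℝ} (hp : 0 ≤ p) (x : En n) (hx : ∀ i, x i ≠ 0) :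
    hessMat (phi n K p) x =
      Matrix.diagonal fun i => -K * (1 / (1 + p) * |x i| ^ (1 / (1 + p) - 1)) := by
  ext i j
  have hgrad : (fun y => fderiv ℝ (phi n K p) y (EuclideanSpace.single j 1)) =
      fun y : En n => -K * (|y j| ^ (1 / (1 + p) - 1) * y j) :=
    funext fun y => gradVec_phi K hp y j
  have h : HasFDerivAt (fun y : En n => -K * (|y j| ^ (1 / (1 + p) - 1) * y j)) _ x :=
    ((hasDerivAt_abs_rpow_mul_self_s11 (1 / (1 + p) - 1) (hx j)).comp_hasFDerivAt x
      (hasFDerivAt_coord j x)).const_mul (-K)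
  rw [hessMat, Matrix.of_apply, hgrad, h.fderiv]
  by_cases hij : i = j
  · subst hij
    simp
  · simp [hij, Ne.symm hij]

/-- The key identity for the anisotropic paraboloid:
`−((1+p)/K^{1+p})·D_p(Dφ(x))·D²φ(x)·D_p(Dφ(x)) = Iₙ` at every point all of whose coordinates
are nonzero. -/
theorem phi_identity (n : ℕ) (hn : 1 ≤ n) (K p : ℝ) (hK : 0 < K) (hp : 0 ≤ p)
    (x : En n) (hx : ∀ i, x i ≠ 0) :
    (-((1 + p) / K ^ (1 + p))) •
        (Dp p (gradVec (phi n K p) x) * hessMat (phi n K p) x * Dp p (gradVec (phi n K p) x))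
      = (1 : Matrix (Fin n) (Fin n) ℝ) := by
  have h1 : 1 + p ≠ 0 := by positivity
  have hKp : K ^ (1 + p) ≠ 0 := (Real.rpow_pos_of_pos hK _).ne'
  rw [hessMat_phi K hp x hx, Dp, Matrix.diagonal_mul_diagonal, Matrix.diagonal_mul_diagonal,
    ← Matrix.diagonal_smul, ← Matrix.diagonal_one]
  congr 1
  funext i
  have ht : 0 < |x i| := abs_pos.mpr (hx i)
  have hgrad : |gradVec (phi n K p) x i| = K * |x i| ^ (1 / (1 + p)) := by
    rw [gradVec_phi K hp, abs_mul, abs_neg, abs_of_pos hK, abs_mul,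
      abs_of_pos (Real.rpow_pos_of_pos ht _), ← Real.rpow_add_one ht.ne', sub_add_cancel]
  have hsq : |gradVec (phi n K p) x i| ^ (p / 2) * |gradVec (phi n K p) x i| ^ (p / 2) =
      K ^ p * |x i| ^ (1 / (1 + p) * p) := by
    have hpos : 0 < |gradVec (phi n K p) x i| := by
      rw [hgrad]
      positivity
    rw [← Real.rpow_add hpos, add_halves, hgrad,
      Real.mul_rpow hK.le (Real.rpow_nonneg ht.le _), ← Real.rpow_mul ht.le]
  have hone : |x i| ^ (1 / (1 + p) * p) * |x i| ^ (1 / (1 + p) - 1) = 1 := by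
    rw [← Real.rpow_add ht]
    convert Real.rpow_zero |x i| using 2
    field_simp
    ring
  have hK1 : K * K ^ p = K ^ (1 + p) := by
    rw [Real.rpow_add hK, Real.rpow_one]
  calc
    _ = (1 + p) / K ^ (1 + p) * (K * (1 / (1 + p)) * |x i| ^ (1 / (1 + p) - 1) *
        (|gradVec (phi n K p) x i| ^ (p / 2) * |gradVec (phi n K p) x i| ^ (p / 2))) := by
      simp only [Pi.smul_apply, smul_eq_mul]
      ring
    _ = (1 + p) / K ^ (1 + p) * (1 / (1 + p)) * (K * K ^ p) *
        (|x i| ^ (1 / (1 + p) * p) * |x i| ^ (1 / (1 + p) - 1)) := by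
      rw [hsq]
      ring
    _ = 1 := by
      rw [hone, hK1]
      field_simp
end
end
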